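/- Let d ≥ 4 and 1 ≤ p < 2(d−1)/(d+1). Then for every 0 ≤ u < 1 and every function f : ℕ × ℝ^d → ℂ, ‖ Σ_{n≥2} K_{n+u} ∗ f(n,·) ‖_{L^p(ℝ^d)}^p ≤ C Σ_{n≥2} (1+n)^{p(d−1)(1/p − 1/2)} ∫_{ℝ^d} |f(n,y)|^p dy, with a constant C independent of u and f. -/

import Mathlib

open MeasureTheory Real Set
open scoped Classical FourierTransform RealInnerProductSpace NNReal ENNReal

noncomputable section

/-- Euclidean space `ℝ^d`. -/
abbrev Rd (d : ℕ) := EuclideanSpace ℝ (Fin d)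

/-- `a` is a "distance function": smooth away from the origin, positive away from the
origin, and homogeneous of degree one. -/
structure IsDistFn {d : ℕ} (a : Rd d → ℝ) : Prop where
  smooth : ContDiffOn ℝ (⊤ : ℕ∞) a {ξ : Rd d | ξ ≠ 0}
  pos : ∀ ξ : Rd d, ξ ≠ 0 → 0 < a ξ
  homog : ∀ t : ℝ, 0 < t → ∀ ξ : Rd d, a (t • ξ) = t * a ξ

/-- Nonvanishing Gaussian curvature of the cosphere `Σ = {a = 1}`: at every point `ξ` of `Σ`
the second fundamental form, i.e. the Hessian of `a` restricted to the tangent space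
`ker (da(ξ))`, is nondegenerate. -/
def CurvNondeg {d : ℕ} (a : Rd d → ℝ) : Prop :=
  ∀ ξ : Rd d, a ξ = 1 → ∀ v : Rd d, fderiv ℝ a ξ v = 0 → v ≠ 0 →
    ∃ w : Rd d, fderiv ℝ a ξ w = 0 ∧ iteratedFDeriv ℝ 2 a ξ ![v, w] ≠ 0

/-- The bump function `η`: smooth, supported in `[1/8,8]`, equal to `1` on `[1/4,4]`. -/
structure IsBump (η : ℝ → ℝ) : Prop where
  smooth : ContDiff ℝ (⊤ : ℕ∞) η
  supp : ∀ x : ℝ, x ∉ Icc (1/8 : ℝ) 8 → η x = 0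
  one : ∀ x ∈ Icc (1/4 : ℝ) 4, η x = 1

/-- The kernel `K_r`, given by the inverse Fourier transform of `ξ ↦ η(a(ξ)) e^{i r a(ξ)}`. -/
def Kker {d : ℕ} (a : Rd d → ℝ) (η : ℝ → ℝ) (r : ℝ) (x : Rd d) : ℂ :=
  ∫ ξ : Rd d, (η (a ξ) : ℂ) * Complex.exp (Complex.I * r * a ξ) *
    Complex.exp (2 * π * Complex.I * (inner ℝ x ξ : ℝ))

/-- Convolution `K ∗ b`. -/
def conv {d : ℕ} (K b : Rd d → ℂ) (x : Rd d) : ℂ := ∫ y, K (x - y) * b y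

/-- The measure `ν_d` on `ℝ`, `dν_d(r) = (1+|r|)^{d-1} dr`. -/
def nuMeas (d : ℕ) : Measure ℝ :=
  volume.withDensity fun r => ENNReal.ofReal ((1 + |r|) ^ (d - 1))

/-- The Lorentz quasinorm `‖f‖_{L^{p,q}(μ)}`. -/
def lorentzNorm {α : Type*} {E : Type*} [MeasurableSpace α] [NormedAddCommGroup E]
    (μ : Measure α) (p : ℝ) (q : ℝ≥0∞) (f : α → E) : ℝ≥0∞ :=
  if q = ∞ then ⨆ t : ℝ, ENNReal.ofReal t * μ {x | t < ‖f x‖} ^ (1 / p)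
  else (∫⁻ t in Ioi (0 : ℝ),
      (ENNReal.ofReal t * μ {x | t < ‖f x‖} ^ (1 / p)) ^ q.toReal / ENNReal.ofReal t) ^
      (1 / q.toReal)

/-- The unit cube `q_z = ∏ [z_i, z_i + 1)`. -/
def qcube (d : ℕ) (z : Fin d → ℤ) : Set (Rd d) :=
  {y : Rd d | ∀ i, (z i : ℝ) ≤ y i ∧ y i < z i + 1}

/-- A normalized function `b_{n,z}`: measurable, bounded by the characteristic
function of `q_z`. -/
def IsNormalized {d : ℕ} (z : Fin d → ℤ) (b : Rd d → ℂ) : Prop :=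
  Measurable b ∧ (∀ y, ‖b y‖ ≤ 1) ∧ ∀ y ∉ qcube d z, b y = 0

/-- A dyadic cube of side length `2^k`, `1 ≤ k ≤ j`, in the tiling of
`[2^j, 2^{j+1}) × ℝ^d`. -/
structure DyCube (d j : ℕ) where
  k : ℕ
  m : ℤ
  zv : Fin d → ℤ
  hk : 1 ≤ k ∧ k ≤ j
  hm : (2:ℤ) ^ (j - k) ≤ m ∧ m < 2 ^ (j + 1 - k)

/-- side length of a dyadic cube -/
def DyCube.len {d j : ℕ} (Q : DyCube d j) : ℝ := 2 ^ Q.k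

/-- a dyadic cube as a subset of `ℝ^{1+d}` -/
def DyCube.toSet {d j : ℕ} (Q : DyCube d j) : Set (ℝ × (Fin d → ℝ)) :=
  {p | ((Q.m : ℝ) * 2 ^ Q.k ≤ p.1 ∧ p.1 < (Q.m + 1) * 2 ^ Q.k) ∧
    ∀ i, (Q.zv i : ℝ) * 2 ^ Q.k ≤ p.2 i ∧ p.2 i < (Q.zv i + 1) * 2 ^ Q.k}

/-- center of a dyadic cube: the `r`-coordinate -/
def DyCube.centerT {d j : ℕ} (Q : DyCube d j) : ℝ := ((Q.m : ℝ) + 1/2) * 2 ^ Q.k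

/-- center of a dyadic cube: the `y`-coordinate -/
def DyCube.centerX {d j : ℕ} (Q : DyCube d j) : Rd d :=
  WithLp.toLp 2 fun i => ((Q.zv i : ℝ) + 1/2) * 2 ^ Q.k

/-- a point `(n,z) ∈ ℕ × ℤ^d` viewed as a point of `ℝ^{1+d}` -/
def embedPt (d : ℕ) (e : ℕ × (Fin d → ℤ)) : ℝ × (Fin d → ℝ) :=
  ((e.1 : ℝ), fun i => (e.2 i : ℝ))

/-- the number of points of `E` lying in the cube `Q` -/
def cubeCount {d j : ℕ} (E : Finset (ℝ × (Fin d → ℝ))) (Q : DyCube d j) : ℕ :=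
  (E.filter (· ∈ Q.toSet)).card

/-- `Q` is `λ`-dense: `#(E ∩ Q) > λ^p l(Q)` -/
def IsDense {d j : ℕ} (E : Finset (ℝ × (Fin d → ℝ))) (lam p : ℝ) (Q : DyCube d j) : Prop :=
  lam ^ p * Q.len < (cubeCount E Q : ℝ)

/-- `Q` is a maximal `λ`-dense dyadic cube -/
def IsMaxDense {d j : ℕ} (E : Finset (ℝ × (Fin d → ℝ))) (lam p : ℝ) (Q : DyCube d j) : Prop :=
  IsDense E lam p Q ∧
    ∀ Q' : DyCube d j, IsDense E lam p Q' → Q.toSet ⊆ Q'.toSet → Q'.toSet = Q.toSet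

/-- a lattice vector viewed as an element of `ℝ^d` -/
def latticeVec (d : ℕ) (z : Fin d → ℤ) : Rd d := WithLp.toLp 2 fun i => (z i : ℝ)

/-- The structural properties of the phase function `ψ = -ψ₋`: Lipschitz with constant `L`,
comparable to the norm, and homogeneous of degree one. -/
structure IsPsi {d : ℕ} (ψ : Rd d → ℝ) (L c₁ c₂ : ℝ) : Prop where
  lip : LipschitzWith (Real.toNNReal L) ψ
  lower : ∀ x : Rd d, c₁ * ‖x‖ ≤ ψ x
  upper : ∀ x : Rd d, ψ x ≤ c₂ * ‖x‖
  homog : ∀ t : ℝ, 0 < t → ∀ x : Rd d, ψ (t • x) = t * ψ x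

/-- The stationary phase kernel estimate for `K_r`, `r ≥ 2`:
`|K_r(x)| ≤ C_N (1+|x|+|r|)^{-(d-1)/2} (1+|ψ(x)-r|)^{-N}`. -/
def KernelEst {d : ℕ} (a : Rd d → ℝ) (η : ℝ → ℝ) (ψ : Rd d → ℝ) : Prop :=
  ∀ N : ℕ, ∃ C : ℝ, 0 < C ∧ ∀ r : ℝ, 2 ≤ r → ∀ x : Rd d,
    ‖Kker a η r x‖ ≤ C * (1 + ‖x‖ + |r|) ^ (-(((d:ℝ) - 1) / 2)) * (1 + |ψ x - r|) ^ (-(N : ℝ))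

/-- The two-sided stationary phase kernel estimate for `K_r`, `|r| ≥ 2`, with the
two phase functions `ψ₊`, `ψ₋`:
`|K_r(x)| ≤ C_N (1+|x|+|r|)^{-(d-1)/2} ∑_± (1+|ψ_±(x)+r|)^{-N}`. -/
def KernelEstPM {d : ℕ} (a : Rd d → ℝ) (η : ℝ → ℝ) (ψp ψm : Rd d → ℝ) : Prop :=
  ∀ N : ℕ, ∃ C : ℝ, 0 < C ∧ ∀ r : ℝ, 2 ≤ |r| → ∀ x : Rd d,
    ‖Kker a η r x‖ ≤ C * (1 + ‖x‖ + |r|) ^ (-(((d:ℝ) - 1) / 2)) *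
      ((1 + |ψp x + r|) ^ (-(N : ℝ)) + (1 + |ψm x + r|) ^ (-(N : ℝ)))

open Filter Topology in
/-- A distance function agrees, on a given shell, with a smooth compactly supported function. -/
theorem IsDistFn.exists_extension {d : ℕ} {a : Rd d → ℝ} (ha : IsDistFn a) (R : ℝ) (hR : 1 ≤ R) :
    ∃ b : Rd d → ℝ, ContDiff ℝ (⊤ : ℕ∞) b ∧ HasCompactSupport b ∧
      ∀ ξ : Rd d, R⁻¹ ≤ ‖ξ‖ → ‖ξ‖ ≤ R → b =ᶠ[𝓝 ξ] a := by
  have hR0 : 0 < R := by linarith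
  let χ : Rd d → ℝ := fun ξ => Real.smoothTransition (4 * R ^ 2 * ‖ξ‖ ^ 2 - 1) *
    Real.smoothTransition (4 - ‖ξ‖ ^ 2 / R ^ 2)
  have hχ : ContDiff ℝ (⊤ : ℕ∞) χ := by
    have h : ContDiff ℝ (⊤ : ℕ∞) fun ξ : Rd d => ‖ξ‖ ^ 2 := contDiff_norm_sq ℝ
    refine ContDiff.mul (Real.smoothTransition.contDiff.comp ?_)
      (Real.smoothTransition.contDiff.comp ?_)
    · fun_prop
    · fun_prop
  refine ⟨fun ξ => χ ξ * a ξ, ?_, ?_, ?_⟩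
  · rw [contDiff_iff_contDiffAt]
    intro ξ
    by_cases hξ : ξ = 0
    · have : (fun ξ => χ ξ * a ξ) =ᶠ[𝓝 ξ] fun _ => 0 := by
        have : Tendsto (fun ξ : Rd d => 4 * R ^ 2 * ‖ξ‖ ^ 2 - 1) (𝓝 ξ)
            (𝓝 (4 * R ^ 2 * ‖ξ‖ ^ 2 - 1)) := (by fun_prop : Continuous _).tendsto _
        filter_upwards [this.eventually_lt_const (u := 0) (by simp [hξ])] with ζ hζ
        simp [χ, Real.smoothTransition.zero_of_nonpos hζ.le]
      exact contDiffAt_const.congr_of_eventuallyEq this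
    · exact hχ.contDiffAt.mul (ha.smooth.contDiffAt (isOpen_ne.mem_nhds hξ))
  · refine HasCompactSupport.intro (isCompact_closedBall (0 : Rd d) (2 * R)) ?_
    intro ξ hξ
    have h1 : 2 * R < ‖ξ‖ := by simpa using hξ
    have : Real.smoothTransition (4 - ‖ξ‖ ^ 2 / R ^ 2) = 0 := by
      apply Real.smoothTransition.zero_of_nonpos
      have : 4 ≤ ‖ξ‖ ^ 2 / R ^ 2 := by
        rw [le_div_iff₀ (by positivity)]
        nlinarith
      linarith
    simp [χ, this]
  · intro ξ h1 h2
    have e1 : Tendsto (fun ξ : Rd d => 4 * R ^ 2 * ‖ξ‖ ^ 2 - 1) (𝓝 ξ)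
            (𝓝 (4 * R ^ 2 * ‖ξ‖ ^ 2 - 1)) := (by fun_prop : Continuous _).tendsto _
    have e2 : Tendsto (fun ξ : Rd d => 4 - ‖ξ‖ ^ 2 / R ^ 2) (𝓝 ξ)
            (𝓝 (4 - ‖ξ‖ ^ 2 / R ^ 2)) := (by fun_prop : Continuous _).tendsto _
    have h1' : 1 ≤ R * ‖ξ‖ := by
      have := mul_le_mul_of_nonneg_left h1 hR0.le
      rwa [mul_inv_cancel₀ hR0.ne'] at this
    have h2' : ‖ξ‖ ^ 2 / R ^ 2 ≤ 1 := by
      rw [div_le_one (by positivity)]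
      gcongr
    filter_upwards [e1.eventually_const_lt (u := 1) (by nlinarith),
      e2.eventually_const_lt (u := 1) (by linarith)] with ζ k1 k2
    simp [χ, Real.smoothTransition.one_of_one_le k1.le, Real.smoothTransition.one_of_one_le k2.le]

/-- Rapid decay of the Fourier transform, uniform in a parameter: if `F θ` is smooth in
`(θ, z)` and supported in a fixed compact set of `z`. -/
theorem exists_fourier_decay {Θ E : Type*} [NormedAddCommGroup Θ] [NormedSpace ℝ Θ]
    [NormedAddCommGroup E] [NormedSpace ℝ E] [FiniteDimensional ℝ E] [MeasurableSpace E]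
    [BorelSpace E] (μ : Measure E) [μ.IsAddHaarMeasure] {Θ₀ : Set Θ} (hΘ : IsCompact Θ₀)
    {K : Set E} (hK : IsCompact K) (u : E) (N : ℕ) (F : Θ × E → ℂ)
    (hF : ContDiff ℝ (⊤ : ℕ∞) F) (hsupp : ∀ θ, ∀ z ∉ K, F (θ, z) = 0) :
    ∃ C : ℝ, ∀ θ ∈ Θ₀, ∀ L : E →L[ℝ] ℝ,
      |L u| ^ N * ‖∫ z, F (θ, z) * Complex.exp (Complex.I * (L z : ℂ)) ∂μ‖ ≤ C := by
  induction N generalizing F with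
  | zero =>
    obtain ⟨M, hM⟩ := (hΘ.prod hK).exists_bound_of_continuousOn hF.continuous.continuousOn
    refine ⟨M * μ.real K, fun θ hθ L => ?_⟩
    simp only [pow_zero, one_mul]
    have : ∫ z, F (θ, z) * Complex.exp (Complex.I * (L z : ℂ)) ∂μ
        = ∫ z in K, F (θ, z) * Complex.exp (Complex.I * (L z : ℂ)) ∂μ := by
      rw [setIntegral_eq_integral_of_forall_compl_eq_zero]
      intro z hz
      simp [hsupp θ z hz]
    rw [this]
    refine norm_setIntegral_le_of_norm_le_const hK.measure_lt_top fun z hz => ?_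
    rw [norm_mul, mul_comm Complex.I, Complex.norm_exp_ofReal_mul_I, mul_one]
    exact hM (θ, z) ⟨hθ, hz⟩
  | succ N ih =>
    have hG : ContDiff ℝ (⊤ : ℕ∞) fun p : Θ × E => fderiv ℝ F p (0, u) :=
      (hF.fderiv_right (m := (⊤ : ℕ∞)) (by simp)).clm_apply contDiff_const
    obtain ⟨C, hC⟩ := ih (fun p => fderiv ℝ F p (0, u)) hG (by
      intro θ z hz
      have : F =ᶠ[nhds (θ, z)] fun _ => 0 := by
        have : IsOpen ((Prod.snd : Θ × E → E) ⁻¹' Kᶜ) :=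
          hK.isClosed.isOpen_compl.preimage continuous_snd
        filter_upwards [this.mem_nhds (show (θ, z) ∈ _ from hz)] with p hp
        exact hsupp p.1 p.2 hp
      rw [this.fderiv_eq]
      simp)
    refine ⟨C, fun θ hθ L => ?_⟩
    refine le_trans (le_of_eq ?_) (hC θ hθ L)
    have hcF : ContDiff ℝ (⊤ : ℕ∞) fun z => F (θ, z) := hF.comp (contDiff_prodMk_right θ)
    have hcE : ContDiff ℝ (⊤ : ℕ∞) fun z : E => Complex.exp (Complex.I * (L z : ℂ)) := by
      refine Complex.contDiff_exp.comp (contDiff_const.mul ?_)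
      exact Complex.ofRealCLM.contDiff.comp L.contDiff
    have hcs : HasCompactSupport fun z => F (θ, z) := HasCompactSupport.intro hK (hsupp θ)
    have hderF : ∀ z, fderiv ℝ (fun z => F (θ, z)) z u = fderiv ℝ F (θ, z) (0, u) := by
      intro z
      have h1 : HasFDerivAt F (fderiv ℝ F (θ, z)) (θ, z) :=
        (hF.differentiable (by simp) _).hasFDerivAt
      have := h1.comp z (hasFDerivAt_prodMk_right θ z)
      rw [show (fun z => F (θ, z)) = F ∘ (fun z => (θ, z)) from rfl, this.fderiv]
      simp
    have hderE : ∀ z, fderiv ℝ (fun z : E => Complex.exp (Complex.I * (L z : ℂ))) z u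
        = Complex.I * (L u : ℂ) * Complex.exp (Complex.I * (L z : ℂ)) := by
      intro z
      have h1 : HasFDerivAt (fun z : E => Complex.I * (L z : ℂ))
          (Complex.I • Complex.ofRealCLM.comp L) z :=
        (Complex.ofRealCLM.hasFDerivAt.comp z L.hasFDerivAt).const_mul Complex.I
      rw [h1.cexp.fderiv]
      simp [mul_comm]
    have hdF : Continuous fun z => fderiv ℝ (fun z => F (θ, z)) z u :=
      (hcF.continuous_fderiv (by simp)).clm_apply continuous_const
    have hdE : Continuous fun z => fderiv ℝ
        (fun z : E => Complex.exp (Complex.I * (L z : ℂ))) z u :=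
      (hcE.continuous_fderiv (by simp)).clm_apply continuous_const
    have key := integral_mul_fderiv_eq_neg_fderiv_mul_of_integrable (μ := μ) (𝕜 := ℂ)
      (f := fun z => F (θ, z)) (g := fun z : E => Complex.exp (Complex.I * (L z : ℂ))) (v := u)
      ((hdF.mul hcE.continuous).integrable_of_hasCompactSupport
        ((hcs.fderiv_apply (𝕜 := ℝ) u).mul_right))
      ((hcF.continuous.mul hdE).integrable_of_hasCompactSupport hcs.mul_right)
      ((hcF.continuous.mul hcE.continuous).integrable_of_hasCompactSupport hcs.mul_right)
      (fun z _ => hcF.differentiable (by simp) z) (fun z _ => hcE.differentiable (by simp) z)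
    simp only [hderF, hderE] at key
    rw [← norm_neg (∫ z, fderiv ℝ F (θ, z) (0, u) * _ ∂μ), ← key, pow_succ, mul_assoc]
    congr 1
    have : (fun z => F (θ, z) * (Complex.I * (L u : ℂ) * Complex.exp (Complex.I * (L z : ℂ))))
        = fun z => (Complex.I * (L u : ℂ)) * (F (θ, z) * Complex.exp (Complex.I * (L z : ℂ))) := by
      funext z; ring
    rw [this, integral_const_mul, norm_mul]
    simp

/-- Smooth parametric integrals over the unit interval. -/
theorem contDiff_setIntegral_Ioc {P : Type*} [NormedAddCommGroup P] [NormedSpace ℝ P]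
    (c : P × ℝ → ℝ) (hc : ContDiff ℝ (⊤ : ℕ∞) c) :
    ContDiff ℝ (⊤ : ℕ∞) fun p : P => ∫ t in Ioc (0 : ℝ) 1, c (p, t) := by
  let cut : ℝ → ℝ := fun t => Real.smoothTransition (3 - t ^ 2)
  have hcut : ContDiff ℝ (⊤ : ℕ∞) cut :=
    Real.smoothTransition.contDiff.comp (by fun_prop)
  let g : P → ℝ → ℝ := fun p t => cut t * c (p, -t)
  have hg : ContDiff ℝ (⊤ : ℕ∞) (Function.uncurry g) :=
    (hcut.comp contDiff_snd).mul (hc.comp (contDiff_fst.prodMk contDiff_snd.neg))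
  have h := contDiffOn_convolution_right_with_param_comp (μ := (volume : Measure ℝ))
    (ContinuousLinearMap.mul ℝ ℝ) (s := (univ : Set P)) (v := fun _ => (0 : ℝ))
    (n := (⊤ : ℕ∞)) contDiffOn_const (f := (Ioc (0 : ℝ) 1).indicator fun _ => (1 : ℝ)) (g := g)
    (k := Icc (-2 : ℝ) 2) isOpen_univ isCompact_Icc
    (by
      intro p x _ hx
      have : 4 ≤ x ^ 2 := by
        by_contra hlt
        exact hx ⟨by nlinarith, by nlinarith⟩
      simp [g, cut, Real.smoothTransition.zero_of_nonpos (show 3 - x ^ 2 ≤ 0 by linarith)])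
    (((integrableOn_const (by simp)).integrable_indicator measurableSet_Ioc).locallyIntegrable)
    hg.contDiffOn
  rw [contDiffOn_univ] at h
  convert h using 2 with p
  unfold MeasureTheory.convolution
  rw [← integral_indicator measurableSet_Ioc]
  refine integral_congr_ae (Filter.Eventually.of_forall fun t => ?_)
  by_cases ht : t ∈ Ioc (0 : ℝ) 1
  · have : cut (-t) = 1 :=
      Real.smoothTransition.one_of_one_le (by nlinarith [ht.1, ht.2])
    simp [ht, g, this]
  · simp [ht]

/-- Second order Taylor expansion with a remainder depending smoothly on all data. -/
theorem ContDiff.exists_taylor_remainder {E : Type*} [NormedAddCommGroup E] [NormedSpace ℝ E]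
    {b : E → ℝ} (hb : ContDiff ℝ (⊤ : ℕ∞) b) :
    ∃ B : E × ℝ × E → ℝ, ContDiff ℝ (⊤ : ℕ∞) B ∧ ∀ μ ε y,
      b (μ + ε • y) = b μ + ε * fderiv ℝ b μ y + ε ^ 2 * B (μ, ε, y) := by
  have hb1 : ContDiff ℝ (⊤ : ℕ∞) (fderiv ℝ b) := hb.fderiv_right (by simp)
  have hb2 : ContDiff ℝ (⊤ : ℕ∞) (fderiv ℝ (fderiv ℝ b)) := hb1.fderiv_right (by simp)
  let c : (E × ℝ × E) × ℝ → ℝ := fun q =>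
    (1 - q.2) * fderiv ℝ (fderiv ℝ b) (q.1.1 + q.2 • q.1.2.1 • q.1.2.2) q.1.2.2 q.1.2.2
  have hc : ContDiff ℝ (⊤ : ℕ∞) c := by
    refine ContDiff.mul (by fun_prop) ?_
    refine ContDiff.clm_apply (ContDiff.clm_apply (hb2.comp ?_) ?_) ?_ <;> fun_prop
  refine ⟨_, contDiff_setIntegral_Ioc c hc, fun μ ε y => ?_⟩
  have hline : ∀ t : ℝ, HasDerivAt (fun t : ℝ => μ + t • ε • y) (ε • y) t := by
    intro t
    simpa using ((hasDerivAt_id t).smul_const (ε • y)).const_add μ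
  have h1 : ∀ t : ℝ, HasDerivAt (fun t : ℝ => b (μ + t • ε • y))
      (fderiv ℝ b (μ + t • ε • y) (ε • y)) t := fun t =>
    (hb.differentiable (by simp) _).hasFDerivAt.comp_hasDerivAt t (hline t)
  have h2 : ∀ t : ℝ, HasDerivAt (fun t : ℝ => fderiv ℝ b (μ + t • ε • y) (ε • y))
      (fderiv ℝ (fderiv ℝ b) (μ + t • ε • y) (ε • y) (ε • y)) t := fun t => by
    have := ((hb1.differentiable (by simp) _).hasFDerivAt.comp_hasDerivAt t (hline t)).clm_apply
      (hasDerivAt_const t (ε • y))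
    simpa using this
  have h3 : ∀ t : ℝ, HasDerivAt
      (fun t : ℝ => (1 - t) * fderiv ℝ b (μ + t • ε • y) (ε • y) + b (μ + t • ε • y))
      ((1 - t) * fderiv ℝ (fderiv ℝ b) (μ + t • ε • y) (ε • y) (ε • y)) t := fun t => by
    have := (((hasDerivAt_id t).const_sub 1).mul (h2 t)).add (h1 t)
    refine HasDerivAt.congr_deriv this ?_
    simp only [id]
    ring
  have hcont : Continuous fun t : ℝ => c ((μ, ε, y), t) :=
    hc.continuous.comp (by fun_prop)
  have hce : (fun t : ℝ => (1 - t) * fderiv ℝ (fderiv ℝ b) (μ + t • ε • y) (ε • y) (ε • y))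
      = fun t => ε ^ 2 * c ((μ, ε, y), t) := by
    funext t
    simp [c]
    ring
  have key := intervalIntegral.integral_eq_sub_of_hasDerivAt (a := 0) (b := 1)
    (fun t _ => h3 t) (by rw [hce]; exact (hcont.const_mul _).intervalIntegrable _ _)
  rw [hce, intervalIntegral.integral_const_mul, intervalIntegral.integral_of_le zero_le_one] at key
  rw [key]
  simp
  ring

/-- The closed shell `r⁻¹ ≤ ‖ζ‖ ≤ r`. -/
def shell (d : ℕ) (r : ℝ) : Set (Rd d) := {ζ | r⁻¹ ≤ ‖ζ‖ ∧ ‖ζ‖ ≤ r}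

theorem shell_mono {d : ℕ} {r R : ℝ} (hr : 0 < r) (h : r ≤ R) : shell d r ⊆ shell d R :=
  fun _ hζ => ⟨(inv_anti₀ hr h).trans hζ.1, hζ.2.trans h⟩

theorem ne_zero_of_mem_shell {d : ℕ} {r : ℝ} (hr : 0 < r) {ζ : Rd d} (hζ : ζ ∈ shell d r) :
    ζ ≠ 0 := by
  rintro rfl
  have := hζ.1
  simp only [norm_zero] at this
  exact absurd (inv_pos.2 hr) (not_lt.2 this)

theorem isCompact_shell (d : ℕ) (r : ℝ) : IsCompact (shell d r) := by
  refine (isCompact_closedBall (0 : Rd d) r).of_isClosed_subset ?_ fun ζ hζ => by simpa using hζ.2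
  exact (isClosed_le continuous_const continuous_norm).inter
    (isClosed_le continuous_norm continuous_const)

theorem measurableSet_shell (d : ℕ) (r : ℝ) : MeasurableSet (shell d r) :=
  (isCompact_shell d r).measurableSet

theorem smul_mem_shell {d : ℕ} {r c t : ℝ} (hr : 0 < r) (hc : 0 < c) (h1 : c⁻¹ ≤ t) (h2 : t ≤ c)
    {ζ : Rd d} (hζ : ζ ∈ shell d r) : t • ζ ∈ shell d (c * r) := by
  have ht : 0 < t := (inv_pos.2 hc).trans_le h1
  refine ⟨?_, ?_⟩
  · rw [norm_smul, Real.norm_of_nonneg ht.le, mul_inv]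
    exact mul_le_mul h1 hζ.1 (inv_nonneg.2 hr.le) ht.le
  · rw [norm_smul, Real.norm_of_nonneg ht.le]
    exact mul_le_mul h2 hζ.2 (norm_nonneg _) hc.le

/-- The phase `s a(ζ) + 2π⟨x, ζ⟩` of the integral defining `Kker`. -/
def phase {d : ℕ} (a : Rd d → ℝ) (s : ℝ) (x ζ : Rd d) : ℝ := s * a ζ + 2 * π * inner ℝ x ζ

/-- The gradient of the phase. -/
def phaseGrad {d : ℕ} (a : Rd d → ℝ) (s : ℝ) (x ζ : Rd d) : Rd d :=
  s • gradient a ζ + (2 * π) • x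

section DistFn

variable {d : ℕ} {a : Rd d → ℝ}

theorem IsDistFn.differentiableAt (ha : IsDistFn a) {ζ : Rd d} (hζ : ζ ≠ 0) :
    DifferentiableAt ℝ a ζ :=
  (ha.smooth.contDiffAt (isOpen_ne.mem_nhds hζ)).differentiableAt (by simp)

theorem IsDistFn.map_zero (ha : IsDistFn a) : a 0 = 0 := by
  have := ha.homog 2 (by norm_num) 0
  simp only [smul_zero] at this
  linarith

theorem IsDistFn.nonneg (ha : IsDistFn a) (ζ : Rd d) : 0 ≤ a ζ := by
  by_cases h : ζ = 0
  · rw [h, ha.map_zero]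
  · exact (ha.pos ζ h).le

theorem IsDistFn.fderiv_smul (ha : IsDistFn a) {ζ : Rd d} (hζ : ζ ≠ 0) {t : ℝ} (ht : 0 < t) :
    fderiv ℝ a (t • ζ) = fderiv ℝ a ζ := by
  have h1 : HasFDerivAt (fun ξ : Rd d => a (t • ξ)) (t • fderiv ℝ a (t • ζ)) ζ := by
    have := (ha.differentiableAt (smul_ne_zero ht.ne' hζ)).hasFDerivAt.comp ζ
      ((hasFDerivAt_id ζ).const_smul t)
    refine this.congr_fderiv ?_
    ext v
    simp
  have h2 : HasFDerivAt (fun ξ : Rd d => a (t • ξ)) (t • fderiv ℝ a ζ) ζ := by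
    have : (fun ξ : Rd d => a (t • ξ)) = fun ξ => t • a ξ := by
      funext ξ
      simp [ha.homog t ht]
    rw [this]
    exact (ha.differentiableAt hζ).hasFDerivAt.const_smul t
  exact smul_right_injective _ ht.ne' (h1.unique h2)

theorem IsDistFn.gradient_smul (ha : IsDistFn a) {ζ : Rd d} (hζ : ζ ≠ 0) {t : ℝ} (ht : 0 < t) :
    gradient a (t • ζ) = gradient a ζ := by
  rw [gradient, gradient, ha.fderiv_smul hζ ht]

theorem IsDistFn.fderiv_self (ha : IsDistFn a) {ζ : Rd d} (hζ : ζ ≠ 0) :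
    fderiv ℝ a ζ ζ = a ζ := by
  have h1 : HasDerivAt (fun t : ℝ => a (t • ζ)) (fderiv ℝ a ζ ζ) 1 := by
    have hl : HasDerivAt (fun t : ℝ => t • ζ) ζ 1 := by
      simpa using (hasDerivAt_id (1 : ℝ)).smul_const ζ
    have : HasFDerivAt a (fderiv ℝ a ζ) ((1 : ℝ) • ζ) := by
      simpa using (ha.differentiableAt hζ).hasFDerivAt
    exact this.comp_hasDerivAt 1 hl
  have h2 : HasDerivAt (fun t : ℝ => a (t • ζ)) (a ζ) 1 := by
    have : HasDerivAt (fun t : ℝ => t * a ζ) (a ζ) 1 := by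
      simpa using (hasDerivAt_id (1 : ℝ)).mul_const (a ζ)
    refine this.congr_of_eventuallyEq ?_
    filter_upwards [lt_mem_nhds (zero_lt_one : (0 : ℝ) < 1)] with t ht
    exact ha.homog t ht ζ
  exact h1.unique h2

theorem inner_gradient_eq_fderiv (a : Rd d → ℝ) (ζ y : Rd d) :
    inner ℝ (gradient a ζ) y = fderiv ℝ a ζ y := by
  simp [gradient]

theorem inner_phaseGrad (a : Rd d → ℝ) (s : ℝ) (x ζ y : Rd d) :
    inner ℝ (phaseGrad a s x ζ) y = s * fderiv ℝ a ζ y + 2 * π * inner ℝ x y := by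
  simp [phaseGrad, inner_add_left, inner_smul_left]

theorem IsDistFn.inner_phaseGrad_self (ha : IsDistFn a) (s : ℝ) (x : Rd d) {ζ : Rd d}
    (hζ : ζ ≠ 0) : inner ℝ (phaseGrad a s x ζ) ζ = phase a s x ζ := by
  rw [inner_phaseGrad, ha.fderiv_self hζ, phase]

theorem IsDistFn.phase_smul (ha : IsDistFn a) (s : ℝ) (x ζ : Rd d) {t : ℝ} (ht : 0 < t) :
    phase a s x (t • ζ) = t * phase a s x ζ := by
  simp only [phase, ha.homog t ht, inner_smul_right]
  ring

theorem IsDistFn.phaseGrad_smul (ha : IsDistFn a) (s : ℝ) (x : Rd d) {ζ : Rd d} (hζ : ζ ≠ 0)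
    {t : ℝ} (ht : 0 < t) : phaseGrad a s x (t • ζ) = phaseGrad a s x ζ := by
  simp only [phaseGrad, ha.gradient_smul hζ ht]

theorem IsDistFn.continuousOn (ha : IsDistFn a) : ContinuousOn a {ξ : Rd d | ξ ≠ 0} :=
  ha.smooth.continuousOn

theorem IsDistFn.continuousOn_fderiv (ha : IsDistFn a) :
    ContinuousOn (fderiv ℝ a) {ξ : Rd d | ξ ≠ 0} :=
  ha.smooth.continuousOn_fderiv_of_isOpen isOpen_ne (by simp)

/-- Two-sided comparison of a distance function with the norm. -/
theorem IsDistFn.exists_bounds (ha : IsDistFn a) :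
    ∃ M : ℝ, 1 ≤ M ∧ ∀ ξ : Rd d, a ξ ≤ M * ‖ξ‖ ∧ ‖ξ‖ ≤ M * a ξ := by
  have hK : IsCompact (Metric.sphere (0 : Rd d) 1) := isCompact_sphere _ _
  have hne : ∀ ξ ∈ Metric.sphere (0 : Rd d) 1, ξ ≠ 0 := by
    rintro ξ hξ rfl
    simp at hξ
  obtain ⟨M₁, hM₁⟩ := hK.exists_bound_of_continuousOn (ha.continuousOn.mono hne)
  obtain ⟨M₂, hM₂⟩ := hK.exists_bound_of_continuousOn
    ((ha.continuousOn.mono hne).inv₀ fun ξ hξ => (ha.pos ξ (hne ξ hξ)).ne')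
  refine ⟨max 1 (max M₁ M₂), le_max_left _ _, fun ξ => ?_⟩
  by_cases h : ξ = 0
  · simp [h, ha.map_zero]
  have hn : 0 < ‖ξ‖ := norm_pos_iff.2 h
  have hu : ‖ξ‖⁻¹ • ξ ∈ Metric.sphere (0 : Rd d) 1 := by
    simp [norm_smul, hn.ne']
  have hau : a (‖ξ‖⁻¹ • ξ) = ‖ξ‖⁻¹ * a ξ := ha.homog _ (inv_pos.2 hn) ξ
  have h1 := hM₁ _ hu
  have h2 := hM₂ _ hu
  rw [hau] at h1
  have hp := ha.pos ξ h
  rw [Real.norm_of_nonneg (by positivity)] at h1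
  rw [Pi.inv_apply, hau, Real.norm_of_nonneg (by positivity)] at h2
  constructor
  · rw [inv_mul_le_iff₀ hn] at h1
    calc a ξ ≤ ‖ξ‖ * M₁ := h1
      _ ≤ _ := by
        rw [mul_comm]
        gcongr
        exact (le_max_left _ _).trans (le_max_right _ _)
  · rw [mul_inv, inv_inv, mul_inv_le_iff₀ hp] at h2
    calc ‖ξ‖ ≤ M₂ * a ξ := h2
      _ ≤ _ := by
        gcongr
        exact (le_max_right _ _).trans (le_max_right _ _)

theorem IsDistFn.exists_gradient_bound (ha : IsDistFn a) :
    ∃ M : ℝ, 1 ≤ M ∧ ∀ ξ : Rd d, ξ ≠ 0 → ‖gradient a ξ‖ ≤ M := by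
  have hK : IsCompact (Metric.sphere (0 : Rd d) 1) := isCompact_sphere _ _
  have hne : ∀ ξ ∈ Metric.sphere (0 : Rd d) 1, ξ ≠ 0 := by
    rintro ξ hξ rfl
    simp at hξ
  obtain ⟨M₁, hM₁⟩ := hK.exists_bound_of_continuousOn (ha.continuousOn_fderiv.mono hne)
  refine ⟨max 1 M₁, le_max_left _ _, fun ξ h => ?_⟩
  have hn : 0 < ‖ξ‖ := norm_pos_iff.2 h
  have hu : ‖ξ‖⁻¹ • ξ ∈ Metric.sphere (0 : Rd d) 1 := by
    simp [norm_smul, hn.ne']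
  have := hM₁ _ hu
  rw [ha.fderiv_smul h (inv_pos.2 hn)] at this
  rw [gradient, LinearIsometryEquiv.norm_map]
  exact this.trans (le_max_right _ _)

/-- Quantitative `C²` control on shells. -/
theorem IsDistFn.exists_taylor_bound (ha : IsDistFn a) (R : ℝ) (hR : 1 ≤ R) :
    ∃ C : ℝ, 1 ≤ C ∧ ∀ ζ ∈ shell d R, ∀ ζ' ∈ shell d R,
      ‖gradient a ζ' - gradient a ζ‖ ≤ C * ‖ζ' - ζ‖ ∧
      |a ζ' - a ζ - fderiv ℝ a ζ (ζ' - ζ)| ≤ C * ‖ζ' - ζ‖ ^ 2 := by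
  obtain ⟨b, hb, hbc, hab⟩ := ha.exists_extension R hR
  have hb1 : ContDiff ℝ (⊤ : ℕ∞) (fderiv ℝ b) := hb.fderiv_right (by simp)
  obtain ⟨C, hC⟩ := ContDiff.lipschitzWith_of_hasCompactSupport (hbc.fderiv (𝕜 := ℝ)) hb1 (by simp)
  refine ⟨max 1 C, le_max_left _ _, fun ζ hζ ζ' hζ' => ?_⟩
  have e1 : fderiv ℝ b ζ = fderiv ℝ a ζ := (hab ζ hζ.1 hζ.2).fderiv_eq
  have e2 : fderiv ℝ b ζ' = fderiv ℝ a ζ' := (hab ζ' hζ'.1 hζ'.2).fderiv_eq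
  constructor
  · rw [gradient, gradient, ← map_sub, LinearIsometryEquiv.norm_map, ← e1, ← e2]
    refine (hC.norm_sub_le _ _).trans ?_
    gcongr
    exact le_max_right _ _
  · rw [← (hab ζ hζ.1 hζ.2).eq_of_nhds, ← (hab ζ' hζ'.1 hζ'.2).eq_of_nhds, ← e1]
    have hmv := (convex_segment ζ ζ').norm_image_sub_le_of_norm_hasFDerivWithin_le'
      (f := b) (f' := fderiv ℝ b) (φ := fderiv ℝ b ζ) (C := C * ‖ζ' - ζ‖)
      (fun ξ _ => (hb.differentiable (by simp) ξ).hasFDerivAt.hasFDerivWithinAt)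
      (fun ξ hξ => (hC.norm_sub_le _ _).trans (by
        gcongr
        exact norm_sub_le_of_mem_segment hξ)) (left_mem_segment ℝ ζ ζ')
      (right_mem_segment ℝ ζ ζ')
    rw [Real.norm_eq_abs] at hmv
    refine hmv.trans ?_
    rw [mul_assoc, ← sq]
    gcongr
    exact le_max_right _ _

/-- The symbol `η ∘ a` is smooth. -/
theorem IsDistFn.contDiff_bump_comp (ha : IsDistFn a) {η : ℝ → ℝ}
    (hη : ContDiff ℝ (⊤ : ℕ∞) η) (hsupp : ∀ x, x ∉ Icc (1/8 : ℝ) 8 → η x = 0) :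
    ContDiff ℝ (⊤ : ℕ∞) fun ξ : Rd d => η (a ξ) := by
  obtain ⟨M, hM1, hM⟩ := ha.exists_bounds
  rw [contDiff_iff_contDiffAt]
  intro ξ
  by_cases hξ : ξ = 0
  · have : (fun ξ : Rd d => η (a ξ)) =ᶠ[nhds ξ] fun _ => 0 := by
      rw [hξ]
      filter_upwards [Metric.ball_mem_nhds (0 : Rd d) (show 0 < 1 / (8 * M) by positivity)]
        with ζ hζ
      apply hsupp
      intro h
      rw [mem_ball_zero_iff, lt_div_iff₀ (by positivity)] at hζ
      have := (hM ζ).1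
      linarith [h.1]
    exact contDiffAt_const.congr_of_eventuallyEq this
  · exact hη.contDiffAt.comp ξ (ha.smooth.contDiffAt (isOpen_ne.mem_nhds hξ))

theorem IsDistFn.exists_shell_support (ha : IsDistFn a) :
    ∃ r : ℝ, 1 ≤ r ∧ ∀ ξ : Rd d, a ξ ∈ Icc (1/8 : ℝ) 8 → ξ ∈ shell d r := by
  obtain ⟨M, hM1, hM⟩ := ha.exists_bounds
  refine ⟨8 * M, by linarith, fun ξ hξ => ⟨?_, ?_⟩⟩
  · rw [inv_le_iff_one_le_mul₀ (by positivity)]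
    nlinarith [(hM ξ).1, hξ.1]
  · nlinarith [(hM ξ).2, hξ.2]

end DistFn

/-- The weight `1 + (|Φ| + |∇Φ|² / (1 + |s|)) / l` measuring the distance of `ζ` to the stationary
set of the phase `Φ`. -/
def wt {d : ℕ} (a : Rd d → ℝ) (l s : ℝ) (x ζ : Rd d) : ℝ :=
  1 + (|phase a s x ζ| + ‖phaseGrad a s x ζ‖ ^ 2 / (1 + |s|)) / l

theorem one_le_wt {d : ℕ} (a : Rd d → ℝ) {l : ℝ} (hl : 0 < l) (s : ℝ) (x ζ : Rd d) :
    1 ≤ wt a l s x ζ := by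
  unfold wt
  have : 0 ≤ (|phase a s x ζ| + ‖phaseGrad a s x ζ‖ ^ 2 / (1 + |s|)) / l := by positivity
  linarith

theorem pow_one_add_sum_le {ι : Type*} [Fintype ι] (N : ℕ) (t : ℝ) (v : ι → ℝ) (A C : ℝ)
    (hA : 0 ≤ A) (h0 : A ≤ C) (h1 : |t| ^ N * A ≤ C) (h2 : ∀ i, |v i| ^ (2 * N) * A ≤ C) :
    (1 + (|t| + ∑ i, v i ^ 2)) ^ N * A ≤ (2 + Fintype.card ι : ℝ) ^ N * C := by
  let f : Option (Option ι) → ℝ := fun o => o.elim 1 fun o' => o'.elim |t| fun i => v i ^ 2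
  have hsum : ∑ o, f o = 1 + (|t| + ∑ i, v i ^ 2) := by
    simp [f, Fintype.sum_option]
  obtain ⟨o, -, ho⟩ := Finset.exists_max_image (Finset.univ : Finset (Option (Option ι))) f
    ⟨none, Finset.mem_univ _⟩
  have hle : ∑ o, f o ≤ (2 + Fintype.card ι : ℝ) * f o := by
    refine (Finset.sum_le_card_nsmul _ _ _ fun i hi => ho i hi).trans (le_of_eq ?_)
    rw [nsmul_eq_mul, Finset.card_univ, Fintype.card_option, Fintype.card_option]
    push_cast
    ring
  have hfn : ∀ o, 0 ≤ f o := by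
    rintro (_ | _ | i) <;> (simp [f]; try positivity)
  rw [← hsum]
  calc (∑ o, f o) ^ N * A ≤ ((2 + Fintype.card ι : ℝ) * f o) ^ N * A := by
        gcongr
        exact Finset.sum_nonneg fun i _ => hfn i
    _ = (2 + Fintype.card ι : ℝ) ^ N * (f o ^ N * A) := by rw [mul_pow, mul_assoc]
    _ ≤ _ := by
      gcongr
      rcases o with _ | _ | i
      · simpa [f] using h0
      · simpa [f] using h1
      · have := h2 i
        rw [pow_mul, sq_abs] at this
        simpa [f] using this

/-- The oscillatory integral defining the kernel is controlled by the mass of the part of a shell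
where the phase is stationary. -/
theorem IsDistFn.exists_kernel_bound {d : ℕ} {a : Rd d → ℝ} (ha : IsDistFn a) {g : Rd d → ℂ}
    (hg : ContDiff ℝ (⊤ : ℕ∞) g) {r : ℝ} (hr : 1 ≤ r) (hsupp : ∀ ξ ∉ shell d r, g ξ = 0) (N : ℕ) :
    ∃ C : ℝ≥0, ∀ (s : ℝ) (x : Rd d),
      ‖∫ ξ, g ξ * Complex.exp (Complex.I * (phase a s x ξ : ℝ))‖ₑ ≤
        C * ∫⁻ ζ in shell d (4 * r), ENNReal.ofReal ((wt a 1 s x ζ ^ N)⁻¹) := by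
  have hr0 : 0 < r := by linarith
  obtain ⟨b, hb, hbc, hab⟩ := ha.exists_extension (8 * r) (by linarith)
  obtain ⟨B, hB, hBt⟩ := hb.exists_taylor_remainder
  let w₀ : ContDiffBump (1 : ℝ) := ⟨1/4, 1/2, by norm_num, by norm_num⟩
  let χ₀ : ContDiffBump (0 : Rd d) := ⟨1/(4*r), 1/(2*r), by positivity, by
    gcongr; norm_num⟩
  let w : ℝ → ℝ := w₀.normed volume
  let χ : Rd d → ℝ := χ₀.normed volume
  have hw : ContDiff ℝ (⊤ : ℕ∞) w := w₀.contDiff_normed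
  have hχ : ContDiff ℝ (⊤ : ℕ∞) χ := χ₀.contDiff_normed
  have hw1 : ∫ t, w t = 1 := w₀.integral_normed
  have hχ1 : ∫ t, χ t = 1 := χ₀.integral_normed
  have hws : ∀ t, w t ≠ 0 → 1/2 ≤ t ∧ t ≤ 2 := by
    intro t ht
    have : t ∈ Function.support w := ht
    rw [show Function.support w = _ from w₀.support_normed_eq, Metric.mem_ball,
      Real.dist_eq, abs_lt] at this
    have h2 : w₀.rOut = 1/2 := rfl
    rw [h2] at this
    constructor <;> linarith [this.1, this.2]
  have hχs : ∀ y, χ y ≠ 0 → ‖y‖ ≤ 1/(2*r) := by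
    intro t ht
    have : t ∈ Function.support χ := ht
    rw [show Function.support χ = _ from χ₀.support_normed_eq, mem_ball_zero_iff] at this
    exact this.le
  have hgeo : ∀ (ρ ε : ℝ) (y ζ : Rd d), w ρ ≠ 0 → χ y ≠ 0 → 0 ≤ ε → ε ≤ 1 →
      g (ρ • ζ + ε • y) ≠ 0 → ζ ∈ shell d (4 * r) := by
    intro ρ ε y ζ h1 h2 h3 h4 h5
    obtain ⟨k1, k2⟩ := hws ρ h1
    have k3 := hχs y h2
    have k4 : ρ • ζ + ε • y ∈ shell d r := by
      by_contra h
      exact h5 (hsupp _ h)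
    have k5 : ‖ε • y‖ ≤ 1 / (2 * r) := by
      rw [norm_smul, Real.norm_of_nonneg h3]
      calc ε * ‖y‖ ≤ 1 * ‖y‖ := by gcongr
        _ ≤ _ := by linarith
    have k6 : ‖ρ • ζ‖ = ρ * ‖ζ‖ := by
      rw [norm_smul, Real.norm_of_nonneg (by linarith)]
    have k7 := norm_add_le (ρ • ζ) (ε • y)
    have k8 := norm_sub_le (ρ • ζ + ε • y) (ε • y)
    rw [add_sub_cancel_right] at k8
    rw [k6] at k7 k8
    have k9 : 1 / (2 * r) = r⁻¹ / 2 := by field_simp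
    rw [k9] at k5
    have hri : r⁻¹ ≤ 1 := inv_le_one_of_one_le₀ hr
    have hn := norm_nonneg ζ
    constructor
    · rw [mul_inv]
      nlinarith [k4.1]
    · nlinarith [k4.2]
  let F : (Rd d × ℝ × ℝ) × (ℝ × Rd d) → ℂ := fun q =>
    ((w q.2.1 * q.2.1 ^ d * χ q.2.2 : ℝ) : ℂ) * g (q.2.1 • q.1.1 + q.1.2.1 • q.2.2) *
      Complex.exp (Complex.I * ((q.1.2.2 * B (q.2.1 • q.1.1, q.1.2.1, q.2.2) : ℝ) : ℂ))
  have hF : ContDiff ℝ (⊤ : ℕ∞) F := by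
    refine ContDiff.mul (ContDiff.mul ?_ (hg.comp (by fun_prop))) ?_
    · refine Complex.ofRealCLM.contDiff.comp ?_
      exact ((hw.comp (by fun_prop)).mul (by fun_prop)).mul (hχ.comp (by fun_prop))
    · refine (contDiff_const.mul (Complex.ofRealCLM.contDiff.comp ?_)).cexp
      exact ContDiff.mul (by fun_prop) (hB.comp (by fun_prop))
  let Kz : Set (ℝ × Rd d) := Icc (1/2) 2 ×ˢ Metric.closedBall 0 (1/(2*r))
  have hKz : IsCompact Kz := isCompact_Icc.prod (isCompact_closedBall _ _)
  have hFs : ∀ θ, ∀ z ∉ Kz, F (θ, z) = 0 := by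
    intro θ z hz
    by_contra h
    apply hz
    have h1 : w z.1 ≠ 0 := fun h' => h (by simp [F, h'])
    have h2 : χ z.2 ≠ 0 := fun h' => h (by simp [F, h'])
    exact ⟨hws _ h1, by simpa using hχs _ h2⟩
  let Θ₀ : Set (Rd d × ℝ × ℝ) := shell d (4 * r) ×ˢ Icc (0:ℝ) 1 ×ˢ Icc (-1:ℝ) 1
  have hΘ : IsCompact Θ₀ := (isCompact_shell d _).prod (isCompact_Icc.prod isCompact_Icc)
  have : (volume : Measure (ℝ × Rd d)).IsAddHaarMeasure := by
    rw [Measure.volume_eq_prod]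
    infer_instance
  obtain ⟨C₀, hC₀⟩ := exists_fourier_decay (volume : Measure (ℝ × Rd d)) hΘ hKz 0 0 F hF hFs
  obtain ⟨C₁, hC₁⟩ := exists_fourier_decay (volume : Measure (ℝ × Rd d)) hΘ hKz (1, 0) N F hF hFs
  have hex := fun i : Fin d => exists_fourier_decay (volume : Measure (ℝ × Rd d)) hΘ hKz
    (0, EuclideanSpace.single i (1 : ℝ)) (2 * N) F hF hFs
  choose C₂ hC₂ using hex
  let C : ℝ := |C₀| + |C₁| + ∑ i, |C₂ i|
  let D : ℝ := (2 + d : ℝ) ^ N * C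
  have hCnn : 0 ≤ C := by positivity
  have hD : 0 ≤ D := by positivity
  refine ⟨D.toNNReal, fun s x => ?_⟩
  have hS : 0 < 1 + |s| := by positivity
  let ε : ℝ := (Real.sqrt (1 + |s|))⁻¹
  have hε0 : 0 ≤ ε := by positivity
  have hε1 : ε ≤ 1 := by
    apply inv_le_one_of_one_le₀
    rw [Real.one_le_sqrt]
    linarith [abs_nonneg s]
  have hε2 : ε ^ 2 = (1 + |s|)⁻¹ := by
    simp only [ε, inv_pow, Real.sq_sqrt hS.le]
  let Φ : Rd d → ℝ := fun ξ => s * b ξ + 2 * π * inner ℝ x ξ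
  have hΦ : Continuous Φ := by
    have := hb.continuous
    fun_prop
  let G : Rd d → ℝ × Rd d → ℂ := fun ζ z =>
    ((w z.1 * z.1 ^ d * χ z.2 : ℝ) : ℂ) * (g (z.1 • ζ + ε • z.2) *
      Complex.exp (Complex.I * (Φ (z.1 • ζ + ε • z.2) : ℝ)))
  set K : ℂ := ∫ ξ, g ξ * Complex.exp (Complex.I * (phase a s x ξ : ℝ)) with hKdef
  have hK' : K = ∫ ξ, g ξ * Complex.exp (Complex.I * (Φ ξ : ℝ)) := by
    refine integral_congr_ae (Filter.Eventually.of_forall fun ξ => ?_)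
    by_cases h : ξ ∈ shell d r
    · have h' := shell_mono hr0 (by linarith : r ≤ 8 * r) h
      simp only [Φ, phase, (hab ξ h'.1 h'.2).eq_of_nhds]
    · simp [hsupp ξ h]
  have hGz : ∀ z, ∫ ζ, G ζ z = ((w z.1 * χ z.2 : ℝ) : ℂ) * K := by
    intro z
    by_cases hz : w z.1 = 0
    · simp [G, hz]
    have hz0 : 0 < z.1 := by linarith [(hws _ hz).1]
    simp only [G]
    rw [integral_const_mul]
    have h1 := Measure.integral_comp_smul (volume : Measure (Rd d))
      (fun ξ => g (ξ + ε • z.2) * Complex.exp (Complex.I * (Φ (ξ + ε • z.2) : ℝ))) z.1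
    rw [h1, integral_add_right_eq_self
      (fun ξ => g ξ * Complex.exp (Complex.I * (Φ ξ : ℝ))), ← hK']
    rw [finrank_euclideanSpace_fin, abs_of_pos (by positivity)]
    rw [Complex.real_smul]
    push_cast
    have : (z.1 : ℂ) ≠ 0 := by exact_mod_cast hz0.ne'
    field_simp
  have hGc : Continuous (Function.uncurry G) := by
    have := hw.continuous
    have := hχ.continuous
    have := hg.continuous
    simp only [G, Function.uncurry_def]
    fun_prop
  have hGsupp : ∀ ζ z, G ζ z ≠ 0 → ζ ∈ shell d (4 * r) ∧ z ∈ Kz := by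
    intro ζ z h
    have h1 : w z.1 ≠ 0 := fun h' => h (by simp [G, h'])
    have h2 : χ z.2 ≠ 0 := fun h' => h (by simp [G, h'])
    have h3 : g (z.1 • ζ + ε • z.2) ≠ 0 := fun h' => h (by simp [G, h'])
    exact ⟨hgeo _ _ _ _ h1 h2 hε0 hε1 h3, hws _ h1, by simpa using hχs _ h2⟩
  have hGi : Integrable (Function.uncurry G) (volume.prod volume) := by
    refine hGc.integrable_of_hasCompactSupport
      (HasCompactSupport.intro ((isCompact_shell d (4 * r)).prod hKz) fun q hq => ?_)
    by_contra h
    exact hq (hGsupp q.1 q.2 h)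
  have hKint : K = ∫ ζ, ∫ z, G ζ z := by
    rw [integral_integral_swap hGi]
    simp only [hGz]
    rw [integral_mul_const]
    have : ∫ z : ℝ × Rd d, ((w z.1 * χ z.2 : ℝ) : ℂ) = 1 := by
      rw [integral_complex_ofReal]
      have := integral_prod_mul (μ := (volume : Measure ℝ)) (ν := (volume : Measure (Rd d))) w χ
      rw [hw1, hχ1] at this
      rw [Measure.volume_eq_prod, this]
      simp
    rw [this, one_mul]
  have hJ : ∀ ζ ∈ shell d (4 * r), wt a 1 s x ζ ^ N * ‖∫ z, G ζ z‖ ≤ D := by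
    intro ζ hζ
    have hζ0 := ne_zero_of_mem_shell (by positivity) hζ
    let θ : Rd d × ℝ × ℝ := (ζ, ε, s * (1 + |s|)⁻¹)
    have hθ : θ ∈ Θ₀ := by
      refine ⟨hζ, ⟨hε0, hε1⟩, ?_⟩
      have : |s * (1 + |s|)⁻¹| ≤ 1 := by
        rw [abs_mul, abs_inv, abs_of_pos hS, mul_inv_le_iff₀ hS]
        linarith
      exact abs_le.1 this
    let v : Rd d := ε • phaseGrad a s x ζ
    let L : ℝ × Rd d →L[ℝ] ℝ := (phase a s x ζ) • ContinuousLinearMap.fst ℝ ℝ (Rd d) +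
      (innerSL ℝ v).comp (ContinuousLinearMap.snd ℝ ℝ (Rd d))
    have hL : ∀ z, L z = phase a s x ζ * z.1 + inner ℝ v z.2 := fun z => by simp [L]
    have hGF : ∀ z, G ζ z = F (θ, z) * Complex.exp (Complex.I * (L z : ℂ)) := by
      intro z
      by_cases hz : w z.1 = 0
      · simp [G, F, hz]
      have hz1 := hws _ hz
      have hz0 : 0 < z.1 := by linarith
      have hzs : z.1 • ζ ∈ shell d (8 * r) := by
        have := smul_mem_shell (c := 2) (by positivity) (by norm_num) (by linarith [hz1.1])
          hz1.2 hζ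
        rwa [show 2 * (4 * r) = 8 * r by ring] at this
      have hev := hab _ hzs.1 hzs.2
      have e1 : Φ (z.1 • ζ + ε • z.2)
          = L z + s * (1 + |s|)⁻¹ * B (z.1 • ζ, ε, z.2) := by
        simp only [Φ]
        rw [hBt, hev.eq_of_nhds, hev.fderiv_eq, ha.homog _ hz0, ha.fderiv_smul hζ0 hz0, hL, hε2]
        simp only [v, inner_smul_left, inner_phaseGrad, phase, inner_add_right, inner_smul_right]
        simp
        ring
      simp only [G, F, θ]
      have e2 : ∀ p q : ℝ, Complex.exp (Complex.I * ((p + q : ℝ) : ℂ))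
          = Complex.exp (Complex.I * q) * Complex.exp (Complex.I * p) := by
        intro p q
        rw [← Complex.exp_add]
        congr 1
        push_cast
        ring
      rw [e1, e2]
      ring
    have hInt : ∫ z, G ζ z = ∫ z, F (θ, z) * Complex.exp (Complex.I * (L z : ℂ)) := by
      simp only [hGF]
    have b0 := hC₀ θ hθ L
    have b1 := hC₁ θ hθ L
    have b2 := fun i => hC₂ i θ hθ L
    rw [← hInt] at b0 b1
    simp only [← hInt] at b2
    have key := pow_one_add_sum_le N (phase a s x ζ) (fun i => v i) ‖∫ z, G ζ z‖ C
      (norm_nonneg _)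
      (by
        simp only [pow_zero, one_mul] at b0
        have : 0 ≤ ∑ i, |C₂ i| := by positivity
        simp only [C]
        linarith [le_abs_self C₀, abs_nonneg C₁])
      (by
        have e : L (1, 0) = phase a s x ζ := by simp [hL]
        rw [e] at b1
        have : 0 ≤ ∑ i, |C₂ i| := by positivity
        simp only [C]
        linarith [le_abs_self C₁, abs_nonneg C₀])
      (fun i => by
        have e : L (0, EuclideanSpace.single i (1 : ℝ)) = v i := by
          simp [hL, EuclideanSpace.inner_single_right]
        have b2i := b2 i
        rw [e] at b2i
        have := Finset.single_le_sum (f := fun i => |C₂ i|) (fun i _ => abs_nonneg _)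
          (Finset.mem_univ i)
        simp only [C]
        linarith [le_abs_self (C₂ i), abs_nonneg C₀, abs_nonneg C₁])
    have hv : ∑ i, v i ^ 2 = ‖phaseGrad a s x ζ‖ ^ 2 / (1 + |s|) := by
      rw [← EuclideanSpace.real_norm_sq_eq]
      simp only [v]
      rw [norm_smul, mul_pow, Real.norm_eq_abs, sq_abs, hε2]
      field_simp
    rw [hv, Fintype.card_fin] at key
    simpa [wt, D] using key
  rw [hKint]
  refine (enorm_integral_le_lintegral_enorm _).trans ?_
  have hzero : ∀ ζ ∉ shell d (4 * r), ‖∫ z, G ζ z‖ₑ = 0 := by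
    intro ζ hζ
    have : ∀ z, G ζ z = 0 := fun z => by
      by_contra h
      exact hζ (hGsupp ζ z h).1
    simp [this]
  rw [← lintegral_add_compl _ (measurableSet_shell d (4 * r)),
    setLIntegral_congr_fun (measurableSet_shell d (4 * r)).compl hzero, lintegral_zero, add_zero,
    ← lintegral_const_mul' _ _ ENNReal.coe_ne_top]
  refine setLIntegral_mono' (measurableSet_shell d (4 * r)) fun ζ hζ => ?_
  have hwp : 0 < wt a 1 s x ζ ^ N := by
    have := one_le_wt a one_pos s x ζ
    positivity
  have := hJ ζ hζ
  rw [← ofReal_norm, ← ENNReal.ofReal.eq_1 D, ← ENNReal.ofReal_mul hD]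
  refine ENNReal.ofReal_le_ofReal ?_
  rw [← div_eq_mul_inv, le_div_iff₀ hwp]
  linarith

theorem lintegral_comp_smul_eq {d : ℕ} (f : Rd d → ℝ≥0∞) {t : ℝ} (ht : 0 < t) :
    ∫⁻ x, f (t • x) = ENNReal.ofReal ((t ^ d)⁻¹) * ∫⁻ x, f x := by
  have h := (Homeomorph.smulOfNeZero t ht.ne' : Rd d ≃ₜ Rd d).measurableEmbedding.lintegral_map
    (μ := volume) f
  have h2 := Measure.map_addHaar_smul (volume : Measure (Rd d)) ht.ne'
  rw [finrank_euclideanSpace_fin, abs_of_pos (by positivity)] at h2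
  have h3 : ⇑(Homeomorph.smulOfNeZero t ht.ne' : Rd d ≃ₜ Rd d) = fun x => t • x := rfl
  rw [h3] at h
  rw [show (fun x : Rd d => t • x) = (t • ·) from rfl, h2, lintegral_smul_measure] at h
  exact h.symm

/-- The mass of a rescaled polynomially decaying bump. -/
theorem exists_lintegral_bump_le (d N : ℕ) (hN : d < 2 * N) :
    ∃ C : ℝ≥0, ∀ (t : ℝ) (v₀ : Rd d), 0 < t →
      ∫⁻ v, ENNReal.ofReal (((1 + t ^ 2 * ‖v - v₀‖ ^ 2) ^ N)⁻¹) ≤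
        C * ENNReal.ofReal ((t ^ d)⁻¹) := by
  have hint : Integrable (fun x : Rd d => ((1 : ℝ) + ‖x‖ ^ 2) ^ (-(2 * N : ℝ) / 2)) volume :=
    integrable_rpow_neg_one_add_norm_sq (by
      rw [finrank_euclideanSpace_fin]
      exact_mod_cast hN)
  have hfin : ∫⁻ x : Rd d, ENNReal.ofReal (((1 + ‖x‖ ^ 2) ^ N)⁻¹) ≠ ∞ := by
    have := hint.lintegral_lt_top
    refine ne_of_lt (lt_of_le_of_lt (lintegral_mono fun x => ?_) this)
    apply ENNReal.ofReal_le_ofReal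
    rw [show -(2 * N : ℝ) / 2 = -(N : ℝ) by ring, Real.rpow_neg (by positivity), Real.rpow_natCast]
  refine ⟨(∫⁻ x : Rd d, ENNReal.ofReal (((1 + ‖x‖ ^ 2) ^ N)⁻¹)).toNNReal, fun t v₀ ht => ?_⟩
  rw [ENNReal.coe_toNNReal hfin]
  have h1 := lintegral_sub_right_eq_self (μ := (volume : Measure (Rd d)))
    (fun v => ENNReal.ofReal (((1 + t ^ 2 * ‖v‖ ^ 2) ^ N)⁻¹)) v₀
  rw [h1]
  have h2 := lintegral_comp_smul_eq
    (fun x : Rd d => ENNReal.ofReal (((1 + ‖x‖ ^ 2) ^ N)⁻¹)) ht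
  simp only [norm_smul, mul_pow, Real.norm_eq_abs, sq_abs] at h2
  rw [h2, mul_comm]

/-- A map with injective derivative on a compact set pushes Lebesgue measure forward to a measure
with bounded density. -/
theorem exists_lintegral_comp_le {E : Type*} [NormedAddCommGroup E] [NormedSpace ℝ E]
    [FiniteDimensional ℝ E] [MeasurableSpace E] [BorelSpace E] (μ : Measure E)
    [μ.IsAddHaarMeasure] {K O : Set E} (hK : IsCompact K) (hO : IsOpen O) (hKO : K ⊆ O)
    (f : E → E) (hf : ContDiffOn ℝ 1 f O)
    (hinj : ∀ x ∈ K, ∀ v, fderiv ℝ f x v = 0 → v = 0) :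
    ∃ C : ℝ≥0, ∀ h : E → ℝ≥0∞, ∫⁻ x in K, h (f x) ∂μ ≤ C * ∫⁻ x, h x ∂μ := by
  refine hK.induction_on (p := fun s => ∃ C : ℝ≥0, ∀ h : E → ℝ≥0∞,
    ∫⁻ x in s, h (f x) ∂μ ≤ C * ∫⁻ x, h x ∂μ) ⟨0, by simp⟩ ?_ ?_ ?_
  · rintro s t hst ⟨C, hC⟩
    exact ⟨C, fun h => (lintegral_mono_set hst).trans (hC h)⟩
  · rintro s t ⟨C, hC⟩ ⟨C', hC'⟩
    refine ⟨C + C', fun h => (lintegral_union_le _ _ _).trans ?_⟩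
    rw [ENNReal.coe_add, add_mul]
    exact add_le_add (hC h) (hC' h)
  · intro x hx
    have hxO := hO.mem_nhds (hKO hx)
    let e : E ≃L[ℝ] E := (LinearEquiv.ofInjectiveEndo (fderiv ℝ f x : E →ₗ[ℝ] E)
      ((injective_iff_map_eq_zero _).2 (hinj x hx))).toContinuousLinearEquiv
    have he : (e : E →L[ℝ] E) = fderiv ℝ f x := by
      ext v
      rfl
    have hs : HasStrictFDerivAt f (e : E →L[ℝ] E) x := by
      rw [he]
      exact (hf.contDiffAt hxO).hasStrictFDerivAt (by simp)
    have hdet : (fderiv ℝ f x).det ≠ 0 := by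
      rw [← he]
      exact (LinearEquiv.isUnit_det' e.toLinearEquiv).ne_zero
    have hcont : ContinuousAt (fun y => |(fderiv ℝ f y).det|) x :=
      (ContinuousLinearMap.continuous_det.continuousAt.comp
        ((hf.continuousOn_fderiv_of_isOpen hO le_rfl).continuousAt hxO)).abs
    let c : ℝ := |(fderiv ℝ f x).det| / 2
    have hc : 0 < c := by positivity
    have hev := hcont.eventually_const_lt (show c < |(fderiv ℝ f x).det| by
      have := abs_pos.2 hdet
      simp only [c]; linarith)
    obtain ⟨V, hVsub, hVo, hxV⟩ := mem_nhds_iff.1 (Filter.inter_mem hev (Filter.inter_mem hxO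
      ((hs.toOpenPartialHomeomorph f).open_source.mem_nhds
        hs.mem_toOpenPartialHomeomorph_source)))
    refine ⟨V, mem_nhdsWithin_of_mem_nhds (hVo.mem_nhds hxV), c.toNNReal⁻¹, fun h => ?_⟩
    have hder : ∀ y ∈ V, HasFDerivWithinAt f (fderiv ℝ f y) V y := fun y hy =>
      ((hf.contDiffAt (hO.mem_nhds (hVsub hy).2.1)).differentiableAt
        (by simp)).hasFDerivAt.hasFDerivWithinAt
    have hVinj : InjOn f V := fun y hy z hz hyz =>
      (hs.toOpenPartialHomeomorph f).injOn (hVsub hy).2.2 (hVsub hz).2.2 hyz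
    have key := lintegral_image_eq_lintegral_abs_det_fderiv_mul μ hVo.measurableSet hder hVinj h
    have hcc : ENNReal.ofReal c ≠ 0 := by simpa using hc
    have h1 : ENNReal.ofReal c * ∫⁻ y in V, h (f y) ∂μ ≤ ∫⁻ y, h y ∂μ := by
      rw [← lintegral_const_mul' _ _ ENNReal.ofReal_ne_top]
      calc ∫⁻ y in V, ENNReal.ofReal c * h (f y) ∂μ
          ≤ ∫⁻ y in V, ENNReal.ofReal |(fderiv ℝ f y).det| * h (f y) ∂μ := by
            refine setLIntegral_mono' hVo.measurableSet fun y hy => ?_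
            gcongr
            exact (hVsub hy).1.le
        _ = ∫⁻ y in f '' V, h y ∂μ := key.symm
        _ ≤ _ := setLIntegral_le_lintegral _ _
    rw [ENNReal.coe_inv (by simpa using hc)]
    rw [← ENNReal.ofReal.eq_1 c, ← ENNReal.div_eq_inv_mul,
      ENNReal.le_div_iff_mul_le (Or.inl hcc) (Or.inl (by simp)),
      mul_comm]
    exact h1

section Curvature

variable {d : ℕ} {a : Rd d → ℝ}

theorem IsDistFn.contDiffOn_gradient (ha : IsDistFn a) :
    ContDiffOn ℝ (⊤ : ℕ∞) (gradient a) {ξ : Rd d | ξ ≠ 0} := by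
  have := ha.smooth.fderiv_of_isOpen (m := (⊤ : ℕ∞)) isOpen_ne (by simp)
  exact (InnerProductSpace.toDual ℝ (Rd d)).symm.contDiff.comp_contDiffOn this

theorem IsDistFn.contDiffOn_smul_gradient (ha : IsDistFn a) :
    ContDiffOn ℝ (⊤ : ℕ∞) (fun ξ => a ξ • gradient a ξ) {ξ : Rd d | ξ ≠ 0} :=
  ha.smooth.smul ha.contDiffOn_gradient

/-- The homogeneous map `a ∇a` has injective derivative when the cosphere is curved. -/
theorem IsDistFn.fderiv_smul_gradient_injective (ha : IsDistFn a) (hc : CurvNondeg a)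
    {ζ : Rd d} (hζ : ζ ≠ 0) (v : Rd d)
    (hv : fderiv ℝ (fun ξ => a ξ • gradient a ξ) ζ v = 0) : v = 0 := by
  have hO : IsOpen {ξ : Rd d | ξ ≠ 0} := isOpen_ne
  have hΨd : ∀ ξ : Rd d, ξ ≠ 0 → DifferentiableAt ℝ (fun ξ => a ξ • gradient a ξ) ξ := fun ξ hξ =>
    (ha.contDiffOn_smul_gradient.contDiffAt (hO.mem_nhds hξ)).differentiableAt (by simp)
  have hhom : ∀ t : ℝ, 0 < t → ∀ ξ : Rd d, ξ ≠ 0 →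
      fderiv ℝ (fun ξ => a ξ • gradient a ξ) (t • ξ) =
        fderiv ℝ (fun ξ => a ξ • gradient a ξ) ξ := by
    intro t ht ξ hξ
    have h1 : HasFDerivAt (fun ξ : Rd d => (fun ξ => a ξ • gradient a ξ) (t • ξ))
        (t • fderiv ℝ (fun ξ => a ξ • gradient a ξ) (t • ξ)) ξ := by
      have := (hΨd _ (smul_ne_zero ht.ne' hξ)).hasFDerivAt.comp ξ
        ((hasFDerivAt_id ξ).const_smul t)
      refine this.congr_fderiv ?_
      ext v
      simp
    have h2 : HasFDerivAt (fun ξ : Rd d => (fun ξ => a ξ • gradient a ξ) (t • ξ))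
        (t • fderiv ℝ (fun ξ => a ξ • gradient a ξ) ξ) ξ := by
      refine ((hΨd ξ hξ).hasFDerivAt.const_smul t).congr_of_eventuallyEq ?_
      filter_upwards [hO.mem_nhds hξ] with x hx
      simp [ha.homog t ht, ha.gradient_smul hx ht, mul_smul]
    exact smul_right_injective _ ht.ne' (h1.unique h2)
  have hap := ha.pos ζ hζ
  let ξ : Rd d := (a ζ)⁻¹ • ζ
  have hξ : ξ ≠ 0 := smul_ne_zero (inv_ne_zero hap.ne') hζ
  have haξ : a ξ = 1 := by
    simp only [ξ, ha.homog _ (inv_pos.2 hap)]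
    field_simp
  rw [← hhom _ (inv_pos.2 hap) ζ hζ] at hv
  change fderiv ℝ (fun ξ => a ξ • gradient a ξ) ξ v = 0 at hv
  have had := (ha.differentiableAt hξ).hasFDerivAt
  have hfd : DifferentiableAt ℝ (fderiv ℝ a) ξ :=
    ((ha.smooth.fderiv_of_isOpen (m := (⊤ : ℕ∞)) isOpen_ne (by simp)).contDiffAt
      (hO.mem_nhds hξ)).differentiableAt (by simp)
  have hgrad : HasFDerivAt (gradient a) (fderiv ℝ (gradient a) ξ) ξ :=
    ((ha.contDiffOn_gradient.contDiffAt (hO.mem_nhds hξ)).differentiableAt (by simp)).hasFDerivAt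
  have hgradw : ∀ w : Rd d, inner ℝ (fderiv ℝ (gradient a) ξ v) w
      = fderiv ℝ (fderiv ℝ a) ξ v w := by
    intro w
    have h1 := hgrad.inner ℝ (hasFDerivAt_const w ξ)
    have h2 := hfd.hasFDerivAt.clm_apply (hasFDerivAt_const w ξ)
    simp only [inner_gradient_eq_fderiv] at h1
    have := congrArg (fun L : Rd d →L[ℝ] ℝ => L v) (h1.unique h2)
    simpa using this
  have hprod := (had.smul hgrad).fderiv
  rw [show (fun ξ => a ξ • gradient a ξ) = a • gradient a from rfl, hprod] at hv
  have hvw : ∀ w : Rd d, fderiv ℝ (fderiv ℝ a) ξ v w + fderiv ℝ a ξ v * fderiv ℝ a ξ w = 0 := by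
    intro w
    have := congrArg (fun y => inner ℝ y w) hv
    simpa [haξ, inner_add_left, inner_smul_left, hgradw, mul_comm] using this
  have heuler : fderiv ℝ (fderiv ℝ a) ξ v ξ = 0 := by
    have h1 : HasFDerivAt (fun y => fderiv ℝ a y y) (fderiv ℝ a ξ) ξ := by
      refine had.congr_of_eventuallyEq ?_
      filter_upwards [hO.mem_nhds hξ] with y hy using ha.fderiv_self hy
    have h2 := hfd.hasFDerivAt.clm_apply (hasFDerivAt_id ξ)
    have := congrArg (fun L : Rd d →L[ℝ] ℝ => L v) (h1.unique h2)
    simpa using this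
  have hv0 : fderiv ℝ a ξ v = 0 := by
    have := hvw ξ
    rw [heuler, ha.fderiv_self hξ, haξ] at this
    linarith
  by_contra hne
  obtain ⟨w, -, hw⟩ := hc ξ haξ v hv0 hne
  apply hw
  rw [iteratedFDeriv_two_apply]
  have := hvw w
  rw [hv0, zero_mul, add_zero] at this
  simpa using this

end Curvature

theorem ENNReal.le_ofReal_inv_mul {u : ℝ} (hu : 0 < u) {X Y : ℝ≥0∞}
    (h : ENNReal.ofReal u * X ≤ Y) : X ≤ ENNReal.ofReal u⁻¹ * Y := by
  calc X = ENNReal.ofReal u⁻¹ * (ENNReal.ofReal u * X) := by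
        rw [← mul_assoc, ← ENNReal.ofReal_mul (by positivity), inv_mul_cancel₀ hu.ne']
        simp
    _ ≤ _ := by gcongr

theorem one_le_sqrt_one_add_abs (s : ℝ) : 1 ≤ √(1 + |s|) := by
  rw [Real.one_le_sqrt]
  linarith [abs_nonneg s]

section Dispersive

variable {d : ℕ} {a : Rd d → ℝ}

theorem IsDistFn.continuous (ha : IsDistFn a) : Continuous a := by
  obtain ⟨M, hM1, hM⟩ := ha.exists_bounds
  rw [continuous_iff_continuousAt]
  intro ξ
  by_cases h : ξ = 0
  · rw [h, ContinuousAt, ha.map_zero]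
    refine squeeze_zero (fun ξ => ha.nonneg ξ) (fun ξ => (hM ξ).1) ?_
    have : Continuous fun ξ : Rd d => M * ‖ξ‖ := by fun_prop
    simpa using this.tendsto 0
  · exact (ha.differentiableAt h).continuousAt

theorem measurable_gradient (a : Rd d → ℝ) : Measurable (gradient a) :=
  (InnerProductSpace.toDual ℝ (Rd d)).symm.continuous.measurable.comp (measurable_fderiv ℝ a)

/-- The dispersive estimate. -/
theorem IsDistFn.exists_dispersive_bound (ha : IsDistFn a) (hc : CurvNondeg a) (hd : 1 ≤ d)
    (R : ℝ) (hR : 1 ≤ R) (N : ℕ) (hN : d < 2 * N) :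
    ∃ C : ℝ≥0, ∀ (s : ℝ) (x : Rd d),
      ∫⁻ ζ in shell d R, ENNReal.ofReal (((1 + ‖phaseGrad a s x ζ‖ ^ 2 / (1 + |s|)) ^ N)⁻¹) ≤
        C * ENNReal.ofReal ((√(1 + |s|) ^ (d - 1))⁻¹) := by
  obtain ⟨M, hM1, hM⟩ := ha.exists_bounds
  obtain ⟨G, hG1, hG⟩ := ha.exists_gradient_bound
  obtain ⟨R₀, hR₀, hsh⟩ := ha.exists_shell_support
  obtain ⟨C₂, hC₂⟩ := exists_lintegral_bump_le d N hN
  have hRpos : ∀ ζ ∈ shell d R, ζ ≠ 0 := fun ζ => ne_zero_of_mem_shell (by linarith)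
  have hR0pos : ∀ ζ ∈ shell d R₀, ζ ≠ 0 := fun ζ => ne_zero_of_mem_shell (by linarith)
  let Ψ : Rd d → Rd d := fun ξ => a ξ • gradient a ξ
  have hΨm : Measurable Ψ := ha.continuous.measurable.smul (measurable_gradient a)
  obtain ⟨C₃, hC₃⟩ := exists_lintegral_comp_le (volume : Measure (Rd d)) (isCompact_shell d R₀)
    isOpen_ne hR0pos Ψ (ha.contDiffOn_smul_gradient.of_le (by exact_mod_cast le_top))
    (fun ζ hζ v hv => ha.fderiv_smul_gradient_injective hc (hR0pos ζ hζ) v hv)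
  let ρ₀ : ℝ := 1 / (2 * (M * R))
  let ρ₁ : ℝ := 3 / 2 * (M * R)
  have hρ₀ : 0 < ρ₀ := by positivity
  let A : ℝ := 8 + 2 * G ^ 2
  let D : ℝ≥0∞ := ENNReal.ofReal (M * R) * (ENNReal.ofReal (A ^ N) *
    (ENNReal.ofReal ((ρ₀ ^ d)⁻¹) * (C₃ * C₂) * ENNReal.ofReal (ρ₁ - ρ₀)))
  have hDtop : D ≠ ∞ := by
    simp only [D]
    finiteness
  let V : ℝ≥0∞ := ENNReal.ofReal (2 ^ (d - 1)) * volume (shell d R)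
  have hVtop : V ≠ ∞ := ENNReal.mul_ne_top (by simp) (isCompact_shell d R).measure_lt_top.ne
  refine ⟨(D + V).toNNReal, fun s x => ?_⟩
  rw [ENNReal.coe_toNNReal (by finiteness)]
  set τ : ℝ := √(1 + |s|) with hτ
  have hτ1 : 1 ≤ τ := one_le_sqrt_one_add_abs s
  have hτ2 : τ ^ 2 = 1 + |s| := Real.sq_sqrt (by positivity)
  have hS : 0 < 1 + |s| := by positivity
  rw [add_mul]
  by_cases hs : |s| < 1
  · refine le_trans ?_ le_add_self
    have h1 : τ ≤ 2 := by nlinarith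
    calc ∫⁻ ζ in shell d R, ENNReal.ofReal (((1 + ‖phaseGrad a s x ζ‖ ^ 2 / (1 + |s|)) ^ N)⁻¹)
        ≤ ∫⁻ ζ in shell d R, 1 := by
          refine lintegral_mono fun ζ => ?_
          rw [← ENNReal.ofReal_one]
          apply ENNReal.ofReal_le_ofReal
          apply inv_le_one_of_one_le₀
          apply one_le_pow₀
          have : 0 ≤ ‖phaseGrad a s x ζ‖ ^ 2 / (1 + |s|) := by positivity
          linarith
      _ = 1 * volume (shell d R) := by simp
      _ ≤ (ENNReal.ofReal (2 ^ (d - 1)) * ENNReal.ofReal ((τ ^ (d - 1))⁻¹)) *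
          volume (shell d R) := by
        gcongr
        rw [← ENNReal.ofReal_mul (by positivity), ← ENNReal.ofReal_one]
        apply ENNReal.ofReal_le_ofReal
        rw [← div_eq_mul_inv, one_le_div (by positivity)]
        gcongr
      _ = _ := by simp only [V]; ring
  · push Not at hs
    refine le_trans ?_ le_self_add
    have hs0 : s ≠ 0 := by
      rintro rfl
      simp at hs
      linarith
    let v₀ : Rd d := (-(2 * π) / s) • x
    let h : Rd d → ℝ≥0∞ := fun v => ENNReal.ofReal (((1 + τ ^ 2 * ‖v - v₀‖ ^ 2) ^ N)⁻¹)
    have hhm : Measurable h := by fun_prop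
    let k : Rd d → ℝ≥0∞ := (shell d R₀).indicator (h ∘ Ψ)
    have hkm : Measurable k := (hhm.comp hΨm).indicator (measurableSet_shell d R₀)
    let f : Rd d → ℝ≥0∞ := fun ζ =>
      ENNReal.ofReal (((1 + ‖phaseGrad a s x ζ‖ ^ 2 / (1 + |s|)) ^ N)⁻¹)
    have hpt : ∀ ζ ∈ shell d R, ∀ ρ : ℝ, 0 < ρ → |ρ * a ζ - 1| ≤ 1 / (2 * τ) →
        f ζ ≤ ENNReal.ofReal (A ^ N) * k (ρ • ζ) := by
      intro ζ hζ ρ hρ hρa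
      have hζ0 := hRpos ζ hζ
      have hle : 1 / (2 * τ) ≤ 1 / 2 := by
        apply one_div_le_one_div_of_le <;> linarith
      have hmem : ρ • ζ ∈ shell d R₀ := by
        apply hsh
        rw [ha.homog ρ hρ]
        have := abs_le.1 (hρa.trans hle)
        constructor <;> linarith [this.1, this.2]
      have hk : k (ρ • ζ) = h (Ψ (ρ • ζ)) := by
        simp only [k, indicator_of_mem hmem, Function.comp]
      rw [hk, ← ENNReal.ofReal_mul (by positivity)]
      apply ENNReal.ofReal_le_ofReal
      have hΨ : Ψ (ρ • ζ) - v₀ = (gradient a ζ - v₀) + (ρ * a ζ - 1) • gradient a ζ := by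
        simp only [Ψ, ha.homog ρ hρ, ha.gradient_smul hζ0 hρ, sub_smul, one_smul]
        abel
      have hY : phaseGrad a s x ζ = s • (gradient a ζ - v₀) := by
        simp only [phaseGrad, v₀, smul_sub, smul_smul]
        rw [mul_div_cancel₀ _ hs0, neg_smul, sub_neg_eq_add]
      have hYn : ‖phaseGrad a s x ζ‖ ^ 2 / (1 + |s|) ≥ τ ^ 2 * ‖gradient a ζ - v₀‖ ^ 2 / 4 := by
        rw [hY, norm_smul, mul_pow, Real.norm_eq_abs, hτ2, ge_iff_le, le_div_iff₀ hS]
        have : (1 + |s|) ^ 2 ≤ 4 * |s| ^ 2 := by nlinarith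
        nlinarith [sq_nonneg ‖gradient a ζ - v₀‖]
      have hn : ‖Ψ (ρ • ζ) - v₀‖ ≤ ‖gradient a ζ - v₀‖ + G / (2 * τ) := by
        rw [hΨ]
        refine (norm_add_le _ _).trans ?_
        gcongr
        rw [norm_smul, Real.norm_eq_abs]
        calc _ ≤ 1 / (2 * τ) * G := by
              gcongr
              exact hG ζ hζ0
          _ = _ := by ring
      have hn2 : τ ^ 2 * ‖Ψ (ρ • ζ) - v₀‖ ^ 2 ≤ 2 * (τ ^ 2 * ‖gradient a ζ - v₀‖ ^ 2) + G ^ 2 := by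
        have h1 : τ * ‖Ψ (ρ • ζ) - v₀‖ ≤ τ * ‖gradient a ζ - v₀‖ + G / 2 := by
          calc _ ≤ τ * (‖gradient a ζ - v₀‖ + G / (2 * τ)) := by gcongr
            _ = _ := by field_simp
        have h2 : 0 ≤ τ * ‖Ψ (ρ • ζ) - v₀‖ := by positivity
        have h3 : 0 ≤ τ * ‖gradient a ζ - v₀‖ := by positivity
        nlinarith [sq_nonneg (τ * ‖gradient a ζ - v₀‖ - G / 2)]
      rw [← inv_inv (A ^ N), ← mul_inv]
      apply inv_anti₀ (by positivity)
      rw [inv_mul_le_iff₀ (by positivity), ← mul_pow A]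
      apply pow_le_pow_left₀ (by positivity)
      have : 0 ≤ ‖phaseGrad a s x ζ‖ ^ 2 / (1 + |s|) := by positivity
      simp only [A]
      nlinarith [mul_nonneg (sq_nonneg G) this]
    have hone : ∀ ζ ∈ shell d R, ENNReal.ofReal (1 / (τ * (M * R))) * f ζ ≤
        ∫⁻ ρ in Icc ρ₀ ρ₁, ENNReal.ofReal (A ^ N) * k (ρ • ζ) := by
      intro ζ hζ
      have hap := ha.pos ζ (hRpos ζ hζ)
      have haM : a ζ ≤ M * R := (hM ζ).1.trans (by gcongr; exact hζ.2)
      have haM' : (a ζ)⁻¹ ≤ M * R := by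
        rw [inv_le_iff_one_le_mul₀ hap]
        have h1 := (hM ζ).2
        have h2 := hζ.1
        rw [inv_le_iff_one_le_mul₀ (by linarith)] at h2
        nlinarith
      let I : Set ℝ := Icc ((1 - 1 / (2 * τ)) / a ζ) ((1 + 1 / (2 * τ)) / a ζ)
      have hle : 1 / (2 * τ) ≤ 1 / 2 := by
        apply one_div_le_one_div_of_le <;> linarith
      have hIsub : I ⊆ Icc ρ₀ ρ₁ := by
        apply Icc_subset_Icc
        · simp only [ρ₀]
          rw [div_le_div_iff₀ (by positivity) hap]
          have : 0 < M * R := by positivity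
          nlinarith
        · simp only [ρ₁]
          rw [div_eq_mul_inv]
          gcongr
          linarith
      have hIvol : volume I = ENNReal.ofReal (1 / (τ * a ζ)) := by
        rw [Real.volume_Icc]
        congr 1
        field_simp
        ring
      calc ENNReal.ofReal (1 / (τ * (M * R))) * f ζ ≤ volume I * f ζ := by
            rw [hIvol]
            gcongr
        _ = ∫⁻ ρ in I, f ζ := by rw [setLIntegral_const, mul_comm]
        _ ≤ ∫⁻ ρ in I, ENNReal.ofReal (A ^ N) * k (ρ • ζ) := by
          refine setLIntegral_mono' measurableSet_Icc fun ρ hρ => hpt ζ hζ ρ ?_ ?_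
          · exact hρ₀.trans_le (hIsub hρ).1
          · have h1 := hρ.1
            have h2 := hρ.2
            rw [div_le_iff₀ hap] at h1
            rw [le_div_iff₀ hap] at h2
            rw [abs_le]
            constructor <;> linarith
        _ ≤ _ := lintegral_mono_set hIsub
    have hkint : ∫⁻ ξ, k ξ ≤ (C₃ * C₂) * ENNReal.ofReal ((τ ^ d)⁻¹) := by
      simp only [k]
      rw [lintegral_indicator (measurableSet_shell d R₀)]
      refine (hC₃ h).trans ?_
      rw [mul_assoc]
      gcongr
      exact hC₂ τ v₀ (by linarith)
    have hmain : ENNReal.ofReal (1 / (τ * (M * R))) * ∫⁻ ζ in shell d R, f ζ ≤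
        ENNReal.ofReal (A ^ N) * (ENNReal.ofReal ((ρ₀ ^ d)⁻¹) *
          ((C₃ * C₂) * ENNReal.ofReal ((τ ^ d)⁻¹)) * ENNReal.ofReal (ρ₁ - ρ₀)) := by
      rw [← lintegral_const_mul' _ _ ENNReal.ofReal_ne_top]
      calc _ ≤ ∫⁻ ζ in shell d R, ∫⁻ ρ in Icc ρ₀ ρ₁, ENNReal.ofReal (A ^ N) * k (ρ • ζ) :=
            setLIntegral_mono' (measurableSet_shell d R) hone
        _ ≤ ∫⁻ ζ, ∫⁻ ρ in Icc ρ₀ ρ₁, ENNReal.ofReal (A ^ N) * k (ρ • ζ) :=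
            setLIntegral_le_lintegral _ _
        _ = ∫⁻ ρ in Icc ρ₀ ρ₁, ∫⁻ ζ, ENNReal.ofReal (A ^ N) * k (ρ • ζ) := by
            apply lintegral_lintegral_swap
            apply Measurable.aemeasurable
            fun_prop
        _ = ∫⁻ ρ in Icc ρ₀ ρ₁,
              ENNReal.ofReal (A ^ N) * (ENNReal.ofReal ((ρ ^ d)⁻¹) * ∫⁻ ξ, k ξ) := by
            refine setLIntegral_congr_fun measurableSet_Icc fun ρ hρ => ?_
            rw [lintegral_const_mul' _ _ ENNReal.ofReal_ne_top,
              lintegral_comp_smul_eq k (hρ₀.trans_le hρ.1)]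
        _ ≤ ∫⁻ ρ in Icc ρ₀ ρ₁, ENNReal.ofReal (A ^ N) * (ENNReal.ofReal ((ρ₀ ^ d)⁻¹) *
              ((C₃ * C₂) * ENNReal.ofReal ((τ ^ d)⁻¹))) := by
            refine setLIntegral_mono' measurableSet_Icc fun ρ hρ => ?_
            gcongr
            exact hρ.1
        _ = _ := by
            rw [setLIntegral_const, Real.volume_Icc]
            ring
    refine (ENNReal.le_ofReal_inv_mul (by positivity) hmain).trans (le_of_eq ?_)
    have e1 : ENNReal.ofReal (1 / (τ * (M * R)))⁻¹ * ENNReal.ofReal ((τ ^ d)⁻¹)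
        = ENNReal.ofReal (M * R) * ENNReal.ofReal ((τ ^ (d - 1))⁻¹) := by
      rw [← ENNReal.ofReal_mul (by positivity), ← ENNReal.ofReal_mul (by positivity)]
      congr 1
      obtain ⟨m, rfl⟩ : ∃ m, d = m + 1 := ⟨d - 1, by omega⟩
      simp only [Nat.add_sub_cancel]
      field_simp
      rw [pow_succ]
      ring
    simp only [D]
    calc _ = (ENNReal.ofReal (1 / (τ * (M * R)))⁻¹ * ENNReal.ofReal ((τ ^ d)⁻¹)) *
          (ENNReal.ofReal (A ^ N) * (ENNReal.ofReal ((ρ₀ ^ d)⁻¹) * (C₃ * C₂) *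
            ENNReal.ofReal (ρ₁ - ρ₀))) := by ring
      _ = _ := by rw [e1]; ring

end Dispersive

section Tube

variable {d : ℕ} {a : Rd d → ℝ}

set_option maxHeartbeats 1000000 in
theorem IsDistFn.exists_wt_le (ha : IsDistFn a) (R : ℝ) (hR : 1 ≤ R) (B : ℝ) (hB : 0 ≤ B) :
    ∃ C : ℝ, 1 ≤ C ∧ ∀ l s s' : ℝ, ∀ x x' ζ ζ' : Rd d, ∀ ρ ∈ Icc (1 : ℝ) 2, 1 ≤ l →
      l ≤ 1 + |s| → l ≤ 1 + |s'| → |s - s'| ≤ 2 * l → ‖x - x'‖ ≤ B * l →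
      ζ ∈ shell d R → ‖ζ' - ρ • ζ‖ ≤ √(l / (1 + |s'|)) / (2 * R) →
      ζ' ∈ shell d (4 * R) ∧ wt a l s' x' ζ' ≤ C * wt a l s x ζ := by
  obtain ⟨C₁, hC₁, hT⟩ := ha.exists_taylor_bound (4 * R) (by linarith)
  obtain ⟨M, hM1, hM⟩ := ha.exists_bounds
  obtain ⟨G, hG1, hG⟩ := ha.exists_gradient_bound
  let B' : ℝ := 2 * (M * (4 * R)) + 2 * π * (B * (4 * R))
  let G' : ℝ := 2 * G + 2 * π * B
  have hB' : 0 ≤ B' := by positivity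
  have hG' : 0 ≤ G' := by positivity
  let D : ℝ := 5 * C₁ + B' + 36 * C₁ ^ 2 + 2 * G' ^ 2
  have hD : 0 ≤ D := by positivity
  refine ⟨20 + D, by linarith, ?_⟩
  intro l s s' x x' ζ ζ' ρ hρ hl hls hls' hss hxx hζ hζ'
  have hS : 0 < 1 + |s| := by positivity
  have hS' : 0 < 1 + |s'| := by positivity
  have hl0 : 0 < l := by linarith
  have h3 : 1 + |s| ≤ 3 * (1 + |s'|) := by
    have := abs_sub_abs_le_abs_sub s s'
    linarith
  have h3' : 1 + |s'| ≤ 3 * (1 + |s|) := by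
    have := abs_sub_abs_le_abs_sub s' s
    rw [abs_sub_comm] at this
    linarith
  set ε : ℝ := √(l / (1 + |s'|)) / (2 * R) with hε
  have hδ1 : √(l / (1 + |s'|)) ≤ 1 := by
    rw [Real.sqrt_le_iff, one_pow, div_le_one hS']
    exact ⟨zero_le_one, hls'⟩
  have hε0 : 0 ≤ ε := by positivity
  have hε1 : ε ≤ 1 / (2 * R) := by
    rw [hε]
    gcongr
  have hε2 : ε ^ 2 ≤ l / (1 + |s'|) := by
    rw [hε, div_pow, Real.sq_sqrt (by positivity)]
    apply div_le_self (by positivity)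
    nlinarith
  have hεS : (1 + |s|) * ε ^ 2 ≤ 3 * l := by
    calc (1 + |s|) * ε ^ 2 ≤ (3 * (1 + |s'|)) * (l / (1 + |s'|)) := by gcongr
      _ = 3 * l := by field_simp
  have hRζ : R⁻¹ ≤ ‖ζ‖ := hζ.1
  have hRζ' : ‖ζ‖ ≤ R := hζ.2
  have hnorm1 : ‖ρ • ζ‖ = ρ * ‖ζ‖ := by
    rw [norm_smul, Real.norm_of_nonneg (by linarith [hρ.1])]
  have hmem1 : ρ • ζ ∈ shell d (4 * R) := by
    have h1 : (4 : ℝ)⁻¹ ≤ ρ := by linarith [hρ.1]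
    have h2 : ρ ≤ 4 := by linarith [hρ.2]
    exact smul_mem_shell (by linarith) (by norm_num) h1 h2 hζ
  have hmem : ζ' ∈ shell d (4 * R) := by
    have h1 : R⁻¹ ≤ ρ * ‖ζ‖ := by nlinarith [hρ.1, norm_nonneg ζ]
    have h2 : ρ * ‖ζ‖ ≤ 2 * R := by
      apply mul_le_mul hρ.2 hRζ' (norm_nonneg _) (by norm_num)
    have h3 : 1 / (2 * R) = R⁻¹ / 2 := by field_simp
    have h4 : R⁻¹ ≤ 1 := inv_le_one_of_one_le₀ hR
    have h5 : (4 * R)⁻¹ = R⁻¹ / 4 := by field_simp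
    have h6 : 0 < R⁻¹ := by positivity
    constructor
    · have := norm_sub_norm_le (ρ • ζ) ζ'
      rw [norm_sub_rev] at this
      rw [h5]
      linarith
    · have := norm_sub_norm_le ζ' (ρ • ζ)
      linarith
  refine ⟨hmem, ?_⟩
  have hρ0 : 0 < ρ := by linarith [hρ.1]
  have hζ0 : ζ ≠ 0 := ne_zero_of_mem_shell (by linarith) hζ
  have hζ'0 : ζ' ≠ 0 := ne_zero_of_mem_shell (by linarith) hmem
  obtain ⟨hg, ht⟩ := hT (ρ • ζ) hmem1 ζ' hmem
  set Y := phaseGrad a s x ζ with hY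
  have hY1 : phaseGrad a s x (ρ • ζ) = Y := ha.phaseGrad_smul s x hζ0 hρ0
  have hΦ1 : phase a s x (ρ • ζ) = ρ * phase a s x ζ := ha.phase_smul s x ζ hρ0
  have hw := hζ'
  set w := ζ' - ρ • ζ with hwdef
  have hζ'M : ‖ζ'‖ ≤ 4 * R := hmem.2
  have ha' : |a ζ'| ≤ M * (4 * R) := by
    rw [abs_of_nonneg (ha.nonneg _)]
    exact (hM ζ').1.trans (by gcongr)
  have hΦ : |phase a s' x' ζ'| ≤ 2 * |phase a s x ζ| + ‖Y‖ ^ 2 / (1 + |s|) +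
      (5 * C₁ + B') * l := by
    have e : phase a s' x' ζ' = ρ * phase a s x ζ + inner ℝ Y w +
        s * (a ζ' - a (ρ • ζ) - fderiv ℝ a (ρ • ζ) w) + (s' - s) * a ζ' +
        2 * π * inner ℝ (x' - x) ζ' := by
      rw [← hY1, inner_phaseGrad, ← hΦ1]
      simp only [phase, w, inner_sub_left, inner_sub_right]
      ring
    have b1 : |ρ * phase a s x ζ| ≤ 2 * |phase a s x ζ| := by
      rw [abs_mul, abs_of_pos hρ0]
      gcongr
      exact hρ.2
    have b2 : |inner ℝ Y w| ≤ ‖Y‖ ^ 2 / (1 + |s|) + 2 * l := by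
      have h1 : |inner ℝ Y w| ≤ ‖Y‖ * ε := (abs_real_inner_le_norm _ _).trans (by gcongr)
      have h2 : 2 * (‖Y‖ * ε) ≤ ‖Y‖ ^ 2 / (1 + |s|) + (1 + |s|) * ε ^ 2 := by
        have h4 : ‖Y‖ ^ 2 / (1 + |s|) + (1 + |s|) * ε ^ 2 - 2 * (‖Y‖ * ε) =
          (‖Y‖ - (1 + |s|) * ε) ^ 2 / (1 + |s|) := by
          field_simp
          ring
        have : 0 ≤ (‖Y‖ - (1 + |s|) * ε) ^ 2 / (1 + |s|) := by positivity
        linarith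
      have h3 : 0 ≤ ‖Y‖ ^ 2 / (1 + |s|) := by positivity
      linarith
    have b3 : |s * (a ζ' - a (ρ • ζ) - fderiv ℝ a (ρ • ζ) w)| ≤ 3 * C₁ * l := by
      rw [abs_mul]
      calc |s| * |a ζ' - a (ρ • ζ) - fderiv ℝ a (ρ • ζ) w| ≤ (1 + |s|) * (C₁ * ε ^ 2) := by
            gcongr
            · linarith
            · exact ht.trans (by gcongr)
        _ = C₁ * ((1 + |s|) * ε ^ 2) := by ring
        _ ≤ C₁ * (3 * l) := by gcongr
        _ = _ := by ring
    have b4 : |(s' - s) * a ζ'| ≤ 2 * (M * (4 * R)) * l := by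
      rw [abs_mul, abs_sub_comm]
      calc |s - s'| * |a ζ'| ≤ 2 * l * (M * (4 * R)) := by gcongr
        _ = _ := by ring
    have b5 : |2 * π * inner ℝ (x' - x) ζ'| ≤ 2 * π * (B * (4 * R)) * l := by
      rw [abs_mul, abs_of_pos (by positivity)]
      calc 2 * π * |inner ℝ (x' - x) ζ'| ≤ 2 * π * (‖x' - x‖ * ‖ζ'‖) := by
            gcongr
            exact abs_real_inner_le_norm _ _
        _ ≤ 2 * π * (B * l * (4 * R)) := by
            rw [norm_sub_rev]
            gcongr
        _ = _ := by ring
    rw [e]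
    refine (abs_add_le _ _).trans ?_
    refine (add_le_add_left (abs_add_le _ _) _).trans ?_
    refine (add_le_add_left (add_le_add_left (abs_add_le _ _) _) _).trans ?_
    refine (add_le_add_left (add_le_add_left (add_le_add_left (abs_add_le _ _) _) _) _).trans ?_
    simp only [B']
    linarith [mul_le_mul_of_nonneg_right hC₁ hl0.le]
  have hYY : ‖phaseGrad a s' x' ζ'‖ ^ 2 / (1 + |s'|) ≤ 12 * (‖Y‖ ^ 2 / (1 + |s|)) +
      (36 * C₁ ^ 2 + 2 * G' ^ 2) * l := by
    have e : phaseGrad a s' x' ζ' = (Y + s • (gradient a ζ' - gradient a (ρ • ζ))) +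
        ((s' - s) • gradient a ζ' + (2 * π) • (x' - x)) := by
      rw [← hY1]
      simp only [phaseGrad, smul_sub, sub_smul]
      abel
    have b1 : ‖s • (gradient a ζ' - gradient a (ρ • ζ))‖ ≤ (1 + |s|) * (C₁ * ε) := by
      rw [norm_smul, Real.norm_eq_abs]
      gcongr
      · linarith
      · exact hg.trans (by gcongr)
    have b2 : ‖(s' - s) • gradient a ζ' + (2 * π) • (x' - x)‖ ≤ G' * l := by
      refine (norm_add_le _ _).trans ?_
      rw [norm_smul, norm_smul, Real.norm_eq_abs, abs_sub_comm, norm_sub_rev,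
        Real.norm_of_nonneg (by positivity)]
      calc |s - s'| * ‖gradient a ζ'‖ + 2 * π * ‖x - x'‖ ≤ 2 * l * G + 2 * π * (B * l) := by
            gcongr
            exact hG _ hζ'0
        _ = _ := by simp only [G']; ring
    have b3 : ‖phaseGrad a s' x' ζ'‖ ^ 2 ≤ 4 * ‖Y‖ ^ 2 + 4 * ((1 + |s|) * (C₁ * ε)) ^ 2 +
        2 * (G' * l) ^ 2 := by
      have h1 : ‖phaseGrad a s' x' ζ'‖ ≤ (‖Y‖ + (1 + |s|) * (C₁ * ε)) + G' * l := by
        rw [e]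
        refine (norm_add_le _ _).trans (add_le_add ((norm_add_le _ _).trans ?_) b2)
        gcongr
      have h2 := pow_le_pow_left₀ (norm_nonneg _) h1 2
      have h3 : ∀ p q r : ℝ, (p + q + r) ^ 2 ≤ 4 * p ^ 2 + 4 * q ^ 2 + 2 * r ^ 2 := fun p q r => by
        nlinarith [sq_nonneg (p + q - r), sq_nonneg (p - q)]
      exact h2.trans (h3 _ _ _)
    have hi : (1 + |s'|)⁻¹ ≤ 3 * (1 + |s|)⁻¹ := by
      rw [← div_eq_mul_inv, le_div_iff₀ hS, inv_mul_le_iff₀ hS']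
      linarith
    calc ‖phaseGrad a s' x' ζ'‖ ^ 2 / (1 + |s'|)
        ≤ (4 * ‖Y‖ ^ 2 + 4 * ((1 + |s|) * (C₁ * ε)) ^ 2 + 2 * (G' * l) ^ 2) / (1 + |s'|) := by
          gcongr
      _ = (4 * ‖Y‖ ^ 2) * (1 + |s'|)⁻¹ + 4 * C₁ ^ 2 * ((1 + |s|) * ((1 + |s|) * ε ^ 2)) *
            (1 + |s'|)⁻¹ + 2 * G' ^ 2 * (l * (l / (1 + |s'|))) := by
          field_simp
      _ ≤ (4 * ‖Y‖ ^ 2) * (3 * (1 + |s|)⁻¹) + 4 * C₁ ^ 2 * ((1 + |s|) * (3 * l)) *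
            (3 * (1 + |s|)⁻¹) + 2 * G' ^ 2 * (l * 1) := by
          gcongr
          rw [div_le_one hS']
          exact hls'
      _ = 12 * (‖Y‖ ^ 2 / (1 + |s|)) + (36 * C₁ ^ 2 + 2 * G' ^ 2) * l := by
          field_simp
          ring
  unfold wt
  rw [← hY]
  have hq : 0 ≤ ‖Y‖ ^ 2 / (1 + |s|) := by positivity
  have hsum : |phase a s' x' ζ'| + ‖phaseGrad a s' x' ζ'‖ ^ 2 / (1 + |s'|) ≤
      20 * (|phase a s x ζ| + ‖Y‖ ^ 2 / (1 + |s|)) + D * l := by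
    simp only [D]
    linarith [abs_nonneg (phase a s x ζ)]
  have h0 : 0 ≤ (|phase a s x ζ| + ‖Y‖ ^ 2 / (1 + |s|)) / l := by positivity
  calc 1 + (|phase a s' x' ζ'| + ‖phaseGrad a s' x' ζ'‖ ^ 2 / (1 + |s'|)) / l
      ≤ 1 + (20 * (|phase a s x ζ| + ‖Y‖ ^ 2 / (1 + |s|)) + D * l) / l := by gcongr
    _ = 1 + 20 * ((|phase a s x ζ| + ‖Y‖ ^ 2 / (1 + |s|)) / l) + D := by
        field_simp
        ring
    _ ≤ _ := by linarith [mul_nonneg hD h0]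

theorem exists_le_volume_tube (d : ℕ) (hd : 1 ≤ d) (R : ℝ) (hR : 1 ≤ R) :
    ∃ C : ℝ≥0, ∀ ζ ∈ shell d R, ∀ ε : ℝ, 0 < ε →
      MeasurableSet {ζ' : Rd d | ∃ ρ ∈ Icc (1 : ℝ) 2, ‖ζ' - ρ • ζ‖ ≤ ε} ∧
      ENNReal.ofReal (ε ^ (d - 1)) ≤
        C * volume {ζ' : Rd d | ∃ ρ ∈ Icc (1 : ℝ) 2, ‖ζ' - ρ • ζ‖ ≤ ε} := by
  set V := volume (Metric.closedBall (0 : Rd d) 1) with hV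
  have hV0 : V ≠ 0 := (Metric.measure_closedBall_pos volume _ one_pos).ne'
  have hVt : V ≠ ∞ := measure_closedBall_lt_top.ne
  refine ⟨(V⁻¹ * ENNReal.ofReal (2 * R)).toNNReal, fun ζ hζ ε hε => ?_⟩
  rw [ENNReal.coe_toNNReal (by finiteness)]
  set T := {ζ' : Rd d | ∃ ρ ∈ Icc (1 : ℝ) 2, ‖ζ' - ρ • ζ‖ ≤ ε} with hT
  have hTeq : T = (fun p : ℝ × Rd d => p.1 • ζ + p.2) ''
      (Icc (1 : ℝ) 2 ×ˢ Metric.closedBall (0 : Rd d) ε) := by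
    ext ζ'
    simp only [hT, mem_ofPred_eq, mem_image, mem_prod, Prod.exists, mem_closedBall_zero_iff]
    constructor
    · rintro ⟨ρ, hρ, h⟩
      exact ⟨ρ, ζ' - ρ • ζ, ⟨hρ, h⟩, by abel⟩
    · rintro ⟨ρ, w, ⟨hρ, h⟩, rfl⟩
      exact ⟨ρ, hρ, by simpa using h⟩
  have hTm : MeasurableSet T := by
    rw [hTeq]
    refine IsCompact.measurableSet (IsCompact.image (isCompact_Icc.prod
      (isCompact_closedBall _ _)) (by fun_prop))
  refine ⟨hTm, ?_⟩
  let S : Set (ℝ × Rd d) := {p | p.1 ∈ Icc (1 : ℝ) 2 ∧ ‖p.2 - p.1 • ζ‖ ≤ ε}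
  have hS : MeasurableSet S := by
    refine (measurable_fst measurableSet_Icc).inter ?_
    exact measurableSet_le (f := fun p : ℝ × Rd d => ‖p.2 - p.1 • ζ‖) (by fun_prop) (by fun_prop)
  have h1 : (volume.prod volume) S = V * ENNReal.ofReal (ε ^ d) := by
    rw [Measure.prod_apply hS]
    have : ∀ ρ : ℝ, volume (Prod.mk ρ ⁻¹' S) =
        (Icc (1 : ℝ) 2).indicator (fun _ => V * ENNReal.ofReal (ε ^ d)) ρ := by
      intro ρ
      by_cases hρ : ρ ∈ Icc (1 : ℝ) 2
      · rw [indicator_of_mem hρ]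
        have : Prod.mk ρ ⁻¹' S = Metric.closedBall (ρ • ζ) ε := by
          ext ζ'
          simp only [S, mem_preimage, mem_ofPred_eq, hρ, true_and, mem_closedBall_iff_norm]
        rw [this, Measure.addHaar_closedBall' _ _ hε.le, hV, finrank_euclideanSpace_fin, mul_comm]
      · rw [indicator_of_notMem hρ]
        have : Prod.mk ρ ⁻¹' S = ∅ := by
          ext ζ'
          simp only [S, mem_preimage, mem_ofPred_eq, hρ, false_and, mem_empty_iff_false]
        rw [this, measure_empty]
    simp_rw [this]
    rw [lintegral_indicator measurableSet_Icc, setLIntegral_const, Real.volume_Icc]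
    norm_num
  have h2 : (volume.prod volume) S ≤ ENNReal.ofReal (2 * R * ε) * volume T := by
    rw [Measure.prod_apply_symm hS, ← setLIntegral_const, ← lintegral_indicator hTm]
    refine lintegral_mono fun ζ' => ?_
    by_cases hζ' : ζ' ∈ T
    · rw [indicator_of_mem hζ']
      refine (Real.volume_le_diam _).trans ?_
      refine Metric.ediam_le fun ρ₁ h₁ ρ₂ h₂ => ?_
      rw [edist_dist, Real.dist_eq]
      apply ENNReal.ofReal_le_ofReal
      have e1 : ‖ζ' - ρ₁ • ζ‖ ≤ ε := h₁.2
      have e2 : ‖ζ' - ρ₂ • ζ‖ ≤ ε := h₂.2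
      have e3 : |ρ₁ - ρ₂| * ‖ζ‖ ≤ 2 * ε := by
        rw [← Real.norm_eq_abs, ← norm_smul]
        have : (ρ₁ - ρ₂) • ζ = (ζ' - ρ₂ • ζ) - (ζ' - ρ₁ • ζ) := by
          rw [sub_smul]; abel
        rw [this]
        exact (norm_sub_le _ _).trans (by linarith)
      have e4 : R⁻¹ ≤ ‖ζ‖ := hζ.1
      have e5 : |ρ₁ - ρ₂| * R⁻¹ ≤ 2 * ε := (by gcongr : _ ≤ _).trans e3
      rw [mul_inv_le_iff₀ (by linarith)] at e5
      linarith
    · rw [indicator_of_notMem hζ']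
      have : (fun x => (x, ζ')) ⁻¹' S = ∅ := by
        ext ρ
        simp only [S, mem_preimage, mem_ofPred_eq, mem_empty_iff_false, iff_false]
        exact fun h => hζ' ⟨ρ, h⟩
      rw [this, measure_empty]
  rw [h1] at h2
  obtain ⟨m, rfl⟩ : ∃ m, d = m + 1 := ⟨d - 1, by omega⟩
  rw [Nat.add_sub_cancel]
  have e : ENNReal.ofReal (ε ^ m) =
      V⁻¹ * (ENNReal.ofReal ε⁻¹ * (V * ENNReal.ofReal (ε ^ (m + 1)))) := by
    have : ENNReal.ofReal (ε ^ m) = ENNReal.ofReal ε⁻¹ * ENNReal.ofReal (ε ^ (m + 1)) := by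
      rw [← ENNReal.ofReal_mul (by positivity)]
      congr 1
      field_simp
      rw [pow_succ]
    rw [this]
    calc _ = (V⁻¹ * V) * (ENNReal.ofReal ε⁻¹ * ENNReal.ofReal (ε ^ (m + 1))) := by
          rw [ENNReal.inv_mul_cancel hV0 hVt, one_mul]
      _ = _ := by ring
  rw [e]
  calc _ ≤ V⁻¹ * (ENNReal.ofReal ε⁻¹ * (ENNReal.ofReal (2 * R * ε) * volume T)) := by gcongr
    _ = V⁻¹ * (ENNReal.ofReal (ε⁻¹ * (2 * R * ε)) * volume T) := by
        rw [← mul_assoc (ENNReal.ofReal ε⁻¹), ← ENNReal.ofReal_mul (by positivity)]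
    _ = _ := by
        have : ε⁻¹ * (2 * R * ε) = 2 * R := by field_simp
        rw [this, mul_assoc]

end Tube

section Majorant

variable {d : ℕ} {a : Rd d → ℝ}

theorem IsDistFn.measurable_wt (ha : IsDistFn a) (l s : ℝ) :
    Measurable fun p : Rd d × Rd d => wt a l s p.1 p.2 := by
  have h1 : Measurable fun p : Rd d × Rd d => a p.2 := ha.continuous.measurable.comp measurable_snd
  have h2 : Measurable fun p : Rd d × Rd d => gradient a p.2 :=
    (measurable_gradient a).comp measurable_snd
  have h3 : Measurable fun p : Rd d × Rd d => (inner ℝ p.1 p.2 : ℝ) := by fun_prop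
  have h4 : Measurable fun p : Rd d × Rd d => p.1 := measurable_fst
  unfold wt phase phaseGrad
  exact (((((h1.const_mul s).add (h3.const_mul (2 * π))).abs).add
    ((((h2.const_smul s).add (h4.const_smul (2 * π))).norm.pow_const 2).div_const _)).div_const
      l).const_add 1

/-- An average of negative powers of `wt a l s x ζ` over `ζ`, essentially constant at scale `l` in
`(s, x)`. -/
def tubeInt (a : Rd d → ℝ) (R l s : ℝ) (x : Rd d) : ℝ≥0∞ :=
  ENNReal.ofReal ((√(l / (1 + |s|)) ^ (d - 1))⁻¹) *
    ∫⁻ ζ in shell d R, ENNReal.ofReal ((wt a l s x ζ ^ (d + 2))⁻¹)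

theorem IsDistFn.measurable_tubeInt (ha : IsDistFn a) (R l s : ℝ) :
    Measurable (tubeInt a R l s) := by
  unfold tubeInt
  refine Measurable.const_mul ?_ _
  exact Measurable.lintegral_prod_right' (f := fun p : Rd d × Rd d =>
    ENNReal.ofReal ((wt a l s p.1 p.2 ^ (d + 2))⁻¹))
    (((ha.measurable_wt l s).pow_const _).inv.ennreal_ofReal)

theorem IsDistFn.exists_le_tubeInt (ha : IsDistFn a) (hd : 1 ≤ d) (R : ℝ) (hR : 1 ≤ R) (B : ℝ)
    (hB : 0 ≤ B) :
    ∃ C : ℝ≥0, ∀ l s s' : ℝ, ∀ x x' ζ : Rd d, 1 ≤ l →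
      l ≤ 1 + |s| → l ≤ 1 + |s'| → |s - s'| ≤ 2 * l → ‖x - x'‖ ≤ B * l → ζ ∈ shell d R →
      ENNReal.ofReal ((wt a l s x ζ ^ (d + 2))⁻¹) ≤ C * tubeInt a (4 * R) l s' x' := by
  obtain ⟨C₁, hC₁, hw⟩ := ha.exists_wt_le R hR B hB
  obtain ⟨C₂, hC₂⟩ := exists_le_volume_tube d hd R hR
  let D : ℝ≥0 := Real.toNNReal (C₁ ^ (d + 2)) * C₂ * Real.toNNReal ((2 * R) ^ (d - 1))
  refine ⟨D, fun l s s' x x' ζ hl h1 h2 h3 h4 hζ => ?_⟩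
  have hl0 : 0 < l := by linarith
  set δ := √(l / (1 + |s'|)) with hδ
  have hδ0 : 0 < δ := by positivity
  obtain ⟨hTm, hT⟩ := hC₂ ζ hζ (δ / (2 * R)) (by positivity)
  set T := {ζ' : Rd d | ∃ ρ ∈ Icc (1 : ℝ) 2, ‖ζ' - ρ • ζ‖ ≤ δ / (2 * R)} with hTdef
  set W := wt a l s x ζ with hW
  have hW1 : 1 ≤ W := one_le_wt a hl0 s x ζ
  have hTsub : T ⊆ shell d (4 * R) := by
    rintro ζ' ⟨ρ, hρ, h⟩
    exact (hw l s s' x x' ζ ζ' ρ hρ hl h1 h2 h3 h4 hζ h).1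
  have hlow : ENNReal.ofReal (((C₁ * W) ^ (d + 2))⁻¹) * volume T ≤
      ∫⁻ ζ in shell d (4 * R), ENNReal.ofReal ((wt a l s' x' ζ ^ (d + 2))⁻¹) := by
    rw [← setLIntegral_const]
    refine le_trans (setLIntegral_mono' hTm ?_) (lintegral_mono_set hTsub)
    rintro ζ' ⟨ρ, hρ, h⟩
    have h5 := (hw l s s' x x' ζ ζ' ρ hρ hl h1 h2 h3 h4 hζ h).2
    have h6 := one_le_wt a hl0 s' x' ζ'
    gcongr
  have e : ENNReal.ofReal ((W ^ (d + 2))⁻¹) = ENNReal.ofReal (C₁ ^ (d + 2)) *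
      (ENNReal.ofReal ((2 * R) ^ (d - 1)) * (ENNReal.ofReal ((δ ^ (d - 1))⁻¹) *
        (ENNReal.ofReal (((C₁ * W) ^ (d + 2))⁻¹) * ENNReal.ofReal ((δ / (2 * R)) ^ (d - 1))))) := by
    rw [← ENNReal.ofReal_mul (by positivity), ← ENNReal.ofReal_mul (by positivity),
      ← ENNReal.ofReal_mul (by positivity), ← ENNReal.ofReal_mul (by positivity)]
    congr 1
    rw [div_pow, mul_pow C₁]
    field_simp
  rw [e]
  calc _ ≤ ENNReal.ofReal (C₁ ^ (d + 2)) *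
      (ENNReal.ofReal ((2 * R) ^ (d - 1)) * (ENNReal.ofReal ((δ ^ (d - 1))⁻¹) *
        (ENNReal.ofReal (((C₁ * W) ^ (d + 2))⁻¹) * (C₂ * volume T)))) := by gcongr
    _ = ENNReal.ofReal (C₁ ^ (d + 2)) *
      (ENNReal.ofReal ((2 * R) ^ (d - 1)) * (ENNReal.ofReal ((δ ^ (d - 1))⁻¹) *
        (C₂ * (ENNReal.ofReal (((C₁ * W) ^ (d + 2))⁻¹) * volume T)))) := by ring
    _ ≤ ENNReal.ofReal (C₁ ^ (d + 2)) *
      (ENNReal.ofReal ((2 * R) ^ (d - 1)) * (ENNReal.ofReal ((δ ^ (d - 1))⁻¹) *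
        (C₂ * ∫⁻ ζ in shell d (4 * R), ENNReal.ofReal ((wt a l s' x' ζ ^ (d + 2))⁻¹)))) := by gcongr
    _ = _ := by
      simp only [D, tubeInt, ENNReal.coe_mul, ← ENNReal.ofReal.eq_1, ← hδ]
      ring

theorem lintegral_inv_one_add_sq_comp_affine {κ : ℝ} (hκ : 0 < κ) (b : ℝ) :
    ∫⁻ ρ : ℝ, ENNReal.ofReal ((1 + (b + ρ * κ) ^ 2)⁻¹) = ENNReal.ofReal (π / κ) := by
  have h1 : ∫ ρ : ℝ, (1 + (b + ρ * κ) ^ 2)⁻¹ = π / κ := by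
    have := Measure.integral_comp_mul_right (fun y : ℝ => (1 + (b + y) ^ 2)⁻¹) κ
    rw [this, integral_add_left_eq_self (fun y : ℝ => (1 + y ^ 2)⁻¹) b, integral_univ_inv_one_add_sq,
      abs_of_pos (by positivity), smul_eq_mul]
    field_simp
  rw [← h1, ofReal_integral_eq_lintegral_ofReal]
  · have := (integrable_inv_one_add_sq.comp_add_left b).comp_mul_right' hκ.ne'
    exact this
  · exact Filter.Eventually.of_forall fun ρ => by positivity

theorem exists_lintegral_slab_le (d : ℕ) (hd : 1 ≤ d) (R : ℝ) (hR : 1 ≤ R) :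
    ∃ C : ℝ≥0, ∀ l S : ℝ, ∀ ζ ∈ shell d R, 0 < l → 0 < S →
      ∫⁻ Y : Rd d, ENNReal.ofReal (((1 + (|(inner ℝ Y ζ : ℝ)| + ‖Y‖ ^ 2 / S) / l) ^ (d + 2))⁻¹) ≤
        C * ENNReal.ofReal (l * √(l * S) ^ (d - 1)) := by
  obtain ⟨C₁, hC₁⟩ := exists_lintegral_bump_le d d (by omega)
  refine ⟨Real.toNNReal ((2 + 2 * R ^ 2) ^ d) * Real.toNNReal (π * R ^ 2) * C₁, ?_⟩
  intro l S ζ hζ hl hS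
  set σ := √(l * S) with hσ
  have hσ0 : 0 < σ := by positivity
  have hσ2 : σ ^ 2 = l * S := Real.sq_sqrt (by positivity)
  set F : Rd d → ℝ≥0∞ := fun Y =>
    ENNReal.ofReal (((1 + (|(inner ℝ Y ζ : ℝ)| + ‖Y‖ ^ 2 / S) / l) ^ (d + 2))⁻¹) with hF
  have hFm : Measurable F := by
    simp only [hF]
    fun_prop
  have hζ1 : R⁻¹ ≤ ‖ζ‖ := hζ.1
  have hζ2 : ‖ζ‖ ≤ R := hζ.2
  have hζ0 : 0 < ‖ζ‖ := lt_of_lt_of_le (by positivity) hζ1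
  let κ : ℝ := σ * ‖ζ‖ ^ 2 / l
  have hκ : 0 < κ := by positivity
  have hpt : ∀ ρ ∈ Icc (0 : ℝ) 1, ∀ Y, F (Y + (ρ * σ) • ζ) ≤
      ENNReal.ofReal ((2 + 2 * R ^ 2) ^ d) *
        (ENNReal.ofReal ((1 + ((inner ℝ Y ζ : ℝ) / l + ρ * κ) ^ 2)⁻¹) *
        ENNReal.ofReal (((1 + (σ⁻¹) ^ 2 * ‖Y - 0‖ ^ 2) ^ d)⁻¹)) := by
    intro ρ hρ Y
    simp only [hF]
    rw [← ENNReal.ofReal_mul (by positivity), ← ENNReal.ofReal_mul (by positivity)]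
    apply ENNReal.ofReal_le_ofReal
    set Z := Y + (ρ * σ) • ζ with hZ
    have e1 : (inner ℝ Y ζ : ℝ) / l + ρ * κ = (inner ℝ Z ζ : ℝ) / l := by
      simp only [hZ, inner_add_left, inner_smul_left, real_inner_self_eq_norm_sq, κ, conj_trivial]
      field_simp
    rw [e1, sub_zero]
    set b := |(inner ℝ Z ζ : ℝ)| / l with hb
    have hb0 : 0 ≤ b := by positivity
    have hb2 : ((inner ℝ Z ζ : ℝ) / l) ^ 2 = b ^ 2 := by
      rw [hb, div_pow, div_pow, sq_abs]
    rw [hb2]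
    set q := ‖Z‖ ^ 2 / σ ^ 2 with hq
    have hq0 : 0 ≤ q := by positivity
    have e2 : (|(inner ℝ Z ζ : ℝ)| + ‖Z‖ ^ 2 / S) / l = b + q := by
      rw [hb, hq, hσ2]
      field_simp
    rw [e2]
    have h3 : 1 + (σ⁻¹) ^ 2 * ‖Y‖ ^ 2 ≤ (2 + 2 * R ^ 2) * (1 + q) := by
      have h4 : ‖Y‖ ≤ ‖Z‖ + σ * R := by
        have : Y = Z - (ρ * σ) • ζ := by simp [hZ]
        rw [this]
        refine (norm_sub_le _ _).trans ?_
        rw [norm_smul, Real.norm_of_nonneg (mul_nonneg hρ.1 hσ0.le)]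
        gcongr
        nlinarith [hρ.2]
      have h5 : ‖Y‖ ^ 2 ≤ 2 * ‖Z‖ ^ 2 + 2 * (σ * R) ^ 2 := by
        have := pow_le_pow_left₀ (norm_nonneg _) h4 2
        nlinarith [sq_nonneg (‖Z‖ - σ * R)]
      have h6 : (σ⁻¹) ^ 2 * ‖Y‖ ^ 2 ≤ 2 * q + 2 * R ^ 2 := by
        calc (σ⁻¹) ^ 2 * ‖Y‖ ^ 2 ≤ (σ⁻¹) ^ 2 * (2 * ‖Z‖ ^ 2 + 2 * (σ * R) ^ 2) := by gcongr
          _ = _ := by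
            rw [hq]
            field_simp
      nlinarith [mul_nonneg (sq_nonneg R) hq0]
    have h7 : 1 + b ^ 2 ≤ (1 + (b + q)) ^ 2 := by nlinarith
    have h8 : (1 + b ^ 2) * (1 + (σ⁻¹) ^ 2 * ‖Y‖ ^ 2) ^ d ≤
        (2 + 2 * R ^ 2) ^ d * (1 + (b + q)) ^ (d + 2) := by
      calc _ ≤ (1 + (b + q)) ^ 2 * ((2 + 2 * R ^ 2) * (1 + (b + q))) ^ d := by
            gcongr
            exact h3.trans (by gcongr; linarith)
        _ = _ := by
            rw [mul_pow, pow_add]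
            ring
    rw [← mul_inv, ← div_eq_mul_inv, le_div_iff₀ (by positivity), inv_mul_le_iff₀ (by positivity)]
    linarith
  calc ∫⁻ Y, F Y = ∫⁻ ρ in Icc (0 : ℝ) 1, ∫⁻ Y, F Y := by
        rw [setLIntegral_const, Real.volume_Icc]
        simp
    _ = ∫⁻ ρ in Icc (0 : ℝ) 1, ∫⁻ Y, F (Y + (ρ * σ) • ζ) := by
        refine lintegral_congr fun ρ => ?_
        rw [lintegral_add_right_eq_self F]
    _ ≤ ∫⁻ ρ in Icc (0 : ℝ) 1, ∫⁻ Y, ENNReal.ofReal ((2 + 2 * R ^ 2) ^ d) *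
        (ENNReal.ofReal ((1 + ((inner ℝ Y ζ : ℝ) / l + ρ * κ) ^ 2)⁻¹) *
        ENNReal.ofReal (((1 + (σ⁻¹) ^ 2 * ‖Y - 0‖ ^ 2) ^ d)⁻¹)) :=
        setLIntegral_mono' measurableSet_Icc fun ρ hρ => lintegral_mono (hpt ρ hρ)
    _ ≤ ∫⁻ ρ : ℝ, ∫⁻ Y, ENNReal.ofReal ((2 + 2 * R ^ 2) ^ d) *
        (ENNReal.ofReal ((1 + ((inner ℝ Y ζ : ℝ) / l + ρ * κ) ^ 2)⁻¹) *
        ENNReal.ofReal (((1 + (σ⁻¹) ^ 2 * ‖Y - 0‖ ^ 2) ^ d)⁻¹)) := setLIntegral_le_lintegral _ _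
    _ = ∫⁻ Y : Rd d, ∫⁻ ρ : ℝ, ENNReal.ofReal ((2 + 2 * R ^ 2) ^ d) *
        (ENNReal.ofReal ((1 + ((inner ℝ Y ζ : ℝ) / l + ρ * κ) ^ 2)⁻¹) *
        ENNReal.ofReal (((1 + (σ⁻¹) ^ 2 * ‖Y - 0‖ ^ 2) ^ d)⁻¹)) := by
        rw [lintegral_lintegral_swap]
        refine Measurable.aemeasurable ?_
        simp only [Function.uncurry_def]
        fun_prop
    _ = ∫⁻ Y : Rd d, ENNReal.ofReal ((2 + 2 * R ^ 2) ^ d) * (ENNReal.ofReal (π / κ) *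
        ENNReal.ofReal (((1 + (σ⁻¹) ^ 2 * ‖Y - 0‖ ^ 2) ^ d)⁻¹)) := by
        refine lintegral_congr fun Y => ?_
        rw [lintegral_const_mul' _ _ ENNReal.ofReal_ne_top,
          lintegral_mul_const' _ _ ENNReal.ofReal_ne_top, lintegral_inv_one_add_sq_comp_affine hκ]
    _ ≤ ENNReal.ofReal ((2 + 2 * R ^ 2) ^ d) * (ENNReal.ofReal (π / κ) *
        (C₁ * ENNReal.ofReal ((σ⁻¹ ^ d)⁻¹))) := by
        rw [lintegral_const_mul' _ _ ENNReal.ofReal_ne_top,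
          lintegral_const_mul' _ _ ENNReal.ofReal_ne_top]
        gcongr
        exact hC₁ σ⁻¹ 0 (by positivity)
    _ ≤ ENNReal.ofReal ((2 + 2 * R ^ 2) ^ d) *
        (C₁ * ENNReal.ofReal (π * R ^ 2 * (l * σ ^ (d - 1)))) := by
        rw [mul_left_comm (ENNReal.ofReal (π / κ)), ← ENNReal.ofReal_mul (by positivity)]
        gcongr ENNReal.ofReal _ * (_ * ENNReal.ofReal ?_)
        obtain ⟨m, rfl⟩ : ∃ m, d = m + 1 := ⟨d - 1, by omega⟩
        have : π / κ * (σ⁻¹ ^ (m + 1))⁻¹ = π * (‖ζ‖⁻¹) ^ 2 * (l * σ ^ m) := by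
          simp only [κ]
          rw [inv_pow, inv_inv, pow_succ]
          field_simp
          rw [pow_succ']
        rw [this, Nat.add_sub_cancel]
        have : ‖ζ‖⁻¹ ≤ R := inv_le_of_inv_le₀ (by linarith) hζ1
        gcongr
    _ = _ := by
        rw [ENNReal.ofReal_mul (by positivity)]
        simp only [ENNReal.coe_mul, ← ENNReal.ofReal.eq_1]
        ring

theorem IsDistFn.exists_lintegral_tubeInt_le (ha : IsDistFn a) (hd : 1 ≤ d) (R : ℝ) (hR : 1 ≤ R) :
    ∃ C : ℝ≥0, ∀ l s : ℝ, 0 < l →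
      ∫⁻ x, tubeInt a R l s x ≤ C * ENNReal.ofReal (l * (1 + |s|) ^ (d - 1)) := by
  obtain ⟨C₁, hC₁⟩ := exists_lintegral_slab_le d hd R hR
  have hV : volume (shell d R) ≠ ∞ := (isCompact_shell d R).measure_lt_top.ne
  refine ⟨C₁ * (volume (shell d R)).toNNReal, fun l s hl => ?_⟩
  have hS : 0 < 1 + |s| := by positivity
  have hz : ∀ ζ ∈ shell d R, ∫⁻ x, ENNReal.ofReal ((wt a l s x ζ ^ (d + 2))⁻¹) ≤
      C₁ * ENNReal.ofReal (l * √(l * (1 + |s|)) ^ (d - 1)) := by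
    intro ζ hζ
    have hζ0 := ne_zero_of_mem_shell (by linarith) hζ
    let F : Rd d → ℝ≥0∞ := fun Y =>
      ENNReal.ofReal (((1 + (|(inner ℝ Y ζ : ℝ)| + ‖Y‖ ^ 2 / (1 + |s|)) / l) ^ (d + 2))⁻¹)
    have h1 : ∀ x, ENNReal.ofReal ((wt a l s x ζ ^ (d + 2))⁻¹) =
        F ((2 * π) • (x + (2 * π)⁻¹ • (s • gradient a ζ))) := by
      intro x
      have : (2 * π) • (x + (2 * π)⁻¹ • (s • gradient a ζ)) = phaseGrad a s x ζ := by
        rw [smul_add, smul_smul, mul_inv_cancel₀ (by positivity), one_smul, phaseGrad, add_comm]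
      rw [this]
      simp only [F, wt, ha.inner_phaseGrad_self s x hζ0]
    simp_rw [h1]
    rw [lintegral_add_right_eq_self (fun x => F ((2 * π) • x)),
      lintegral_comp_smul_eq F (by positivity)]
    calc _ ≤ 1 * ∫⁻ Y, F Y := by
          gcongr
          rw [ENNReal.ofReal_le_one]
          apply inv_le_one_of_one_le₀
          apply one_le_pow₀
          linarith [pi_gt_three]
      _ ≤ _ := by
          rw [one_mul]
          exact hC₁ l (1 + |s|) ζ hζ hl hS
  simp only [tubeInt]
  rw [lintegral_const_mul' _ _ ENNReal.ofReal_ne_top, lintegral_lintegral_swap]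
  · calc _ ≤ ENNReal.ofReal ((√(l / (1 + |s|)) ^ (d - 1))⁻¹) * ∫⁻ ζ in shell d R,
          C₁ * ENNReal.ofReal (l * √(l * (1 + |s|)) ^ (d - 1)) := by
          refine mul_le_mul' le_rfl ?_
          exact setLIntegral_mono' (measurableSet_shell d R) hz
      _ = (C₁ * volume (shell d R)) * (ENNReal.ofReal ((√(l / (1 + |s|)) ^ (d - 1))⁻¹) *
          ENNReal.ofReal (l * √(l * (1 + |s|)) ^ (d - 1))) := by
          rw [setLIntegral_const]
          ring
      _ = _ := by
          rw [← ENNReal.ofReal_mul (by positivity), ENNReal.coe_mul, ENNReal.coe_toNNReal hV]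
          congr 2
          rw [mul_left_comm, ← inv_pow, ← mul_pow]
          congr 2
          rw [Real.sqrt_div hl.le, Real.sqrt_mul hl.le, inv_div]
          have := Real.sq_sqrt hS.le
          have hl' : √l ≠ 0 := by positivity
          field_simp
          exact this
  · exact (((ha.measurable_wt l s).pow_const _).inv.ennreal_ofReal).aemeasurable

end Majorant

section OscillatoryKernel

variable {d : ℕ} {a : Rd d → ℝ}

/-- The oscillatory integral with amplitude `g` and phase `s a(ξ) + 2π⟨x, ξ⟩`. -/
def oscKer (g : Rd d → ℂ) (a : Rd d → ℝ) (s : ℝ) (x : Rd d) : ℂ :=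
  ∫ ξ, g ξ * Complex.exp (Complex.I * (phase a s x ξ : ℝ))

theorem one_le_wt_of_abs (a : Rd d → ℝ) (s : ℝ) (x ζ : Rd d) :
    1 + ‖phaseGrad a s x ζ‖ ^ 2 / (1 + |s|) ≤ wt a 1 s x ζ := by
  unfold wt
  rw [div_one]
  linarith [abs_nonneg (phase a s x ζ)]

theorem wt_one_eq (a : Rd d → ℝ) {l : ℝ} (hl : 0 < l) (s : ℝ) (x ζ : Rd d) :
    wt a 1 s x ζ = 1 + l * (wt a l s x ζ - 1) := by
  unfold wt
  field_simp
  ring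

theorem IsDistFn.exists_enorm_oscKer_le (ha : IsDistFn a) (hc : CurvNondeg a) (hd : 1 ≤ d)
    {g : Rd d → ℂ} (hg : ContDiff ℝ (⊤ : ℕ∞) g) {r : ℝ} (hr : 1 ≤ r)
    (hsupp : ∀ ξ ∉ shell d r, g ξ = 0) (B : ℝ) (hB : 0 ≤ B) :
    ∃ C : ℝ≥0, ∀ l s s' : ℝ, ∀ x x' : Rd d, 1 ≤ l →
      l ≤ 1 + |s| → l ≤ 1 + |s'| → |s - s'| ≤ 2 * l → ‖x - x'‖ ≤ B * l →
      ‖oscKer g a s x‖ₑ ≤ C * ENNReal.ofReal ((√(1 + |s|) ^ (d - 1))⁻¹) *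
        tubeInt a (4 * (4 * r)) l s' x' := by
  obtain ⟨C₁, h₁⟩ := ha.exists_kernel_bound hg hr hsupp (d + 2 + d)
  obtain ⟨C₂, h₂⟩ := ha.exists_le_tubeInt hd (4 * r) (by linarith) B hB
  obtain ⟨C₃, h₃⟩ := ha.exists_dispersive_bound hc hd (4 * r) (by linarith) d (by omega)
  refine ⟨C₁ * C₂ * C₃, fun l s s' x x' hl hls hls' hss hxx => ?_⟩
  have hl0 : 0 < l := by linarith
  refine (h₁ s x).trans ?_
  have hpt : ∀ ζ ∈ shell d (4 * r), ENNReal.ofReal ((wt a 1 s x ζ ^ (d + 2 + d))⁻¹) ≤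
      C₂ * tubeInt a (4 * (4 * r)) l s' x' *
        ENNReal.ofReal (((1 + ‖phaseGrad a s x ζ‖ ^ 2 / (1 + |s|)) ^ d)⁻¹) := by
    intro ζ hζ
    refine le_trans ?_ (mul_le_mul' (h₂ l s s' x x' ζ hl hls hls' hss hxx hζ) le_rfl)
    have e1 := one_le_wt a hl0 s x ζ
    have e2 := one_le_wt_of_abs a s x ζ
    have e3 : wt a l s x ζ ≤ wt a 1 s x ζ := by
      rw [wt_one_eq a hl0]
      nlinarith
    have e4 : 0 ≤ ‖phaseGrad a s x ζ‖ ^ 2 / (1 + |s|) := by positivity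
    have e5 := one_le_wt a one_pos s x ζ
    rw [← ENNReal.ofReal_mul (by positivity)]
    apply ENNReal.ofReal_le_ofReal
    rw [pow_add _ (d + 2) d, mul_inv]
    gcongr
  calc _ ≤ C₁ * ∫⁻ ζ in shell d (4 * r), C₂ * tubeInt a (4 * (4 * r)) l s' x' *
        ENNReal.ofReal (((1 + ‖phaseGrad a s x ζ‖ ^ 2 / (1 + |s|)) ^ d)⁻¹) := by
        gcongr C₁ * ?_
        exact setLIntegral_mono' (measurableSet_shell d _) hpt
    _ = C₁ * (C₂ * tubeInt a (4 * (4 * r)) l s' x' * ∫⁻ ζ in shell d (4 * r),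
        ENNReal.ofReal (((1 + ‖phaseGrad a s x ζ‖ ^ 2 / (1 + |s|)) ^ d)⁻¹)) := by
        rw [lintegral_const_mul]
        have := measurable_gradient a
        unfold phaseGrad
        fun_prop
    _ ≤ C₁ * (C₂ * tubeInt a (4 * (4 * r)) l s' x' *
        (C₃ * ENNReal.ofReal ((√(1 + |s|) ^ (d - 1))⁻¹))) := by
        gcongr
        exact h₃ s x
    _ = _ := by
        push_cast
        ring

theorem IsDistFn.exists_lintegral_wt_le (ha : IsDistFn a) (hd : 1 ≤ d) (R : ℝ) (hR : 1 ≤ R) :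
    ∃ C : ℝ≥0, ∀ s : ℝ, ∫⁻ x, ∫⁻ ζ in shell d R, ENNReal.ofReal ((wt a 1 s x ζ ^ (d + 2))⁻¹) ≤
      C * ENNReal.ofReal (√(1 + |s|) ^ (d - 1)) := by
  obtain ⟨C, hC⟩ := ha.exists_lintegral_tubeInt_le hd R hR
  refine ⟨C, fun s => ?_⟩
  have hS : 0 < 1 + |s| := by positivity
  have h := hC 1 s one_pos
  simp only [tubeInt] at h
  rw [lintegral_const_mul' _ _ ENNReal.ofReal_ne_top] at h
  refine (ENNReal.le_ofReal_inv_mul (by positivity) h).trans (le_of_eq ?_)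
  rw [mul_left_comm, ← ENNReal.ofReal_mul (by positivity), inv_inv, one_mul, ← mul_pow,
    Real.sqrt_div zero_le_one, Real.sqrt_one]
  congr 3
  rw [one_div, inv_mul_eq_div, Real.div_sqrt]

theorem IsDistFn.exists_lintegral_oscKer_le (ha : IsDistFn a) (hd : 1 ≤ d)
    {g : Rd d → ℂ} (hg : ContDiff ℝ (⊤ : ℕ∞) g) {r : ℝ} (hr : 1 ≤ r)
    (hsupp : ∀ ξ ∉ shell d r, g ξ = 0) :
    ∃ C : ℝ≥0, ∀ s : ℝ, ∫⁻ x, ‖oscKer g a s x‖ₑ ≤ C * ENNReal.ofReal (√(1 + |s|) ^ (d - 1)) := by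
  obtain ⟨C₁, h₁⟩ := ha.exists_kernel_bound hg hr hsupp (d + 2)
  obtain ⟨C₂, h₂⟩ := ha.exists_lintegral_wt_le hd (4 * r) (by linarith)
  refine ⟨C₁ * C₂, fun s => (lintegral_mono (h₁ s)).trans ?_⟩
  rw [lintegral_const_mul' _ _ ENNReal.coe_ne_top, ENNReal.coe_mul, mul_assoc]
  gcongr
  exact h₂ s

theorem IsDistFn.exists_oscKer_tail (ha : IsDistFn a) (hd : 1 ≤ d)
    {g : Rd d → ℂ} (hg : ContDiff ℝ (⊤ : ℕ∞) g) {r : ℝ} (hr : 1 ≤ r)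
    (hsupp : ∀ ξ ∉ shell d r, g ξ = 0) (B : ℝ) (hB : 0 ≤ B) :
    ∃ C : ℝ≥0, ∀ l s' : ℝ, 1 ≤ l → l ≤ 1 + |s'| → ∃ Ω : Set (Rd d), MeasurableSet Ω ∧
      volume Ω ≤ C * ENNReal.ofReal (l * (1 + |s'|) ^ (d - 1)) ∧
      ∀ (s : ℝ) (v : Rd d), l ≤ 1 + |s| → |s - s'| ≤ 2 * l → ‖v‖ ≤ B * l →
        ∫⁻ x in {x | x + v ∉ Ω}, ‖oscKer g a s x‖ₑ ≤
          C * ENNReal.ofReal ((l ^ d)⁻¹ * √(1 + |s|) ^ (d - 1)) := by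
  obtain ⟨C₁, h₁⟩ := ha.exists_kernel_bound hg hr hsupp (d + (d + 2))
  obtain ⟨D, hD⟩ := ha.exists_le_tubeInt hd (4 * r) (by linarith) B hB
  obtain ⟨C₂, h₂⟩ := ha.exists_lintegral_wt_le hd (4 * r) (by linarith)
  obtain ⟨C₃, h₃⟩ := ha.exists_lintegral_tubeInt_le hd (4 * (4 * r)) (by linarith)
  let c : ℝ := (2 ^ (d + 2))⁻¹
  have hc : 0 < c := by positivity
  refine ⟨C₁ * C₂ + Real.toNNReal c⁻¹ * D * C₃, fun l s' hl hls' => ?_⟩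
  have hl0 : 0 < l := by linarith
  let Ω : Set (Rd d) := {x | ENNReal.ofReal c ≤ D * tubeInt a (4 * (4 * r)) l s' x}
  have hmeas : Measurable fun x => D * tubeInt a (4 * (4 * r)) l s' x :=
    (ha.measurable_tubeInt _ l s').const_mul _
  have hΩ : MeasurableSet Ω := measurableSet_le measurable_const hmeas
  refine ⟨Ω, hΩ, ?_, fun s v hls hss hv => ?_⟩
  · have := mul_meas_ge_le_lintegral (μ := volume) hmeas (ENNReal.ofReal c)
    refine (ENNReal.le_ofReal_inv_mul hc this).trans ?_
    rw [lintegral_const_mul' _ _ ENNReal.coe_ne_top]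
    calc _ ≤ ENNReal.ofReal c⁻¹ * (D * (C₃ * ENNReal.ofReal (l * (1 + |s'|) ^ (d - 1)))) := by
          gcongr
          exact h₃ l s' hl0
      _ = (Real.toNNReal c⁻¹ * D * C₃ : ℝ≥0) * ENNReal.ofReal (l * (1 + |s'|) ^ (d - 1)) := by
          rw [ENNReal.ofReal.eq_1 c⁻¹]
          push_cast
          ring
      _ ≤ _ := by
          gcongr
          exact le_add_self
  · have hpt : ∀ x ∈ {x | x + v ∉ Ω}, ‖oscKer g a s x‖ₑ ≤ C₁ * (ENNReal.ofReal ((l ^ d)⁻¹) *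
        ∫⁻ ζ in shell d (4 * r), ENNReal.ofReal ((wt a 1 s x ζ ^ (d + 2))⁻¹)) := by
      intro x hx
      refine (h₁ s x).trans ?_
      rw [← lintegral_const_mul' _ _ ENNReal.ofReal_ne_top]
      gcongr C₁ * ?_
      refine setLIntegral_mono' (measurableSet_shell d _) fun ζ hζ => ?_
      have e1 := hD l s s' x (x + v) ζ hl hls hls' hss (by simpa using hv) hζ
      have e2 : D * tubeInt a (4 * (4 * r)) l s' (x + v) < ENNReal.ofReal c := not_le.1 hx
      have e3 := (ENNReal.ofReal_lt_ofReal_iff hc).1 (e1.trans_lt e2)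
      have e4 := one_le_wt a hl0 s x ζ
      have e5 : 2 ≤ wt a l s x ζ := by
        rw [inv_lt_inv₀ (by positivity) (by positivity)] at e3
        exact (lt_of_pow_lt_pow_left₀ _ (by linarith) e3).le
      have e6 : l ≤ wt a 1 s x ζ := by
        rw [wt_one_eq a hl0]
        nlinarith
      rw [← ENNReal.ofReal_mul (by positivity)]
      apply ENNReal.ofReal_le_ofReal
      have e7 := one_le_wt a one_pos s x ζ
      rw [pow_add, mul_inv]
      gcongr
    have hset : MeasurableSet {x | x + v ∉ Ω} := (hΩ.compl.preimage (measurable_add_const v))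
    calc _ ≤ ∫⁻ x in {x | x + v ∉ Ω}, C₁ * (ENNReal.ofReal ((l ^ d)⁻¹) *
          ∫⁻ ζ in shell d (4 * r), ENNReal.ofReal ((wt a 1 s x ζ ^ (d + 2))⁻¹)) :=
          setLIntegral_mono' hset hpt
      _ ≤ ∫⁻ x, C₁ * (ENNReal.ofReal ((l ^ d)⁻¹) *
          ∫⁻ ζ in shell d (4 * r), ENNReal.ofReal ((wt a 1 s x ζ ^ (d + 2))⁻¹)) :=
          setLIntegral_le_lintegral _ _
      _ ≤ C₁ * (ENNReal.ofReal ((l ^ d)⁻¹) * (C₂ * ENNReal.ofReal (√(1 + |s|) ^ (d - 1)))) := by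
          rw [lintegral_const_mul' _ _ ENNReal.coe_ne_top,
            lintegral_const_mul' _ _ ENNReal.ofReal_ne_top]
          gcongr
          exact h₂ s
      _ = (C₁ * C₂ : ℝ≥0) * ENNReal.ofReal ((l ^ d)⁻¹ * √(1 + |s|) ^ (d - 1)) := by
          rw [ENNReal.ofReal_mul (by positivity)]
          push_cast
          ring
      _ ≤ _ := by
          gcongr
          exact le_self_add

end OscillatoryKernel

section Correlation

variable {d : ℕ} {a : Rd d → ℝ} {η : ℝ → ℝ}

theorem Kker_eq_oscKer (a : Rd d → ℝ) (η : ℝ → ℝ) (s : ℝ) :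
    Kker a η s = oscKer (fun ξ => (η (a ξ) : ℂ)) a s := by
  ext x
  unfold Kker oscKer
  congr 1
  ext ξ
  rw [mul_assoc, ← Complex.exp_add]
  congr 2
  simp only [phase]
  push_cast
  ring

theorem IsBump.eq_zero_of_notMem (hη : IsBump η) {r : ℝ}
    (hr : ∀ ξ : Rd d, a ξ ∈ Icc (1/8 : ℝ) 8 → ξ ∈ shell d r) {ξ : Rd d} (hξ : ξ ∉ shell d r) :
    η (a ξ) = 0 :=
  hη.supp _ fun h => hξ (hr ξ h)

theorem hasCompactSupport_of_shell {E : Type*} [Zero E] {g : Rd d → E} {r : ℝ}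
    (h : ∀ ξ ∉ shell d r, g ξ = 0) : HasCompactSupport g :=
  HasCompactSupport.intro (isCompact_shell d r) h

theorem IsDistFn.contDiff_amplitude (ha : IsDistFn a) (hη : IsBump η) (s : ℝ) (x : Rd d) :
    ContDiff ℝ (⊤ : ℕ∞) fun ξ => (η (a ξ) : ℂ) * Complex.exp (Complex.I * (phase a s x ξ : ℝ)) := by
  have h1 : ContDiff ℝ (⊤ : ℕ∞) fun ξ : Rd d => η (a ξ) * Real.cos (s * a ξ) :=
    ha.contDiff_bump_comp (η := fun t => η t * Real.cos (s * t))
      (hη.smooth.mul (by fun_prop)) fun x hx => by simp [hη.supp x hx]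
  have h2 : ContDiff ℝ (⊤ : ℕ∞) fun ξ : Rd d => η (a ξ) * Real.sin (s * a ξ) :=
    ha.contDiff_bump_comp (η := fun t => η t * Real.sin (s * t))
      (hη.smooth.mul (by fun_prop)) fun x hx => by simp [hη.supp x hx]
  have h3 : ContDiff ℝ (⊤ : ℕ∞) fun ξ : Rd d =>
      Complex.exp (((2 * π * inner ℝ x ξ : ℝ) : ℂ) * Complex.I) :=
    ((Complex.ofRealCLM.contDiff.comp (contDiff_const.mul (contDiff_const.inner ℝ contDiff_id) :
      ContDiff ℝ (⊤ : ℕ∞) fun ξ : Rd d => (2 * π * inner ℝ x ξ : ℝ))).mul contDiff_const).cexp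
  have h4 := (((Complex.ofRealCLM.contDiff.comp h1).add
    ((Complex.ofRealCLM.contDiff.comp h2).mul (contDiff_const (c := Complex.I)))).mul h3)
  refine Eq.subst (motive := fun f => ContDiff ℝ (⊤ : ℕ∞) f) (funext fun ξ => ?_) h4
  symm
  simp only [Function.comp_apply, Complex.ofRealCLM_apply, phase, Complex.ofReal_mul,
    Complex.ofReal_add, Complex.ofReal_cos, Complex.ofReal_sin]
  rw [mul_add, Complex.exp_add, ← mul_assoc]
  congr 1
  · rw [mul_comm Complex.I, Complex.exp_mul_I]
    ring
  · rw [mul_comm Complex.I]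

theorem IsDistFn.exists_schwartz (ha : IsDistFn a) (hη : IsBump η) (s : ℝ) (x₀ : Rd d) :
    ∃ φ : SchwartzMap (Rd d) ℂ,
      (∀ ξ, φ ξ = (η (a ξ) : ℂ) * Complex.exp (Complex.I * (phase a s x₀ ξ : ℝ))) ∧
      ∀ x, 𝓕 φ (-x) = Kker a η s (x + x₀) := by
  obtain ⟨r, hr1, hr⟩ := ha.exists_shell_support
  have hcs : HasCompactSupport fun ξ => (η (a ξ) : ℂ) *
      Complex.exp (Complex.I * (phase a s x₀ ξ : ℝ)) :=
    hasCompactSupport_of_shell (r := r) fun ξ hξ => by simp [hη.eq_zero_of_notMem hr hξ]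
  refine ⟨hcs.toSchwartzMap (ha.contDiff_amplitude hη s x₀), fun ξ => rfl, fun x => ?_⟩
  rw [Kker_eq_oscKer, oscKer, SchwartzMap.fourier_coe, Real.fourier_eq']
  congr 1
  ext ξ
  change Complex.exp _ * ((η (a ξ) : ℂ) * Complex.exp (Complex.I * (phase a s x₀ ξ : ℝ))) = _
  simp only [inner_neg_right]
  rw [mul_left_comm, ← Complex.exp_add, real_inner_comm]
  congr 2
  simp only [phase, inner_add_left]
  push_cast
  ring

theorem IsDistFn.integral_conj_Kker_mul_Kker (ha : IsDistFn a) (hη : IsBump η) (s s' : ℝ)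
    (y y' : Rd d) :
    ∫ x, starRingEnd ℂ (Kker a η s (x - y)) * Kker a η s' (x - y') =
      oscKer (fun ξ => ((η (a ξ) ^ 2 : ℝ) : ℂ)) a (s' - s) (y - y') := by
  obtain ⟨φ, hφ, hφ'⟩ := ha.exists_schwartz hη s (-y)
  obtain ⟨ψ, hψ, hψ'⟩ := ha.exists_schwartz hη s' (-y')
  have h := SchwartzMap.integral_inner_fourier_fourier φ ψ
  rw [← integral_neg_eq_self] at h
  simp only [sub_eq_add_neg, ← hφ', ← hψ']
  simp only [RCLike.inner_apply, hφ, hψ] at h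
  calc _ = _ := by
        congr 1
        ext x
        rw [mul_comm]
    _ = _ := h
    _ = _ := by
        unfold oscKer
        congr 1
        ext ξ
        rw [map_mul, Complex.conj_ofReal, ← Complex.exp_conj, map_mul, Complex.conj_I,
          Complex.conj_ofReal]
        have : ∀ p q r t : ℂ, p * q * (r * t) = p * r * (q * t) := fun p q r t => by ring
        rw [this, ← Complex.exp_add]
        congr 1
        · push_cast
          ring
        · congr 1
          simp only [phase, inner_add_left, inner_neg_left]
          push_cast
          ring

theorem IsDistFn.exists_schwartz_Kker (ha : IsDistFn a) (hη : IsBump η) (s : ℝ) :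
    ∃ φ : SchwartzMap (Rd d) ℂ, ∀ x, Kker a η s x = φ (-x) := by
  obtain ⟨φ, -, hφ⟩ := ha.exists_schwartz hη s 0
  exact ⟨𝓕 φ, fun x => by rw [hφ, add_zero]⟩

theorem IsDistFn.continuous_Kker (ha : IsDistFn a) (hη : IsBump η) (s : ℝ) :
    Continuous (Kker a η s) := by
  obtain ⟨φ, hφ⟩ := ha.exists_schwartz_Kker hη s
  rw [funext hφ]
  exact φ.continuous.comp continuous_neg

theorem IsDistFn.integrable_Kker (ha : IsDistFn a) (hη : IsBump η) (s : ℝ) :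
    Integrable (Kker a η s) := by
  obtain ⟨φ, hφ⟩ := ha.exists_schwartz_Kker hη s
  rw [funext hφ]
  exact φ.integrable.comp_neg

theorem IsDistFn.exists_norm_Kker_le (ha : IsDistFn a) (hη : IsBump η) (s : ℝ) :
    ∃ C : ℝ, ∀ x, ‖Kker a η s x‖ ≤ C := by
  obtain ⟨φ, hφ⟩ := ha.exists_schwartz_Kker hη s
  obtain ⟨C, hC⟩ := φ.decay 0 0
  refine ⟨C, fun x => ?_⟩
  have := hC.2 (-x)
  simpa [hφ] using this

theorem IsDistFn.integrable_conv (ha : IsDistFn a) (hη : IsBump η) (s : ℝ) {b : Rd d → ℂ}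
    (hb : Integrable b) : Integrable (conv (Kker a η s) b) := by
  have := hb.integrable_convolution (ContinuousLinearMap.mul ℝ ℂ) (ha.integrable_Kker hη s)
  convert this using 1
  ext x
  simp only [conv, convolution, ContinuousLinearMap.mul_apply', mul_comm]

theorem norm_conv_le {K b : Rd d → ℂ} (hb : Integrable b) {C : ℝ} (hC : ∀ x, ‖K x‖ ≤ C)
    (x : Rd d) : ‖conv K b x‖ ≤ C * ∫ y, ‖b y‖ := by
  unfold conv
  rw [← integral_const_mul]
  refine norm_integral_le_of_norm_le (hb.norm.const_mul C) (Filter.Eventually.of_forall fun y => ?_)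
  rw [norm_mul]
  gcongr
  exact hC _

theorem IsDistFn.memLp_conv (ha : IsDistFn a) (hη : IsBump η) (s : ℝ) {b : Rd d → ℂ}
    (hb : Integrable b) : MemLp (conv (Kker a η s) b) 2 := by
  have hi := ha.integrable_conv hη s hb
  obtain ⟨C, hC⟩ := ha.exists_norm_Kker_le hη s
  rw [memLp_two_iff_integrable_sq_norm hi.1]
  refine (hi.norm.const_mul (C * ∫ y, ‖b y‖)).mono' (hi.1.norm.pow 2)
    (Filter.Eventually.of_forall fun x => ?_)
  rw [Real.norm_of_nonneg (by positivity), sq]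
  gcongr
  exact norm_conv_le hb hC x

theorem IsDistFn.enorm_integral_conj_conv_mul_conv_le (ha : IsDistFn a) (hη : IsBump η) (s s' : ℝ)
    {b b' : Rd d → ℂ} (hbm : Measurable b) (hbm' : Measurable b') (hb : Integrable b)
    (hb' : Integrable b') :
    ‖∫ x, starRingEnd ℂ (conv (Kker a η s) b x) * conv (Kker a η s') b' x‖ₑ ≤
      ∫⁻ p : Rd d × Rd d, ‖b p.1‖ₑ * ‖b' p.2‖ₑ *
        ‖oscKer (fun ξ => ((η (a ξ) ^ 2 : ℝ) : ℂ)) a (s' - s) (p.1 - p.2)‖ₑ := by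
  let F : Rd d → Rd d × Rd d → ℂ := fun x p =>
    starRingEnd ℂ (Kker a η s (x - p.1) * b p.1) * (Kker a η s' (x - p.2) * b' p.2)
  have hK := (ha.continuous_Kker hη s).measurable
  have hK' := (ha.continuous_Kker hη s').measurable
  have hFm : Measurable (Function.uncurry F) := by
    simp only [F, Function.uncurry_def]
    have h1 : Measurable fun p : Rd d × (Rd d × Rd d) => Kker a η s (p.1 - p.2.1) * b p.2.1 := by
      fun_prop
    have h2 : Measurable fun p : Rd d × (Rd d × Rd d) => Kker a η s' (p.1 - p.2.2) * b' p.2.2 := by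
      fun_prop
    exact (Complex.continuous_conj.measurable.comp h1).mul h2
  obtain ⟨C, hC⟩ := ha.exists_norm_Kker_le hη s
  have hF : Integrable (Function.uncurry F) (volume.prod (volume.prod volume)) := by
    refine ⟨hFm.aestronglyMeasurable, ?_⟩
    rw [HasFiniteIntegral, lintegral_prod_symm _ hFm.enorm.aemeasurable]
    calc _ ≤ ∫⁻ p : Rd d × Rd d, ∫⁻ x, (ENNReal.ofReal C * (‖b p.1‖ₑ * ‖b' p.2‖ₑ)) *
          ‖Kker a η s' (x - p.2)‖ₑ := by
          refine lintegral_mono fun p => lintegral_mono fun x => ?_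
          simp only [Function.uncurry, F, map_mul, enorm_mul, RCLike.enorm_conj]
          have : ‖Kker a η s (x - p.1)‖ₑ ≤ ENNReal.ofReal C := by
            rw [← ofReal_norm]
            exact ENNReal.ofReal_le_ofReal (hC _)
          calc _ ≤ (ENNReal.ofReal C * ‖b p.1‖ₑ) * (‖Kker a η s' (x - p.2)‖ₑ * ‖b' p.2‖ₑ) := by
                gcongr
            _ = _ := by ring
      _ = ∫⁻ p : Rd d × Rd d, (ENNReal.ofReal C * (‖b p.1‖ₑ * ‖b' p.2‖ₑ)) *
          ∫⁻ x, ‖Kker a η s' x‖ₑ := by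
          refine lintegral_congr fun p => ?_
          rw [lintegral_const_mul' _ _ (by finiteness),
            lintegral_sub_right_eq_self (fun x => ‖Kker a η s' x‖ₑ)]
      _ = (∫⁻ p : Rd d × Rd d, (‖b p.1‖ₑ * ‖b' p.2‖ₑ)) *
          (ENNReal.ofReal C * ∫⁻ x, ‖Kker a η s' x‖ₑ) := by
          rw [← lintegral_mul_const _ (by fun_prop)]
          refine lintegral_congr fun p => ?_
          ring
      _ < ∞ := by
          have h1 : ∫⁻ p : Rd d × Rd d, (‖b p.1‖ₑ * ‖b' p.2‖ₑ) < ∞ := by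
            have := lintegral_prod_mul (μ := (volume : Measure (Rd d)))
              (ν := (volume : Measure (Rd d))) hbm.enorm.aemeasurable hbm'.enorm.aemeasurable
            rw [Measure.volume_eq_prod, this]
            exact ENNReal.mul_lt_top hb.2 hb'.2
          exact ENNReal.mul_lt_top h1 (ENNReal.mul_lt_top ENNReal.ofReal_lt_top
            (ha.integrable_Kker hη s').2)
  have h1 : ∀ x, starRingEnd ℂ (conv (Kker a η s) b x) * conv (Kker a η s') b' x =
      ∫ p, F x p ∂(volume.prod volume) := by
    intro x
    unfold conv
    rw [← integral_conj, ← integral_prod_mul]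
  simp_rw [h1]
  rw [integral_integral_swap hF, Measure.volume_eq_prod]
  refine (enorm_integral_le_lintegral_enorm _).trans (lintegral_mono fun p => le_of_eq ?_)
  rw [← ha.integral_conj_Kker_mul_Kker hη, ← RCLike.enorm_conj (b p.1), ← enorm_mul, ← enorm_mul,
    ← integral_const_mul]
  congr 2
  ext x
  simp only [F, map_mul]
  ring

end Correlation

theorem norm_sum_sq_le_card_mul {H ι : Type*} [NormedAddCommGroup H] (I : Finset ι) (V : ι → H) :
    ‖∑ i ∈ I, V i‖ ^ 2 ≤ I.card * ∑ i ∈ I, ‖V i‖ ^ 2 :=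
  (pow_le_pow_left₀ (norm_nonneg _) (norm_sum_le _ _) 2).trans sq_sum_le_card_mul_sum_sq

theorem sum_filter_div_eq {ι M : Type*} [AddCommMonoid M] (E : Finset ι) (n : ι → ℕ) {R : ℕ}
    (hR : 1 ≤ R) (i : ℕ) (g : ι → M) : ∑ e ∈ E with n e / R = i, g e =
      ∑ m ∈ Finset.Ico (i * R) (i * R + R), ∑ e ∈ E with n e = m, g e := by
  rw [← Finset.sum_fiberwise_of_maps_to (g := n) (t := Finset.Ico (i * R) (i * R + R))]
  · refine Finset.sum_congr rfl fun m hm => ?_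
    rw [Finset.filter_filter]
    refine Finset.sum_congr (Finset.filter_congr fun e _ => ?_) fun _ _ => rfl
    rw [Finset.mem_Ico] at hm
    refine ⟨fun h => h.2, fun h => ⟨?_, h⟩⟩
    rw [h]
    exact Nat.div_eq_of_lt_le hm.1 (by rw [add_mul, one_mul]; exact hm.2)
  · intro e he
    have h1 := (Finset.mem_filter.1 he).2
    rw [Finset.mem_Ico, ← h1]
    exact ⟨Nat.div_mul_le_self _ _, Nat.lt_div_mul_add hR⟩

theorem norm_block_sum_sq_le {H ι : Type*} [NormedAddCommGroup H] {E : Finset ι} {G : ι → H}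
    {n : ι → ℕ} {D : ι → ℝ} {R : ℕ} (hR : 1 ≤ R)
    (h : ∀ m, ‖∑ e ∈ E with n e = m, G e‖ ^ 2 ≤ ∑ e ∈ E with n e = m, D e) (i : ℕ) :
    ‖∑ e ∈ E with n e / R = i, G e‖ ^ 2 ≤ R * ∑ e ∈ E with n e / R = i, D e := by
  rw [sum_filter_div_eq E n hR i G, sum_filter_div_eq E n hR i D]
  refine (norm_sum_sq_le_card_mul _ _).trans ?_
  rw [Nat.card_Ico, Nat.add_sub_cancel_left]
  gcongr with m
  exact h m

section AlmostOrthogonality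

variable {H : Type*} [NormedAddCommGroup H] [InnerProductSpace ℂ H]

theorem norm_sum_sq_le_of_lt (I : Finset ℕ) (V : ℕ → H) :
    ‖∑ i ∈ I, V i‖ ^ 2 ≤ ∑ i ∈ I, ‖V i‖ ^ 2 +
      2 * ∑ i ∈ I, ∑ j ∈ I with j < i, ‖inner ℂ (V i) (V j)‖ := by
  induction I using Finset.induction_on_max
  · simp
  · rename_i m I hm ih
    have hmI : m ∉ I := fun h => lt_irrefl _ (hm m h)
    rw [Finset.sum_insert hmI, Finset.sum_insert hmI, Finset.sum_insert hmI, @norm_add_sq ℂ]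
    have h1 : (insert m I).filter (· < m) = I := by
      rw [Finset.filter_insert, if_neg (lt_irrefl m), Finset.filter_true_of_mem hm]
    have h2 : ∀ i ∈ I, (insert m I).filter (· < i) = I.filter (· < i) := by
      intro i hi
      rw [Finset.filter_insert, if_neg (hm i hi).not_gt]
    have h3 : RCLike.re (inner ℂ (V m) (∑ i ∈ I, V i)) ≤ ∑ j ∈ I, ‖inner ℂ (V m) (V j)‖ := by
      rw [inner_sum]
      exact (RCLike.re_le_norm _).trans (norm_sum_le _ _)
    have h4 : ∑ i ∈ I, ∑ j ∈ insert m I with j < i, ‖inner ℂ (V i) (V j)‖ =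
        ∑ i ∈ I, ∑ j ∈ I with j < i, ‖inner ℂ (V i) (V j)‖ :=
      Finset.sum_congr rfl fun i hi => by rw [h2 i hi]
    rw [h1, h4]
    linarith

variable {ι : Type*} {E : Finset ι} {G : ι → H} {n : ι → ℕ} {D : ι → ℝ} {R : ℕ}

/-- Almost orthogonality for a family graded by `n`: the pieces of constant grade are orthogonal
up to constants, pieces of grades at least `R` apart have summable correlations. -/
theorem norm_sum_sq_le_of_separated (hD : ∀ e ∈ E, 0 ≤ D e) (hR : 1 ≤ R)
    (h₁ : ∀ m, ‖∑ e ∈ E with n e = m, G e‖ ^ 2 ≤ ∑ e ∈ E with n e = m, D e)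
    (h₂ : ∀ e ∈ E, ∑ e' ∈ E with R ≤ n e' ∧ n e' + R ≤ n e, ‖inner ℂ (G e) (G e')‖ ≤ R * D e) :
    ‖∑ e ∈ E, G e‖ ^ 2 ≤ 27 * R * ∑ e ∈ E, D e := by
  set V : ℕ → H := fun i => ∑ e ∈ E with n e / R = i, G e with hV
  set I : Finset ℕ := E.image fun e => n e / R with hI
  have hmap : ∀ e ∈ E, n e / R ∈ I := fun e he => Finset.mem_image_of_mem _ he
  have hblock : ∀ i, ‖V i‖ ^ 2 ≤ R * ∑ e ∈ E with n e / R = i, D e :=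
    norm_block_sum_sq_le hR h₁
  have hDi : ∀ i, 0 ≤ ∑ e ∈ E with n e / R = i, D e := fun i =>
    Finset.sum_nonneg fun e he => hD e (Finset.mem_filter.1 he).1
  have hclass : ∀ J ⊆ I, (∀ i ∈ J, ∀ j ∈ J, j < i → 1 ≤ j ∧ j + 2 ≤ i) →
      ‖∑ i ∈ J, V i‖ ^ 2 ≤ 3 * R * ∑ e ∈ E, D e := by
    intro J hJ hsep
    have h3 : ∀ i ∈ J, ∑ j ∈ J with j < i, ‖inner ℂ (V i) (V j)‖ ≤
        R * ∑ e ∈ E with n e / R = i, D e := by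
      intro i hi
      calc _ ≤ ∑ j ∈ J with j < i, ∑ e ∈ E with n e / R = i, ∑ e' ∈ E with n e' / R = j,
            ‖inner ℂ (G e) (G e')‖ := by
            refine Finset.sum_le_sum fun j _ => ?_
            simp only [hV]
            rw [sum_inner]
            refine (norm_sum_le _ _).trans (Finset.sum_le_sum fun e _ => ?_)
            rw [inner_sum]
            exact norm_sum_le _ _
        _ = ∑ e ∈ E with n e / R = i, ∑ j ∈ J with j < i, ∑ e' ∈ E with n e' / R = j,
            ‖inner ℂ (G e) (G e')‖ := Finset.sum_comm
        _ ≤ ∑ e ∈ E with n e / R = i, R * D e := by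
            refine Finset.sum_le_sum fun e he => ?_
            rw [Finset.mem_filter] at he
            refine le_trans ?_ (h₂ e he.1)
            rw [← Finset.sum_biUnion]
            · refine Finset.sum_le_sum_of_subset_of_nonneg (fun e' he' => ?_)
                fun _ _ _ => norm_nonneg _
              simp only [Finset.mem_biUnion, Finset.mem_filter] at he' ⊢
              obtain ⟨j, ⟨hj, hji⟩, he', rfl⟩ := he'
              obtain ⟨hj1, hj2⟩ := hsep i hi _ hj hji
              refine ⟨he', ?_, ?_⟩
              · exact (Nat.one_le_div_iff hR).1 hj1
              · have h4 : n e' < n e' / R * R + R := Nat.lt_div_mul_add hR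
                have h5 : n e / R * R ≤ n e := Nat.div_mul_le_self _ _
                have h6 : (n e' / R + 2) * R ≤ n e / R * R := by
                  rw [he.2]
                  exact Nat.mul_le_mul_right _ hj2
                nlinarith
            · intro j _ j' _ hjj'
              rw [Function.onFun, Finset.disjoint_filter]
              rintro e' _ rfl
              exact hjj'
        _ = _ := (Finset.mul_sum _ _ _).symm
    calc _ ≤ _ := norm_sum_sq_le_of_lt J V
      _ ≤ ∑ i ∈ J, R * ∑ e ∈ E with n e / R = i, D e +
          2 * ∑ i ∈ J, R * ∑ e ∈ E with n e / R = i, D e := by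
          gcongr with i hi i hi
          · exact hblock i
          · exact h3 i hi
      _ = 3 * R * ∑ i ∈ J, ∑ e ∈ E with n e / R = i, D e := by
          rw [← Finset.mul_sum]
          ring
      _ ≤ 3 * R * ∑ i ∈ I, ∑ e ∈ E with n e / R = i, D e := by
          refine mul_le_mul_of_nonneg_left ?_ (by positivity)
          exact Finset.sum_le_sum_of_subset_of_nonneg hJ fun i _ _ => hDi i
      _ = _ := by rw [Finset.sum_fiberwise_of_maps_to hmap]
  have hsplit : ∑ e ∈ E, G e = ∑ i ∈ I with i = 0, V i + (∑ i ∈ I with i ≠ 0 ∧ Even i, V i +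
      ∑ i ∈ I with i ≠ 0 ∧ ¬ Even i, V i) := by
    rw [← Finset.sum_fiberwise_of_maps_to hmap, ← Finset.sum_filter_add_sum_filter_not I (· = 0),
      ← Finset.sum_filter_add_sum_filter_not (I.filter (¬ · = 0)) Even, Finset.filter_filter,
      Finset.filter_filter]
  have ha := hclass (I.filter (· = 0)) (Finset.filter_subset _ _) (by
    intro i hi j hj hji
    rw [Finset.mem_filter] at hi hj
    omega)
  have hb := hclass (I.filter fun i => i ≠ 0 ∧ Even i) (Finset.filter_subset _ _) (by
    intro i hi j hj hji
    rw [Finset.mem_filter] at hi hj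
    obtain ⟨-, hi0, k, rfl⟩ := hi
    obtain ⟨-, hj0, k', rfl⟩ := hj
    omega)
  have hc := hclass (I.filter fun i => i ≠ 0 ∧ ¬ Even i) (Finset.filter_subset _ _) (by
    intro i hi j hj hji
    simp only [Finset.mem_filter, Nat.not_even_iff_odd] at hi hj
    obtain ⟨-, hi0, k, rfl⟩ := hi
    obtain ⟨-, hj0, k', rfl⟩ := hj
    omega)
  rw [hsplit]
  set x := ∑ i ∈ I with i = 0, V i
  set y := ∑ i ∈ I with i ≠ 0 ∧ Even i, V i
  set w := ∑ i ∈ I with i ≠ 0 ∧ ¬ Even i, V i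
  have h4 : ‖x + (y + w)‖ ≤ ‖x‖ + (‖y‖ + ‖w‖) :=
    (norm_add_le _ _).trans (by gcongr; exact norm_add_le _ _)
  have h5 : ‖x + (y + w)‖ ^ 2 ≤ (‖x‖ + (‖y‖ + ‖w‖)) ^ 2 := by gcongr
  have h6 : 0 ≤ R * ∑ e ∈ E, D e := mul_nonneg (Nat.cast_nonneg _) (Finset.sum_nonneg hD)
  nlinarith [sq_nonneg (‖x‖ - ‖y‖), sq_nonneg (‖x‖ - ‖w‖), sq_nonneg (‖y‖ - ‖w‖)]

end AlmostOrthogonality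

section Lattice

variable {d : ℕ}

/-- The half-open cube of side `l` with lower corner `l • w`. -/
def cell (d : ℕ) (l : ℝ) (w : Fin d → ℤ) : Set (Rd d) :=
  {t | ∀ i, w i * l ≤ t i ∧ t i < (w i + 1) * l}

theorem cell_eq_preimage (l : ℝ) (w : Fin d → ℤ) :
    cell d l w = (WithLp.ofLp : Rd d → Fin d → ℝ) ⁻¹'
      Set.univ.pi fun i => Ico (w i * l) ((w i + 1) * l) := by
  ext t
  simp [cell]

theorem measurableSet_cell (l : ℝ) (w : Fin d → ℤ) : MeasurableSet (cell d l w) := by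
  rw [cell_eq_preimage]
  exact (PiLp.volume_preserving_ofLp (Fin d)).measurable
    (MeasurableSet.univ_pi fun i => measurableSet_Ico)

theorem volume_cell {l : ℝ} (hl : 0 ≤ l) (w : Fin d → ℤ) :
    volume (cell d l w) = ENNReal.ofReal (l ^ d) := by
  rw [cell_eq_preimage, (PiLp.volume_preserving_ofLp (Fin d)).measure_preimage
    (MeasurableSet.univ_pi fun i => measurableSet_Ico).nullMeasurableSet, Real.volume_pi_Ico]
  simp [add_mul, ENNReal.ofReal_pow hl]

theorem qcube_eq_cell (z : Fin d → ℤ) : qcube d z = cell d 1 z := by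
  simp [qcube, cell]

theorem measurableSet_qcube (z : Fin d → ℤ) : MeasurableSet (qcube d z) :=
  qcube_eq_cell z ▸ measurableSet_cell 1 z

theorem volume_qcube (z : Fin d → ℤ) : volume (qcube d z) = 1 := by
  rw [qcube_eq_cell, volume_cell zero_le_one, one_pow, ENNReal.ofReal_one]

theorem eq_floor_of_mem_cell {l : ℝ} (hl : 0 < l) {w : Fin d → ℤ} {t : Rd d}
    (h : t ∈ cell d l w) : w = fun i => ⌊t i / l⌋ := by
  ext i
  symm
  rw [Int.floor_eq_iff, le_div_iff₀ hl, div_lt_iff₀ hl]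
  exact h i

theorem qcube_subset_cell {l : ℕ} (hl : 1 ≤ l) (z : Fin d → ℤ) :
    qcube d z ⊆ cell d l fun i => z i / l := by
  intro y hy i
  have hl' : (0 : ℤ) < l := by exact_mod_cast hl
  have h1 : z i / l * l ≤ z i := Int.ediv_mul_le _ hl'.ne'
  have h2 : z i + 1 ≤ (z i / l + 1) * l := Int.lt_ediv_add_one_mul_self _ hl'
  have h3 : ((z i / l : ℤ) : ℝ) * l ≤ z i := by exact_mod_cast h1
  have h4 : (z i : ℝ) + 1 ≤ (((z i / l : ℤ) : ℝ) + 1) * l := by exact_mod_cast h2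
  exact ⟨h3.trans (hy i).1, (hy i).2.trans_le h4⟩

theorem norm_le_card_mul {x : Rd d} {c : ℝ} (hc : 0 ≤ c) (h : ∀ i, |x i| ≤ c) :
    ‖x‖ ≤ d * c := by
  rw [EuclideanSpace.norm_eq]
  refine Real.sqrt_le_iff.2 ⟨by positivity, ?_⟩
  calc ∑ i, ‖x i‖ ^ 2 ≤ ∑ _i : Fin d, c ^ 2 := by
        gcongr with i
        exact h i
    _ = d * c ^ 2 := by simp
    _ ≤ (d * c) ^ 2 := by
        rw [mul_pow]
        gcongr
        exact_mod_cast Nat.le_self_pow two_ne_zero d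

theorem norm_sub_le_of_mem_cell {l : ℝ} (hl : 0 ≤ l) {w : Fin d → ℤ} {t t' : Rd d}
    (ht : t ∈ cell d l w) (ht' : t' ∈ cell d l w) : ‖t - t'‖ ≤ d * l := by
  refine norm_le_card_mul hl fun i => ?_
  obtain ⟨h1, h2⟩ := ht i
  obtain ⟨h3, h4⟩ := ht' i
  rw [PiLp.sub_apply, abs_le]
  constructor <;> linarith

/-- A family of cells of side `l` in which no cell is repeated more than `N` times has overlap
at most `N`. -/
theorem sum_setLIntegral_cell_le {ι : Type*} {F : Finset ι} {l : ℝ} (hl : 0 < l)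
    {w : ι → Fin d → ℤ} {N : ℝ≥0∞} (hN : ∀ v, ((F.filter fun i => w i = v).card : ℝ≥0∞) ≤ N)
    {P : Rd d → ℝ≥0∞} (hP : Measurable P) :
    ∑ i ∈ F, ∫⁻ t in cell d l (w i), P t ≤ N * ∫⁻ t, P t := by
  simp_rw [← lintegral_indicator (measurableSet_cell l _)]
  rw [← lintegral_finsetSum _ fun i _ => hP.indicator (measurableSet_cell l _),
    ← lintegral_const_mul _ hP]
  refine lintegral_mono fun t => ?_
  calc ∑ i ∈ F, (cell d l (w i)).indicator P t
      ≤ ∑ i ∈ F, if w i = (fun j => ⌊t j / l⌋) then P t else 0 := by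
        refine Finset.sum_le_sum fun i _ => ?_
        by_cases h : t ∈ cell d l (w i)
        · rw [if_pos (eq_floor_of_mem_cell hl h), indicator_of_mem h]
        · rw [indicator_of_notMem h]
          exact zero_le
    _ = (F.filter fun i => w i = fun j => ⌊t j / l⌋).card * P t := by
        rw [← Finset.sum_filter, Finset.sum_const, nsmul_eq_mul]
    _ ≤ N * P t := by
        gcongr
        exact hN _

/-- The largest value of the kernel `oscKer g a s` on the difference of two unit cubes. -/
def cubeSup (g : Rd d → ℂ) (a : Rd d → ℝ) (s : ℝ) (z z' : Fin d → ℤ) : ℝ≥0∞ :=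
  ⨆ y ∈ qcube d z, ⨆ y' ∈ qcube d z', ‖oscKer g a s (y - y')‖ₑ

variable {a : Rd d → ℝ}

theorem IsDistFn.exists_sum_cubeSup_le (ha : IsDistFn a) (hc : CurvNondeg a) (hd : 1 ≤ d)
    {g : Rd d → ℂ} (hg : ContDiff ℝ (⊤ : ℕ∞) g) {r : ℝ} (hr : 1 ≤ r)
    (hsupp : ∀ ζ ∉ shell d r, g ζ = 0) :
    ∃ C : ℝ≥0, ∀ (l : ℕ) (s' : ℝ) (z : Fin d → ℤ) (N : ℝ≥0∞) (F : Finset (ℕ × (Fin d → ℤ)))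
      (s : ℕ → ℝ), 1 ≤ l → (l : ℝ) ≤ 1 + |s'| → (∀ e ∈ F, (l : ℝ) ≤ 1 + |s e.1|) →
      (∀ e ∈ F, |s e.1 - s'| ≤ 2 * l) →
      (∀ v : Fin d → ℤ, ((F.filter fun e => (fun i => e.2 i / (l : ℤ)) = v).card : ℝ≥0∞) ≤ N) →
      ∑ e ∈ F, cubeSup g a (s e.1) z e.2 ≤
        C * N * ENNReal.ofReal (((l : ℝ) ^ d)⁻¹ * l * √(1 + |s'|) ^ (d - 1)) := by
  obtain ⟨C₁, hC₁⟩ := ha.exists_enorm_oscKer_le hc hd hg hr hsupp (2 * d) (by positivity)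
  obtain ⟨C₂, hC₂⟩ := ha.exists_lintegral_tubeInt_le hd (4 * (4 * r)) (by linarith)
  refine ⟨C₁ * C₂ * (√3 ^ (d - 1)).toNNReal, fun l s' z N F s hl hls' hls hss' hN => ?_⟩
  have hl0 : (0 : ℝ) < l := by exact_mod_cast hl
  have hl1 : (1 : ℝ) ≤ l := by exact_mod_cast hl
  set P : Rd d → ℝ≥0∞ := fun t => tubeInt a (4 * (4 * r)) l s' (latticeVec d z - t) with hP
  have hPm : Measurable P := (ha.measurable_tubeInt _ _ _).comp (by fun_prop)
  have hz : latticeVec d z ∈ qcube d z := fun i => ⟨le_rfl, lt_add_one _⟩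
  set W : ℝ := (√(1 + |s'|) ^ (d - 1))⁻¹ with hW
  set c₃ : ℝ := √3 ^ (d - 1) with hc₃
  have hpt : ∀ e ∈ F, ∀ t ∈ cell d l fun i => e.2 i / (l : ℤ),
      cubeSup g a (s e.1) z e.2 ≤ C₁ * ENNReal.ofReal (c₃ * W) * P t := by
    intro e he t ht
    refine iSup₂_le fun y hy => iSup₂_le fun y' hy' => ?_
    have hB : ‖y - y' - (latticeVec d z - t)‖ ≤ 2 * d * l := by
      have h1 : ‖y - latticeVec d z‖ ≤ d * 1 :=
        norm_sub_le_of_mem_cell zero_le_one (qcube_eq_cell z ▸ hy) (qcube_eq_cell z ▸ hz)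
      have h2 : ‖y' - t‖ ≤ d * l :=
        norm_sub_le_of_mem_cell hl0.le (qcube_subset_cell hl _ hy') ht
      have h3 : y - y' - (latticeVec d z - t) = (y - latticeVec d z) - (y' - t) := by abel
      rw [h3]
      refine (norm_sub_le _ _).trans ?_
      have : (d : ℝ) * 1 ≤ d * l := by gcongr
      linarith
    refine (hC₁ l (s e.1) s' _ _ hl1 (hls e he) hls' (hss' e he) hB).trans ?_
    gcongr
    rw [hc₃, hW, ← div_eq_mul_inv, ← div_pow, ← Real.sqrt_div (by norm_num), ← inv_pow,
      ← Real.sqrt_inv]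
    gcongr
    rw [inv_eq_one_div, div_le_div_iff₀ (by positivity) (by positivity)]
    have h1 := hls e he
    have h2 := hss' e he
    have h3 : |s'| ≤ |s e.1| + |s e.1 - s'| := by
      have := abs_sub_abs_le_abs_sub s' (s e.1)
      rw [abs_sub_comm] at this
      linarith
    linarith
  have hterm : ∀ e ∈ F, ENNReal.ofReal ((l : ℝ) ^ d) * cubeSup g a (s e.1) z e.2 ≤
      C₁ * ENNReal.ofReal (c₃ * W) * ∫⁻ t in cell d l fun i => e.2 i / (l : ℤ), P t := by
    intro e he
    rw [← lintegral_const_mul' _ _ (by finiteness), ← volume_cell hl0.le fun i => e.2 i / (l : ℤ),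
      mul_comm, ← setLIntegral_const]
    exact setLIntegral_mono' (measurableSet_cell _ _) fun t ht => hpt e he t ht
  have hPi : ∫⁻ t, P t ≤ C₂ * ENNReal.ofReal (l * (1 + |s'|) ^ (d - 1)) := by
    rw [hP, lintegral_sub_left_eq_self (fun t => tubeInt a (4 * (4 * r)) l s' t)]
    exact hC₂ l s' hl0
  have hsum : ENNReal.ofReal ((l : ℝ) ^ d) * ∑ e ∈ F, cubeSup g a (s e.1) z e.2 ≤
      C₁ * ENNReal.ofReal (c₃ * W) * (N * (C₂ * ENNReal.ofReal (l * (1 + |s'|) ^ (d - 1)))) := by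
    rw [Finset.mul_sum]
    refine (Finset.sum_le_sum hterm).trans ?_
    rw [← Finset.mul_sum]
    gcongr
    refine (sum_setLIntegral_cell_le hl0 hN hPm).trans ?_
    gcongr
  refine (ENNReal.le_ofReal_inv_mul (by positivity) hsum).trans (le_of_eq ?_)
  have h1 : (1 + |s'|) ^ (d - 1) = √(1 + |s'|) ^ (d - 1) * √(1 + |s'|) ^ (d - 1) := by
    rw [← mul_pow, Real.mul_self_sqrt (by positivity)]
  have h2 : ((l : ℝ) ^ d)⁻¹ * l * √(1 + |s'|) ^ (d - 1) =
      ((l : ℝ) ^ d)⁻¹ * (W * (l * (1 + |s'|) ^ (d - 1))) := by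
    rw [h1, hW]
    field_simp
  rw [h2, ENNReal.ofReal_mul (p := ((l : ℝ) ^ d)⁻¹) (by positivity),
    ENNReal.ofReal_mul (p := W) (by positivity), ENNReal.ofReal_mul (p := c₃) (by positivity),
      ENNReal.coe_mul, ENNReal.coe_mul,
    ← ENNReal.ofReal.eq_1]
  ring

end Lattice

section BlockEstimate

variable {d : ℕ} {a : Rd d → ℝ} {η : ℝ → ℝ}

/-- The weight `(1 + n) ^ ((d - 1) / 2)`. -/
def sqrtWt (d n : ℕ) : ℝ := √(1 + n) ^ (d - 1)

theorem sqrtWt_pos (d n : ℕ) : 0 < sqrtWt d n := by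
  unfold sqrtWt
  positivity

theorem IsDistFn.exists_sum_block_le (ha : IsDistFn a) (hc : CurvNondeg a) (hd : 3 ≤ d)
    {g : Rd d → ℂ} (hg : ContDiff ℝ (⊤ : ℕ∞) g) {r : ℝ} (hr : 1 ≤ r)
    (hsupp : ∀ ζ ∉ shell d r, g ζ = 0) :
    ∃ C : ℝ≥0, ∀ (l n m : ℕ) (z : Fin d → ℤ) (N : ℝ) (F : Finset (ℕ × (Fin d → ℤ))),
      1 ≤ l → (∀ e ∈ F, e.1 / l = m ∧ e.1 + l ≤ n ∧
        (1 + e.1 : ℝ) * (1 + n - m * l) ≤ 8 * l * (1 + n)) →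
      (∀ v : Fin d → ℤ, ((F.filter fun e => (fun i => e.2 i / (l : ℤ)) = v).card : ℝ) ≤ N * l) →
      ∑ e ∈ F, cubeSup g a ((e.1 : ℝ) - n) z e.2 * ENNReal.ofReal (sqrtWt d e.1) ≤
        C * ENNReal.ofReal (N * (√l ^ (d - 3))⁻¹ * sqrtWt d n) := by
  obtain ⟨C, hC⟩ := ha.exists_sum_cubeSup_le hc (by omega) hg hr hsupp
  refine ⟨C * (√8 ^ (d - 1)).toNNReal, fun l n m z N F hl hF hN => ?_⟩
  rcases F.eq_empty_or_nonempty with rfl | ⟨e₀, he₀⟩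
  · simp
  have hl1 : (1 : ℝ) ≤ l := by exact_mod_cast hl
  have hN0 : 0 ≤ N * l := (Nat.cast_nonneg _).trans (hN 0)
  have hmul : ∀ e ∈ F, (m * l : ℝ) ≤ e.1 ∧ (e.1 : ℝ) ≤ m * l + l ∧ (e.1 : ℝ) + l ≤ n := by
    intro e he
    obtain ⟨h1, h2, -⟩ := hF e he
    have h3 : e.1 / l * l ≤ e.1 := Nat.div_mul_le_self _ _
    have h4 : e.1 < e.1 / l * l + l := Nat.lt_div_mul_add hl
    rw [h1] at h3 h4
    exact ⟨by exact_mod_cast h3, by exact_mod_cast h4.le, by exact_mod_cast h2⟩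
  have hs' : |(m * l : ℝ) - n| = n - m * l := by
    obtain ⟨h1, h2, h3⟩ := hmul e₀ he₀
    rw [abs_of_nonpos (by linarith)]
    ring
  set S : ℝ := 1 + n - m * l with hS
  have hS0 : l ≤ S := by
    obtain ⟨h1, h2, h3⟩ := hmul e₀ he₀
    linarith
  have hS1 : 0 < S := by linarith
  have hsum := hC l (m * l - n) z (ENNReal.ofReal (N * l)) F (fun k => k - n) hl (by
      rw [hs']
      linarith) (fun e he => by
      obtain ⟨h1, h2, h3⟩ := hmul e he
      rw [abs_of_nonpos (by linarith)]
      linarith) (fun e he => by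
      obtain ⟨h1, h2, h3⟩ := hmul e he
      rw [abs_le]
      constructor <;> linarith) fun v => by
      rw [← ENNReal.ofReal_natCast]
      exact ENNReal.ofReal_le_ofReal (hN v)
  rw [hs', show 1 + ((n : ℝ) - m * l) = S by rw [hS]; ring] at hsum
  have hw : ∀ e ∈ F, sqrtWt d e.1 ≤ √(8 * l * (1 + n) / S) ^ (d - 1) := by
    intro e he
    unfold sqrtWt
    gcongr
    rw [le_div_iff₀ hS1]
    exact (hF e he).2.2
  calc _ ≤ ∑ e ∈ F, cubeSup g a ((e.1 : ℝ) - n) z e.2 *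
        ENNReal.ofReal (√(8 * l * (1 + n) / S) ^ (d - 1)) := by
        refine Finset.sum_le_sum fun e he => ?_
        gcongr
        exact hw e he
    _ = (∑ e ∈ F, cubeSup g a ((e.1 : ℝ) - n) z e.2) *
        ENNReal.ofReal (√(8 * l * (1 + n) / S) ^ (d - 1)) := (Finset.sum_mul _ _ _).symm
    _ ≤ _ := mul_le_mul_left hsum _
    _ = C * ENNReal.ofReal (N * l * (((l : ℝ) ^ d)⁻¹ * l * √S ^ (d - 1)) *
        √(8 * l * (1 + n) / S) ^ (d - 1)) := by
        rw [mul_assoc (C : ℝ≥0∞), ← ENNReal.ofReal_mul hN0, mul_assoc, ← ENNReal.ofReal_mul]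
        positivity
    _ = _ := by
        rw [ENNReal.coe_mul, ← ENNReal.ofReal.eq_1, mul_assoc (C : ℝ≥0∞),
          ← ENNReal.ofReal_mul (p := √8 ^ (d - 1)) (by positivity)]
        congr 2
        obtain ⟨k, rfl⟩ : ∃ k, d = k + 3 := ⟨d - 3, by omega⟩
        have h1 : √S ^ (k + 3 - 1) * √(8 * l * (1 + n) / S) ^ (k + 3 - 1) =
            (√8 * √l * √(1 + n)) ^ (k + 3 - 1) := by
          rw [← mul_pow, ← Real.sqrt_mul hS1.le, mul_div_cancel₀ _ hS1.ne', Real.sqrt_mul (by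
            positivity), Real.sqrt_mul (by positivity)]
        have h2 : (l : ℝ) = √l * √l := (Real.mul_self_sqrt (by positivity)).symm
        have h3 : (l : ℝ) * ((l : ℝ) ^ (k + 3))⁻¹ * l * √l ^ (k + 2) = (√l ^ k)⁻¹ := by
          have h4 : 0 < √(l : ℝ) := by positivity
          nth_rw 1 2 3 [h2]
          field_simp
          ring
        have h5 : ∀ x y : ℝ, N * l * (((l : ℝ) ^ (k + 3))⁻¹ * l * x) * y =
            N * (l * ((l : ℝ) ^ (k + 3))⁻¹ * l) * (x * y) := fun x y => by ring
        rw [h5, h1, mul_pow, mul_pow, sqrtWt]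
        simp only [Nat.add_sub_cancel, show k + 3 - 1 = k + 2 by omega]
        rw [← h3]
        ring

theorem sum_inv_sqrt_two_pow_le (hd : 4 ≤ d) {R : ℕ} (hR : 1 ≤ R) (M : ℕ) :
    ∑ k ∈ Finset.range M with R < 2 ^ (k + 1), (√((2 ^ k : ℕ) : ℝ) ^ (d - 3))⁻¹ ≤
      √2 ^ (d - 3) / (1 - (√2)⁻¹) * (√R ^ (d - 3))⁻¹ := by
  set q : ℝ := (√2)⁻¹ with hq
  have hq0 : 0 < q := by positivity
  have hq1 : q < 1 := inv_lt_one_of_one_lt₀ (by rw [Real.lt_sqrt] <;> norm_num)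
  have hterm : ∀ k : ℕ, (√((2 ^ k : ℕ) : ℝ) ^ (d - 3))⁻¹ = (q ^ (d - 3)) ^ k := by
    intro k
    have h1 : √((2 : ℝ) ^ k) = √2 ^ k := by
      rw [Real.sqrt_eq_iff_mul_self_eq (by positivity) (by positivity), ← mul_pow,
        Real.mul_self_sqrt (by norm_num)]
    rw [hq, inv_pow, inv_pow, Nat.cast_pow, Nat.cast_ofNat, h1,
      ← pow_mul, ← pow_mul, mul_comm]
  set k₀ := Nat.log 2 R
  have hk₀ : R < 2 ^ (k₀ + 1) := Nat.lt_pow_succ_log_self (by norm_num) _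
  obtain ⟨j, rfl⟩ : ∃ j, d = j + 4 := ⟨d - 4, by omega⟩
  have hj : j + 4 - 3 = j + 1 := by omega
  calc _ ≤ ∑ k ∈ Finset.Ico k₀ M, (q ^ j) ^ k₀ * q ^ k := by
        refine (Finset.sum_le_sum_of_subset_of_nonneg (t := Finset.Ico k₀ M) (fun k hk => ?_)
          fun _ _ _ => by positivity).trans (Finset.sum_le_sum fun k hk => ?_)
        · rw [Finset.mem_filter, Finset.mem_range] at hk
          rw [Finset.mem_Ico]
          exact ⟨Nat.lt_succ_iff.1 ((Nat.log_lt_iff_lt_pow (by norm_num) (by omega)).2 hk.2), hk.1⟩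
        · rw [hterm, hj, pow_succ, mul_pow]
          gcongr ?_ * _
          exact pow_le_pow_of_le_one (by positivity) (pow_le_one₀ hq0.le hq1.le)
            (Finset.mem_Ico.1 hk).1
    _ ≤ (q ^ j) ^ k₀ * (q ^ k₀ / (1 - q)) := by
        rw [← Finset.mul_sum]
        gcongr
        exact geom_sum_Ico_le_of_lt_one hq0.le hq1
    _ = √2 ^ (j + 4 - 3) / (1 - q) * (√((2 ^ (k₀ + 1) : ℕ) : ℝ) ^ (j + 4 - 3))⁻¹ := by
        rw [hterm, hj]
        have h1 : √2 ^ (j + 1) * (q ^ (j + 1)) ^ (k₀ + 1) = (q ^ (j + 1)) ^ k₀ := by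
          rw [pow_succ (q ^ (j + 1)), mul_left_comm, ← mul_pow, hq,
            mul_inv_cancel₀ (by positivity), one_pow, mul_one]
        rw [div_mul_eq_mul_div, h1, pow_succ q j, mul_pow]
        ring
    _ ≤ _ := by
        have h1 : 0 < 1 - q := by linarith
        have h2 : (R : ℝ) ≤ ((2 ^ (k₀ + 1) : ℕ) : ℝ) := by exact_mod_cast hk₀.le
        gcongr

end BlockEstimate

section SeparatedEstimate

variable {d : ℕ} {a : Rd d → ℝ} {η : ℝ → ℝ}

/-- The index of the dyadic box of side `2 ^ k` containing the space-time lattice point `e`. -/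
def boxIdx (k : ℕ) (e : ℕ × (Fin d → ℤ)) : ℕ × (Fin d → ℤ) :=
  (e.1 / 2 ^ k, fun i => e.2 i / ((2 ^ k : ℕ) : ℤ))

theorem exists_dyadic_scale {R n n' : ℕ} (hR : 1 ≤ R) (h : R ≤ n') (h' : n' + R ≤ n) :
    ∃ k ≤ n, R < 2 ^ (k + 1) ∧ ∃ m ∈ ({1, n / 2 ^ k - 1, n / 2 ^ k - 2} : Finset ℕ),
      n' / 2 ^ k = m ∧ 2 ^ k ≤ n' ∧ n' + 2 ^ k ≤ n ∧
        (1 + n' : ℝ) * (1 + n - m * (2 ^ k : ℕ)) ≤ 8 * (2 ^ k : ℕ) * (1 + n) := by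
  set k := Nat.log 2 (min n' (n - n')) with hk
  have h0 : min n' (n - n') ≠ 0 := by omega
  have h1 : 2 ^ k ≤ min n' (n - n') := Nat.pow_log_le_self _ h0
  have h2 : min n' (n - n') < 2 ^ (k + 1) := Nat.lt_pow_succ_log_self (by norm_num) _
  have hkn : k ≤ n := by
    have : k < 2 ^ k := Nat.lt_two_pow_self
    omega
  refine ⟨k, hkn, by omega, n' / 2 ^ k, ?_, rfl, by omega, by omega, ?_⟩
  all_goals
    rw [pow_succ] at h2
    have hl : 1 ≤ 2 ^ k := Nat.one_le_two_pow
    generalize 2 ^ k = l at *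
    have h3 : n' / l * l ≤ n' := Nat.div_mul_le_self _ _
    have h4 : n' < n' / l * l + l := Nat.lt_div_mul_add hl
    have h5 : n / l * l ≤ n := Nat.div_mul_le_self _ _
    have h6 : n < n / l * l + l := Nat.lt_div_mul_add hl
    generalize n' / l = y at *
    generalize n / l = x at *
  · simp only [Finset.mem_insert, Finset.mem_singleton]
    rcases le_total n' (n - n') with h7 | h7
    · left
      rw [min_eq_left h7] at h1 h2
      have h8 : y < 2 := by
        by_contra h8
        have : 2 * l ≤ y * l := Nat.mul_le_mul_right _ (by omega)
        omega
      have h9 : y ≠ 0 := by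
        rintro rfl
        omega
      omega
    · right
      rw [min_eq_right h7] at h1 h2
      have h8 : y < x := by
        by_contra h8
        have : x * l ≤ y * l := Nat.mul_le_mul_right _ (by omega)
        omega
      have h9 : x ≤ y + 2 := by
        by_contra h9
        have : (y + 3) * l ≤ x * l := Nat.mul_le_mul_right _ (by omega)
        nlinarith [Nat.sub_add_cancel (show n' ≤ n by omega)]
      omega
  · have h3' : (y * l : ℝ) ≤ n' := by exact_mod_cast h3
    have h4' : (n' : ℝ) ≤ y * l + l := by exact_mod_cast h4.le
    have hl' : (1 : ℝ) ≤ l := by exact_mod_cast hl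
    have hn' : (n' : ℝ) ≤ n := by exact_mod_cast (show n' ≤ n by omega)
    have h0' : (0 : ℝ) ≤ n' := by positivity
    have h00 : (0 : ℝ) ≤ y * l := by positivity
    rcases le_total n' (n - n') with h7 | h7
    · rw [min_eq_left h7] at h1 h2
      have h8 : (n' : ℝ) ≤ 2 * l := by exact_mod_cast (show n' ≤ 2 * l by omega)
      exact mul_le_mul (by linarith) (by linarith) (by linarith) (by linarith)
    · rw [min_eq_right h7] at h1 h2
      have h8 : (n : ℝ) ≤ n' + 2 * l := by exact_mod_cast (show n ≤ n' + 2 * l by omega)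
      rw [mul_comm]
      exact mul_le_mul (by linarith) (by linarith) (by linarith) (by linarith)

theorem IsDistFn.exists_sum_separated_le (ha : IsDistFn a) (hc : CurvNondeg a) (hd : 4 ≤ d)
    {g : Rd d → ℂ} (hg : ContDiff ℝ (⊤ : ℕ∞) g) {r : ℝ} (hr : 1 ≤ r)
    (hsupp : ∀ ζ ∉ shell d r, g ζ = 0) :
    ∃ C : ℝ≥0, ∀ (E : Finset (ℕ × (Fin d → ℤ))) (R : ℕ), 1 ≤ R →
      (∀ (k : ℕ) (q : ℕ × (Fin d → ℤ)), 1 ≤ q.1 →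
        ((E.filter fun e => boxIdx k e = q).card : ℝ) ≤ √R ^ (d - 1) * 2 ^ k) →
      ∀ (n : ℕ) (z : Fin d → ℤ), ∑ e ∈ E with R ≤ e.1 ∧ e.1 + R ≤ n,
        cubeSup g a ((e.1 : ℝ) - n) z e.2 * ENNReal.ofReal (sqrtWt d e.1) ≤
          C * ENNReal.ofReal (R * sqrtWt d n) := by
  obtain ⟨C, hC⟩ := ha.exists_sum_block_le hc (by omega) hg hr hsupp
  set c : ℝ := √2 ^ (d - 3) / (1 - (√2)⁻¹) with hcdef
  have hc0 : 0 < c := by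
    have : (√2)⁻¹ < 1 := inv_lt_one_of_one_lt₀ (by rw [Real.lt_sqrt] <;> norm_num)
    have : 0 < 1 - (√2)⁻¹ := by linarith
    positivity
  refine ⟨C * (3 * c).toNNReal, fun E R hR hE n z => ?_⟩
  set φ : ℕ × (Fin d → ℤ) → ℝ≥0∞ := fun e =>
    cubeSup g a ((e.1 : ℝ) - n) z e.2 * ENNReal.ofReal (sqrtWt d e.1)
  let T : ℕ → ℕ → Finset (ℕ × (Fin d → ℤ)) := fun k m => E.filter fun e =>
    e.1 / 2 ^ k = m ∧ 2 ^ k ≤ e.1 ∧ e.1 + 2 ^ k ≤ n ∧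
      (1 + e.1 : ℝ) * (1 + n - m * (2 ^ k : ℕ)) ≤ 8 * (2 ^ k : ℕ) * (1 + n)
  set K := (Finset.range (n + 1)).filter fun k => R < 2 ^ (k + 1)
  let M : ℕ → Finset ℕ := fun k => {1, n / 2 ^ k - 1, n / 2 ^ k - 2}
  have hT : ∀ k m, ∑ e ∈ T k m, φ e ≤
      C * ENNReal.ofReal (√R ^ (d - 1) * (√((2 ^ k : ℕ) : ℝ) ^ (d - 3))⁻¹ * sqrtWt d n) := by
    intro k m
    refine hC (2 ^ k) n m z (√R ^ (d - 1)) (T k m) Nat.one_le_two_pow (fun e he => ?_) fun v => ?_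
    · obtain ⟨-, h1, h2, h3, h4⟩ := Finset.mem_filter.1 he
      exact ⟨h1, h3, h4⟩
    · rcases Nat.eq_zero_or_pos m with rfl | hm
      · rw [Finset.filter_false_of_mem (fun e he => ?_)]
        · simp only [Finset.card_empty, Nat.cast_zero]
          positivity
        · obtain ⟨-, h1, h2, h3, h4⟩ := Finset.mem_filter.1 he
          exact absurd h1 (Nat.div_pos h2 (by positivity)).ne'
      · push_cast
        refine le_trans ?_ (hE k (m, v) hm)
        gcongr
        intro e he
        simp only [T, Finset.mem_filter, boxIdx] at he ⊢
        refine Finset.mem_filter.2 ⟨he.1.1, ?_⟩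
        rw [he.1.2.1, ← he.2]
        push_cast
        rfl
  calc _ ≤ ∑ e ∈ E, ∑ k ∈ K, ∑ m ∈ M k, if e ∈ T k m then φ e else 0 := by
        rw [Finset.sum_filter]
        refine Finset.sum_le_sum fun e he => ?_
        split_ifs with h
        · obtain ⟨k, hk, hRk, m, hm, h1⟩ := exists_dyadic_scale hR h.1 h.2
          have hmem : e ∈ T k m := Finset.mem_filter.2 ⟨he, h1⟩
          calc φ e = if e ∈ T k m then φ e else 0 := by rw [if_pos hmem]
            _ ≤ ∑ m ∈ M k, if e ∈ T k m then φ e else 0 :=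
              Finset.single_le_sum (f := fun m => if e ∈ T k m then φ e else 0)
                (fun _ _ => zero_le) hm
            _ ≤ _ := Finset.single_le_sum
                (f := fun k => ∑ m ∈ M k, if e ∈ T k m then φ e else 0)
                (fun _ _ => zero_le)
                (Finset.mem_filter.2 ⟨Finset.mem_range.2 (Nat.lt_succ_of_le hk), hRk⟩)
        · exact zero_le
    _ = ∑ k ∈ K, ∑ m ∈ M k, ∑ e ∈ T k m, φ e := by
        rw [Finset.sum_comm]
        refine Finset.sum_congr rfl fun k _ => ?_
        rw [Finset.sum_comm]
        refine Finset.sum_congr rfl fun m _ => ?_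
        rw [← Finset.sum_filter]
        refine Finset.sum_congr ?_ fun _ _ => rfl
        rw [Finset.filter_mem_eq_inter, Finset.inter_eq_right]
        exact Finset.filter_subset _ _
    _ ≤ ∑ k ∈ K, 3 * (C * ENNReal.ofReal
          (√R ^ (d - 1) * (√((2 ^ k : ℕ) : ℝ) ^ (d - 3))⁻¹ * sqrtWt d n)) := by
        refine Finset.sum_le_sum fun k _ => (Finset.sum_le_sum fun m _ => hT k m).trans ?_
        rw [Finset.sum_const, nsmul_eq_mul]
        gcongr
        exact_mod_cast Finset.card_le_three
    _ = 3 * C * ENNReal.ofReal (√R ^ (d - 1) *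
          (∑ k ∈ K, (√((2 ^ k : ℕ) : ℝ) ^ (d - 3))⁻¹) * sqrtWt d n) := by
        rw [← Finset.mul_sum, ← Finset.mul_sum, ← mul_assoc, ← ENNReal.ofReal_sum_of_nonneg
          fun k _ => mul_nonneg (by positivity) (sqrtWt_pos d n).le, Finset.mul_sum,
          Finset.sum_mul]
    _ ≤ 3 * C * ENNReal.ofReal (c * (R * sqrtWt d n)) := by
        refine mul_le_mul_right (ENNReal.ofReal_le_ofReal ?_) _
        have h1 := sum_inv_sqrt_two_pow_le hd hR (n + 1)
        have hw := sqrtWt_pos d n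
        have hR0 : 0 < √(R : ℝ) := by
          have : (0 : ℝ) < R := by exact_mod_cast hR
          positivity
        calc _ ≤ √R ^ (d - 1) * (c * (√R ^ (d - 3))⁻¹) * sqrtWt d n := by
              gcongr
          _ = c * ((√R * √R) * sqrtWt d n) := by
              obtain ⟨j, rfl⟩ : ∃ j, d = j + 3 := ⟨d - 3, by omega⟩
              simp only [Nat.add_sub_cancel, show j + 3 - 1 = j + 2 by omega]
              field_simp
              ring
          _ = _ := by rw [Real.mul_self_sqrt (Nat.cast_nonneg _)]
    _ = _ := by
        rw [ENNReal.ofReal_mul hc0.le, ENNReal.coe_mul, ← ENNReal.ofReal.eq_1,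
          ENNReal.ofReal_mul (p := 3) (by norm_num), ENNReal.ofReal_ofNat]
        ring

theorem IsDistFn.exists_sum_same_le (ha : IsDistFn a) (hc : CurvNondeg a) (hd : 1 ≤ d)
    {g : Rd d → ℂ} (hg : ContDiff ℝ (⊤ : ℕ∞) g) {r : ℝ} (hr : 1 ≤ r)
    (hsupp : ∀ ζ ∉ shell d r, g ζ = 0) :
    ∃ C : ℝ≥0, ∀ (E : Finset (ℕ × (Fin d → ℤ))) (n : ℕ) (z : Fin d → ℤ),
      ∑ e ∈ E with e.1 = n, cubeSup g a ((e.1 : ℝ) - n) z e.2 ≤ C := by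
  obtain ⟨C, hC⟩ := ha.exists_sum_cubeSup_le hc hd hg hr hsupp
  refine ⟨C, fun E n z => ?_⟩
  have h := hC 1 0 z 1 (E.filter fun e => e.1 = n) (fun k => (k : ℝ) - n) le_rfl (by simp)
    (fun e _ => by simp) (fun e he => by simp [(Finset.mem_filter.1 he).2]) fun v => by
      have : (((E.filter fun e => e.1 = n).filter
          fun e => (fun i => e.2 i / ((1 : ℕ) : ℤ)) = v)).card ≤ 1 := by
        refine Finset.card_le_one.2 fun e he e' he' => ?_
        simp only [Finset.mem_filter, Nat.cast_one, Int.ediv_one] at he he'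
        exact Prod.ext (he.1.2.trans he'.1.2.symm) (he.2.trans he'.2.symm)
      exact_mod_cast this
  simpa using h

end SeparatedEstimate

section LTwoEstimate

variable {d : ℕ} {a : Rd d → ℝ} {η : ℝ → ℝ}

theorem IsDistFn.enorm_integral_conj_le_cubeSup (ha : IsDistFn a) (hη : IsBump η) (s s' : ℝ)
    {b b' : Rd d → ℂ} (hbm : Measurable b) (hbm' : Measurable b') {z z' : Fin d → ℤ}
    (hz : ∀ y ∉ qcube d z, b y = 0) (hz' : ∀ y ∉ qcube d z', b' y = 0)
    (hb : ∫⁻ y, ‖b y‖ₑ ≤ 1) (hb' : ∫⁻ y, ‖b' y‖ₑ ≤ 1) :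
    ‖∫ x, starRingEnd ℂ (conv (Kker a η s) b x) * conv (Kker a η s') b' x‖ₑ ≤
      cubeSup (fun ξ => ((η (a ξ) ^ 2 : ℝ) : ℂ)) a (s' - s) z z' := by
  set M := cubeSup (fun ξ => ((η (a ξ) ^ 2 : ℝ) : ℂ)) a (s' - s) z z' with hM
  refine (ha.enorm_integral_conj_conv_mul_conv_le hη s s' hbm hbm'
    ⟨hbm.aestronglyMeasurable, hb.trans_lt ENNReal.one_lt_top⟩
    ⟨hbm'.aestronglyMeasurable, hb'.trans_lt ENNReal.one_lt_top⟩).trans ?_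
  calc _ ≤ ∫⁻ p : Rd d × Rd d, (‖b p.1‖ₑ * ‖b' p.2‖ₑ) * M := by
        refine lintegral_mono fun p => ?_
        by_cases h : p.1 ∈ qcube d z
        · by_cases h' : p.2 ∈ qcube d z'
          · gcongr
            exact le_iSup₂_of_le p.1 h (le_iSup₂_of_le p.2 h' le_rfl)
          · simp [hz' _ h']
        · simp [hz _ h]
    _ = (∫⁻ y, ‖b y‖ₑ) * (∫⁻ y, ‖b' y‖ₑ) * M := by
        have h := lintegral_prod_mul (μ := (volume : Measure (Rd d)))
          (ν := (volume : Measure (Rd d))) hbm.enorm.aemeasurable hbm'.enorm.aemeasurable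
        rw [lintegral_mul_const _ (by fun_prop), Measure.volume_eq_prod, h]
    _ ≤ 1 * 1 * M := by gcongr
    _ = M := by rw [one_mul, one_mul]

theorem IsDistFn.exists_lintegral_sum_conv_sq_le (ha : IsDistFn a) (hc : CurvNondeg a)
    (hη : IsBump η) (hd : 4 ≤ d) :
    ∃ C : ℝ≥0, ∀ (u : ℝ) (E : Finset (ℕ × (Fin d → ℤ))) (R : ℕ)
      (b : ℕ × (Fin d → ℤ) → Rd d → ℂ), 1 ≤ R →
      (∀ (k : ℕ) (q : ℕ × (Fin d → ℤ)), 1 ≤ q.1 →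
        ((E.filter fun e => boxIdx k e = q).card : ℝ) ≤ √R ^ (d - 1) * 2 ^ k) →
      (∀ e ∈ E, Measurable (b e)) → (∀ e ∈ E, ∀ y ∉ qcube d e.2, b e y = 0) →
      (∀ e ∈ E, ∫⁻ y, ‖b e y‖ₑ ≤ 1) →
      ∫⁻ x, ‖∑ e ∈ E, (sqrtWt d e.1 : ℂ) * conv (Kker a η (e.1 + u)) (b e) x‖ₑ ^ 2 ≤
        C * R * ∑ e ∈ E, ENNReal.ofReal (sqrtWt d e.1 ^ 2) := by
  obtain ⟨r, hr1, hr⟩ := ha.exists_shell_support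
  set g : Rd d → ℂ := fun ξ => ((η (a ξ) ^ 2 : ℝ) : ℂ) with hgdef
  have hg : ContDiff ℝ (⊤ : ℕ∞) g :=
    Complex.ofRealCLM.contDiff.comp (ha.contDiff_bump_comp (η := fun t => η t ^ 2)
      (hη.smooth.pow 2) fun x hx => by simp [hη.supp x hx])
  have hgs : ∀ ζ ∉ shell d r, g ζ = 0 := fun ζ hζ => by
    simp [hgdef, hη.eq_zero_of_notMem hr hζ]
  obtain ⟨C₁, hC₁⟩ := ha.exists_sum_same_le hc (by omega) hg hr1 hgs
  obtain ⟨C₂, hC₂⟩ := ha.exists_sum_separated_le hc hd hg hr1 hgs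
  set c : ℝ≥0 := max C₁ C₂
  refine ⟨27 * c, fun u E R b hR hE hbm hbs hb1 => ?_⟩
  set b' : ℕ × (Fin d → ℤ) → Rd d → ℂ := fun e => if e ∈ E then b e else 0 with hb'
  have hb'E : ∀ e ∈ E, b' e = b e := fun e he => if_pos he
  have hbi : ∀ e, Integrable (b' e) := by
    intro e
    by_cases he : e ∈ E
    · rw [hb'E e he]
      exact ⟨(hbm e he).aestronglyMeasurable, (hb1 e he).trans_lt ENNReal.one_lt_top⟩
    · rw [hb']
      simp only [if_neg he]
      exact integrable_zero _ _ _
  let T : ℕ × (Fin d → ℤ) → Lp ℂ 2 (volume : Measure (Rd d)) := fun e =>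
    (ha.memLp_conv hη (e.1 + u) (hbi e)).toLp _
  let G : ℕ × (Fin d → ℤ) → Lp ℂ 2 (volume : Measure (Rd d)) := fun e => (sqrtWt d e.1 : ℂ) • T e
  have hinner : ∀ e ∈ E, ∀ e' ∈ E, ‖inner ℂ (G e) (G e')‖ₑ ≤
      ENNReal.ofReal (sqrtWt d e.1) * (cubeSup g a ((e'.1 : ℝ) - e.1) e.2 e'.2 *
        ENNReal.ofReal (sqrtWt d e'.1)) := by
    intro e he e' he'
    have h1 : inner ℂ (T e) (T e') = ∫ x, starRingEnd ℂ (conv (Kker a η (e.1 + u)) (b e) x) *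
        conv (Kker a η (e'.1 + u)) (b e') x := by
      rw [L2.inner_def]
      refine integral_congr_ae ?_
      filter_upwards [(ha.memLp_conv hη (e.1 + u) (hbi e)).coeFn_toLp,
        (ha.memLp_conv hη (e'.1 + u) (hbi e')).coeFn_toLp] with x hx hx'
      rw [hx, hx', RCLike.inner_apply, hb'E e he, hb'E e' he', mul_comm]
    have h2 := ha.enorm_integral_conj_le_cubeSup hη (e.1 + u) (e'.1 + u) (hbm e he) (hbm e' he')
      (hbs e he) (hbs e' he') (hb1 e he) (hb1 e' he')
    rw [← h1, show (e'.1 + u : ℝ) - (e.1 + u) = e'.1 - e.1 by ring] at h2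
    have h3 : ∀ k, ‖(sqrtWt d k : ℂ)‖ₑ = ENNReal.ofReal (sqrtWt d k) := fun k => by
      rw [← ofReal_norm, Complex.norm_real, Real.norm_of_nonneg (sqrtWt_pos d k).le]
    rw [inner_smul_left, inner_smul_right, enorm_mul, enorm_mul, RCLike.enorm_conj, h3, h3,
      mul_comm (ENNReal.ofReal (sqrtWt d e'.1))]
    gcongr
  have hnorm : ∀ (S : Finset (ℕ × (Fin d → ℤ))) (f : ℕ × (Fin d → ℤ) → ℂ),
      ENNReal.ofReal (∑ e ∈ S, ‖f e‖) = ∑ e ∈ S, ‖f e‖ₑ := fun S f => by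
    rw [ENNReal.ofReal_sum_of_nonneg fun _ _ => norm_nonneg _]
    simp_rw [ofReal_norm]
  have hsq : ∀ k, sqrtWt d k * sqrtWt d k = sqrtWt d k ^ 2 := fun k => (sq _).symm
  have hmain := norm_sum_sq_le_of_separated (E := E) (G := G) (n := Prod.fst)
    (D := fun e => c * sqrtWt d e.1 ^ 2) (R := R) (fun e _ => by positivity) hR (fun m => by
      have h1 : ‖∑ e ∈ E with e.1 = m, G e‖ ^ 2 ≤ ∑ e ∈ E with e.1 = m, ∑ e' ∈ E with e'.1 = m,
          ‖inner ℂ (G e) (G e')‖ := by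
        rw [← @inner_self_eq_norm_sq ℂ, sum_inner]
        refine (RCLike.re_le_norm _).trans ((norm_sum_le _ _).trans ?_)
        refine Finset.sum_le_sum fun e _ => ?_
        rw [inner_sum]
        exact norm_sum_le _ _
      refine h1.trans (Finset.sum_le_sum fun e hem => ?_)
      obtain ⟨he, rfl⟩ := Finset.mem_filter.1 hem
      rw [← ENNReal.ofReal_le_ofReal_iff (by positivity), hnorm]
      calc _ ≤ ∑ e' ∈ E with e'.1 = e.1, ENNReal.ofReal (sqrtWt d e.1) *
            (cubeSup g a ((e'.1 : ℝ) - e.1) e.2 e'.2 * ENNReal.ofReal (sqrtWt d e.1)) := by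
            refine Finset.sum_le_sum fun e' he' => ?_
            obtain ⟨he', h⟩ := Finset.mem_filter.1 he'
            have h2 := hinner e he e' he'
            rwa [congrArg (sqrtWt d) h] at h2
        _ = ENNReal.ofReal (sqrtWt d e.1) * ((∑ e' ∈ E with e'.1 = e.1,
            cubeSup g a ((e'.1 : ℝ) - e.1) e.2 e'.2) * ENNReal.ofReal (sqrtWt d e.1)) := by
            rw [← Finset.mul_sum, Finset.sum_mul]
        _ ≤ ENNReal.ofReal (sqrtWt d e.1) * (c * ENNReal.ofReal (sqrtWt d e.1)) := by
            gcongr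
            exact (hC₁ E e.1 e.2).trans (by exact_mod_cast le_max_left _ _)
        _ = _ := by
            rw [← hsq, ENNReal.ofReal_mul c.coe_nonneg, ENNReal.ofReal_coe_nnreal,
              ENNReal.ofReal_mul (sqrtWt_pos d _).le]
            ring) (fun e he => by
      rw [← ENNReal.ofReal_le_ofReal_iff (by positivity), hnorm]
      calc _ ≤ ∑ e' ∈ E with R ≤ e'.1 ∧ e'.1 + R ≤ e.1, ENNReal.ofReal (sqrtWt d e.1) *
            (cubeSup g a ((e'.1 : ℝ) - e.1) e.2 e'.2 * ENNReal.ofReal (sqrtWt d e'.1)) :=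
            Finset.sum_le_sum fun e' he' => hinner e he e' (Finset.mem_filter.1 he').1
        _ ≤ ENNReal.ofReal (sqrtWt d e.1) * (C₂ * ENNReal.ofReal (R * sqrtWt d e.1)) := by
            rw [← Finset.mul_sum]
            gcongr
            exact hC₂ E R hR hE e.1 e.2
        _ ≤ ENNReal.ofReal (sqrtWt d e.1) * (c * ENNReal.ofReal (R * sqrtWt d e.1)) := by
            gcongr
            exact le_max_right _ _
        _ = _ := by
            rw [← hsq, ENNReal.ofReal_mul (Nat.cast_nonneg _),
              ENNReal.ofReal_mul (Nat.cast_nonneg _), ENNReal.ofReal_mul c.coe_nonneg,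
              ENNReal.ofReal_coe_nnreal, ENNReal.ofReal_mul (sqrtWt_pos d _).le]
            ring)
  have hfin : ∫⁻ x, ‖∑ e ∈ E, (sqrtWt d e.1 : ℂ) * conv (Kker a η (e.1 + u)) (b e) x‖ₑ ^ 2 =
      ENNReal.ofReal (‖∑ e ∈ E, G e‖ ^ 2) := by
    rw [ENNReal.ofReal_pow (norm_nonneg _), ofReal_norm, Lp.enorm_def]
    have h2 := eLpNorm_nnreal_pow_eq_lintegral (f := (∑ e ∈ E, G e : Lp ℂ 2 volume))
      (μ := (volume : Measure (Rd d))) (p := 2) two_ne_zero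
    have h3 : ∀ x : ℝ≥0∞, x ^ ((2 : ℝ≥0) : ℝ) = x ^ 2 := fun x => by
      rw [NNReal.coe_ofNat, ENNReal.rpow_ofNat]
    simp only [h3, ENNReal.coe_ofNat] at h2
    rw [h2]
    refine lintegral_congr_ae ?_
    have h4 : ∀ᵐ x, ∀ e ∈ E, G e x = (sqrtWt d e.1 : ℂ) * conv (Kker a η (e.1 + u)) (b e) x := by
      rw [Finset.eventually_all]
      intro e he
      filter_upwards [(ha.memLp_conv hη (e.1 + u) (hbi e)).coeFn_toLp,
        Lp.coeFn_smul (sqrtWt d e.1 : ℂ) (T e)] with x hx hx'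
      rw [hx', Pi.smul_apply, hx, smul_eq_mul, hb'E e he]
    filter_upwards [h4, Lp.coeFn_finsetSum E G] with x hx hx'
    rw [hx', Finset.sum_apply, Finset.sum_congr rfl hx]
  rw [hfin]
  refine (ENNReal.ofReal_le_ofReal hmain).trans (le_of_eq ?_)
  rw [← Finset.mul_sum, ENNReal.ofReal_mul (by positivity), ENNReal.ofReal_mul (by positivity),
    ENNReal.ofReal_mul c.coe_nonneg, ENNReal.ofReal_coe_nnreal,
    ENNReal.ofReal_sum_of_nonneg fun _ _ => by positivity, ENNReal.ofReal_natCast,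
    ENNReal.ofReal_ofNat, ENNReal.coe_mul, ENNReal.coe_ofNat]
  ring

end LTwoEstimate

section Atoms

variable {d : ℕ} {a : Rd d → ℝ} {η : ℝ → ℝ}

/-- `b` is a family of functions, indexed by space-time lattice points `e ∈ E`, such that `b e` is
supported in the unit cube with corner `e.2` and has `L¹` norm at most `γ e`. -/
structure IsAtomFamily (E : Finset (ℕ × (Fin d → ℤ))) (b : ℕ × (Fin d → ℤ) → Rd d → ℂ)
    (γ : ℕ × (Fin d → ℤ) → ℝ) : Prop where
  measurable : ∀ e ∈ E, Measurable (b e)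
  support : ∀ e ∈ E, ∀ y ∉ qcube d e.2, b e y = 0
  lintegral_le : ∀ e ∈ E, ∫⁻ y, ‖b e y‖ₑ ≤ ENNReal.ofReal (γ e)
  pos : ∀ e ∈ E, 0 < γ e
  one_le : ∀ e ∈ E, 1 ≤ e.1

theorem IsAtomFamily.mono {E F : Finset (ℕ × (Fin d → ℤ))} {b : ℕ × (Fin d → ℤ) → Rd d → ℂ}
    {γ : ℕ × (Fin d → ℤ) → ℝ} (h : IsAtomFamily E b γ) (hF : F ⊆ E) : IsAtomFamily F b γ :=
  ⟨fun e he => h.measurable e (hF he), fun e he => h.support e (hF he),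
    fun e he => h.lintegral_le e (hF he), fun e he => h.pos e (hF he),
    fun e he => h.one_le e (hF he)⟩

theorem IsAtomFamily.integrable {E : Finset (ℕ × (Fin d → ℤ))} {b : ℕ × (Fin d → ℤ) → Rd d → ℂ}
    {γ : ℕ × (Fin d → ℤ) → ℝ} (h : IsAtomFamily E b γ) {e : ℕ × (Fin d → ℤ)} (he : e ∈ E) :
    Integrable (b e) :=
  ⟨(h.measurable e he).aestronglyMeasurable,
    (h.lintegral_le e he).trans_lt ENNReal.ofReal_lt_top⟩

/-- The weighted superposition of the convolutions of the `b e` with the kernels. -/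
def superpos (a : Rd d → ℝ) (η : ℝ → ℝ) (u : ℝ) (E : Finset (ℕ × (Fin d → ℤ)))
    (b : ℕ × (Fin d → ℤ) → Rd d → ℂ) (x : Rd d) : ℂ :=
  ∑ e ∈ E, (sqrtWt d e.1 : ℂ) * conv (Kker a η (e.1 + u)) (b e) x

theorem enorm_sqrtWt (d n : ℕ) : ‖(sqrtWt d n : ℂ)‖ₑ = ENNReal.ofReal (sqrtWt d n) := by
  rw [← ofReal_norm, Complex.norm_real, Real.norm_of_nonneg (sqrtWt_pos d n).le]

theorem sqrtWt_sq (d n : ℕ) : sqrtWt d n ^ 2 = (1 + n : ℝ) ^ (d - 1) := by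
  rw [sqrtWt, ← pow_mul, mul_comm, pow_mul, Real.sq_sqrt (by positivity)]

theorem card_le_of_boxIdx_eq {k : ℕ} {β : ℕ × (Fin d → ℤ)} {F : Finset (ℕ × (Fin d → ℤ))}
    (hF : ∀ e ∈ F, boxIdx k e = β) : F.card ≤ 2 ^ k * (2 ^ k) ^ d := by
  have hl : 0 < 2 ^ k := by positivity
  have hl' : (0 : ℤ) < ((2 ^ k : ℕ) : ℤ) := by positivity
  have hsub : F ⊆ Finset.Ico (β.1 * 2 ^ k) (β.1 * 2 ^ k + 2 ^ k) ×ˢ Fintype.piFinset fun i =>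
      Finset.Ico (β.2 i * ((2 ^ k : ℕ) : ℤ)) (β.2 i * ((2 ^ k : ℕ) : ℤ) + ((2 ^ k : ℕ) : ℤ)) := by
    intro e he
    rw [← hF e he]
    simp only [Finset.mem_product, Finset.mem_Ico, Fintype.mem_piFinset, boxIdx]
    exact ⟨⟨Nat.div_mul_le_self _ _, Nat.lt_div_mul_add hl⟩, fun i =>
      ⟨Int.ediv_mul_le _ hl'.ne', by linarith [Int.lt_ediv_add_one_mul_self (e.2 i) hl']⟩⟩
  refine (Finset.card_le_card hsub).trans (le_of_eq ?_)
  rw [Finset.card_product, Fintype.card_piFinset]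
  simp only [Nat.card_Ico, Int.card_Ico, add_tsub_cancel_left,
    Int.toNat_natCast, Finset.prod_const, Finset.card_univ, Fintype.card_fin]

theorem mul_le_of_boxIdx_eq {k : ℕ} {β e : ℕ × (Fin d → ℤ)} (h : boxIdx k e = β) :
    (β.1 * 2 ^ k : ℝ) ≤ e.1 ∧ (e.1 : ℝ) + 1 ≤ β.1 * 2 ^ k + 2 ^ k := by
  have h3 : e.1 / 2 ^ k * 2 ^ k ≤ e.1 := Nat.div_mul_le_self _ _
  have h4 : e.1 + 1 ≤ e.1 / 2 ^ k * 2 ^ k + 2 ^ k := Nat.lt_div_mul_add (by positivity)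
  rw [← h]
  exact ⟨by exact_mod_cast h3, by exact_mod_cast h4⟩

theorem sum_sqrtWt_sq_mul_le (hd : 1 ≤ d) {k : ℕ} {β : ℕ × (Fin d → ℤ)} (hβ : 1 ≤ β.1)
    {F : Finset (ℕ × (Fin d → ℤ))} (hF : ∀ e ∈ F, boxIdx k e = β) {γ : ℕ × (Fin d → ℤ) → ℝ}
    (hγ : ∀ e ∈ F, 0 < γ e) {q : ℝ} (hq : 1 ≤ q) (hdense : (2 : ℝ) ^ k ≤ ∑ e ∈ F, γ e ^ q) :
    (((2 : ℝ) ^ k) ^ d)⁻¹ * ∑ e ∈ F, sqrtWt d e.1 ^ 2 * γ e ≤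
      2 ^ d * ∑ e ∈ F, sqrtWt d e.1 ^ 2 * γ e ^ q := by
  set l : ℝ := 2 ^ k
  have hl : 1 ≤ l := one_le_pow₀ (by norm_num)
  set w := ∑ e ∈ F, γ e ^ q
  set ν : ℝ := (1 + β.1 * l) ^ (d - 1)
  have hν : 0 < ν := by positivity
  have hβ' : (1 : ℝ) ≤ β.1 := by exact_mod_cast hβ
  have hup : ∀ e ∈ F, sqrtWt d e.1 ^ 2 ≤ 2 ^ (d - 1) * ν := by
    intro e he
    obtain ⟨-, h⟩ := mul_le_of_boxIdx_eq (hF e he)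
    rw [sqrtWt_sq, ← mul_pow]
    gcongr
    have : l ≤ β.1 * l := le_mul_of_one_le_left (by linarith) hβ'
    linarith
  have hlow : ∀ e ∈ F, ν ≤ sqrtWt d e.1 ^ 2 := by
    intro e he
    obtain ⟨h, -⟩ := mul_le_of_boxIdx_eq (hF e he)
    rw [sqrtWt_sq]
    exact pow_le_pow_left₀ (by positivity) (by linarith) _
  have hcard : (F.card : ℝ) ≤ l * l ^ d := by
    have h : (F.card : ℝ) ≤ ((2 ^ k * (2 ^ k) ^ d : ℕ) : ℝ) :=
      Nat.cast_le.2 (card_le_of_boxIdx_eq hF)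
    push_cast at h
    exact h
  have hsum : ∑ e ∈ F, γ e ≤ 2 * l ^ d * w := by
    calc ∑ e ∈ F, γ e ≤ ∑ e ∈ F, (1 + γ e ^ q) := by
          refine Finset.sum_le_sum fun e he => ?_
          rcases le_total (γ e) 1 with h | h
          · have := Real.rpow_nonneg (hγ e he).le q
            linarith
          · have := Real.rpow_le_rpow_of_exponent_le h hq
            rw [Real.rpow_one] at this
            linarith
      _ = F.card + w := by rw [Finset.sum_add_distrib]; simp [w]
      _ ≤ w * l ^ d + l ^ d * w := by
          refine add_le_add (hcard.trans (by gcongr)) ?_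
          exact le_mul_of_one_le_left (by linarith) (one_le_pow₀ hl)
      _ = _ := by ring
  calc _ ≤ (l ^ d)⁻¹ * ∑ e ∈ F, (2 ^ (d - 1) * ν) * γ e := by
        gcongr with e he
        · exact (hγ e he).le
        · exact hup e he
    _ = (l ^ d)⁻¹ * (2 ^ (d - 1) * ν) * ∑ e ∈ F, γ e := by
        rw [← Finset.mul_sum]
        ring
    _ ≤ (l ^ d)⁻¹ * (2 ^ (d - 1) * ν) * (2 * l ^ d * w) := by gcongr
    _ = 2 ^ (d - 1 + 1) * (ν * w) := by
        field_simp
        ring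
    _ ≤ 2 ^ d * (ν * w) := by
        rw [Nat.sub_add_cancel hd]
    _ ≤ _ := by
        rw [Finset.mul_sum]
        gcongr with e he
        · exact Real.rpow_nonneg (hγ e he).le q
        · exact hlow e he

theorem lintegral_compl_conv_le {K b : Rd d → ℂ} (hK : Measurable K) (hb : Measurable b)
    {z : Fin d → ℤ} (hz : ∀ y ∉ qcube d z, b y = 0) {S : Set (Rd d)} (hS : MeasurableSet S)
    {X : ℝ≥0∞} (hX : ∀ y ∈ qcube d z, ∫⁻ x in {x | x + y ∈ S}, ‖K x‖ₑ ≤ X) :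
    ∫⁻ x in S, ‖conv K b x‖ₑ ≤ X * ∫⁻ y, ‖b y‖ₑ := by
  have hm : Measurable fun p : Rd d × Rd d => ‖K (p.1 - p.2)‖ₑ * ‖b p.2‖ₑ := by fun_prop
  calc _ ≤ ∫⁻ x in S, ∫⁻ y, ‖K (x - y)‖ₑ * ‖b y‖ₑ := by
        refine lintegral_mono fun x => (enorm_integral_le_lintegral_enorm _).trans (le_of_eq ?_)
        simp_rw [enorm_mul]
    _ = ∫⁻ y, ∫⁻ x in S, ‖K (x - y)‖ₑ * ‖b y‖ₑ := lintegral_lintegral_swap hm.aemeasurable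
    _ ≤ ∫⁻ y, X * ‖b y‖ₑ := by
        refine lintegral_mono fun y => ?_
        by_cases hy : y ∈ qcube d z
        · rw [lintegral_mul_const' _ _ (by finiteness)]
          gcongr
          refine le_trans (le_of_eq ?_) (hX y hy)
          have hSy : MeasurableSet {x | x + y ∈ S} := hS.preimage (by fun_prop)
          rw [← lintegral_indicator hS, ← lintegral_indicator hSy,
            ← lintegral_sub_right_eq_self
              ({x | x + y ∈ S}.indicator fun x => ‖K x‖ₑ) y]
          refine lintegral_congr fun x => ?_
          simp [indicator_apply]
        · simp [hz y hy]
    _ = _ := lintegral_const_mul _ hb.enorm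

theorem IsDistFn.exists_exceptional_set (ha : IsDistFn a) (hη : IsBump η) (hd : 1 ≤ d) {q : ℝ}
    (hq : 1 ≤ q) :
    ∃ C : ℝ≥0, ∀ (u : ℝ) (k : ℕ) (β : ℕ × (Fin d → ℤ)) (F : Finset (ℕ × (Fin d → ℤ)))
      (b : ℕ × (Fin d → ℤ) → Rd d → ℂ) (γ : ℕ × (Fin d → ℤ) → ℝ), 0 ≤ u → u < 1 →
      IsAtomFamily F b γ → 1 ≤ β.1 → (∀ e ∈ F, boxIdx k e = β) →
      (2 : ℝ) ^ k ≤ ∑ e ∈ F, γ e ^ q →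
      ∃ Ω, MeasurableSet Ω ∧
        volume Ω ≤ C * ENNReal.ofReal (∑ e ∈ F, sqrtWt d e.1 ^ 2 * γ e ^ q) ∧
        ∫⁻ x in Ωᶜ, ‖superpos a η u F b x‖ₑ ≤
          C * ENNReal.ofReal (∑ e ∈ F, sqrtWt d e.1 ^ 2 * γ e ^ q) := by
  obtain ⟨r, hr1, hr⟩ := ha.exists_shell_support
  have hg : ContDiff ℝ (⊤ : ℕ∞) fun ξ => (η (a ξ) : ℂ) :=
    Complex.ofRealCLM.contDiff.comp (ha.contDiff_bump_comp hη.smooth hη.supp)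
  have hgs : ∀ ζ ∉ shell d r, (η (a ζ) : ℂ) = 0 := fun ζ hζ => by
    simp [hη.eq_zero_of_notMem hr hζ]
  obtain ⟨C, hC⟩ := ha.exists_oscKer_tail hd hg hr1 hgs d (Nat.cast_nonneg _)
  refine ⟨C + C * (√2 ^ (d - 1) * 2 ^ d).toNNReal,
    fun u k β F b γ hu0 hu1 hF hβ hFβ hdense => ?_⟩
  set l : ℝ := 2 ^ k
  have hl : 1 ≤ l := one_le_pow₀ (by norm_num)
  have hl0 : 0 < l := by linarith
  have hβ' : (1 : ℝ) ≤ β.1 := by exact_mod_cast hβ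
  have hs' : |(β.1 * l : ℝ)| = β.1 * l := abs_of_nonneg (by positivity)
  have hβl : l ≤ β.1 * l := le_mul_of_one_le_left hl0.le hβ'
  obtain ⟨Ω₀, hΩ₀, hvol, htail⟩ := hC l (β.1 * l) hl (by rw [hs']; linarith)
  set c : Rd d := WithLp.toLp 2 fun i => β.2 i * l
  set X := ∑ e ∈ F, sqrtWt d e.1 ^ 2 * γ e ^ q with hX
  have hX0 : 0 ≤ X := Finset.sum_nonneg fun e he =>
    mul_nonneg (sq_nonneg _) (Real.rpow_nonneg (hF.pos e he).le q)
  have hνX : l * (1 + β.1 * l) ^ (d - 1) ≤ X := by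
    calc _ ≤ (∑ e ∈ F, γ e ^ q) * (1 + β.1 * l) ^ (d - 1) := by gcongr
      _ = ∑ e ∈ F, (1 + β.1 * l) ^ (d - 1) * γ e ^ q := by
          rw [Finset.sum_mul]
          exact Finset.sum_congr rfl fun e _ => mul_comm _ _
      _ ≤ _ := by
          refine Finset.sum_le_sum fun e he => ?_
          obtain ⟨h, -⟩ := mul_le_of_boxIdx_eq (hFβ e he)
          rw [sqrtWt_sq]
          have := Real.rpow_nonneg (hF.pos e he).le q
          gcongr
  have hΩ : MeasurableSet {x | x - c ∈ Ω₀} := hΩ₀.preimage (by fun_prop)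
  refine ⟨{x | x - c ∈ Ω₀}, hΩ, ?_, ?_⟩
  · have h1 : volume {x | x - c ∈ Ω₀} = volume Ω₀ := by
      simp only [sub_eq_add_neg]
      exact measure_preimage_add_right volume (-c) Ω₀
    rw [h1]
    refine hvol.trans ?_
    rw [hs']
    gcongr
    simp
  · have hterm : ∀ e ∈ F, ∫⁻ x in {x | x - c ∈ Ω₀}ᶜ,
        ‖(sqrtWt d e.1 : ℂ) * conv (Kker a η (e.1 + u)) (b e) x‖ₑ ≤
        C * ENNReal.ofReal (√2 ^ (d - 1) * ((l ^ d)⁻¹ * (sqrtWt d e.1 ^ 2 * γ e))) := by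
      intro e he
      obtain ⟨h1, h2⟩ := mul_le_of_boxIdx_eq (hFβ e he)
      have habs : |(e.1 + u : ℝ)| = e.1 + u := abs_of_nonneg (by positivity)
      have h3 := lintegral_compl_conv_le (ha.continuous_Kker hη (e.1 + u)).measurable
        (hF.measurable e he) (hF.support e he) hΩ.compl
        (X := C * ENNReal.ofReal ((l ^ d)⁻¹ * √(1 + |(e.1 + u : ℝ)|) ^ (d - 1))) (by
          intro y hy
          rw [Kker_eq_oscKer]
          have h4 := htail (e.1 + u) (y - c) (by rw [habs]; linarith)
            (by rw [abs_le]; constructor <;> linarith) (norm_le_card_mul hl0.le fun i => by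
              have h5 := qcube_subset_cell (l := 2 ^ k) Nat.one_le_two_pow e.2 hy i
              have h6 : e.2 i / ((2 ^ k : ℕ) : ℤ) = β.2 i := by
                rw [← hFβ e he]
                rfl
              beta_reduce at h5
              rw [h6] at h5
              push_cast at h5
              rw [PiLp.sub_apply, abs_le]
              change -l ≤ y i - β.2 i * l ∧ y i - β.2 i * l ≤ l
              constructor <;> linarith [h5.1, h5.2])
          have h5 : {x : Rd d | x + y ∈ {x | x - c ∈ Ω₀}ᶜ} = {x | x + (y - c) ∉ Ω₀} := by
            ext x
            simp only [mem_ofPred_eq, mem_compl_iff, add_sub_assoc]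
          rw [h5]
          exact h4)
      simp_rw [enorm_mul, enorm_sqrtWt]
      rw [lintegral_const_mul' _ _ (by finiteness)]
      have hw := sqrtWt_pos d e.1
      calc _ ≤ ENNReal.ofReal (sqrtWt d e.1) * (C * ENNReal.ofReal ((l ^ d)⁻¹ *
            √(1 + |(e.1 + u : ℝ)|) ^ (d - 1)) * ENNReal.ofReal (γ e)) := by
            gcongr
            exact h3.trans (mul_le_mul_right (hF.lintegral_le e he) _)
        _ ≤ ENNReal.ofReal (sqrtWt d e.1) * (C * ENNReal.ofReal ((l ^ d)⁻¹ *
            (√2 ^ (d - 1) * sqrtWt d e.1)) * ENNReal.ofReal (γ e)) := by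
            gcongr
            rw [sqrtWt, ← mul_pow, ← Real.sqrt_mul (by norm_num), habs]
            gcongr
            have := Nat.cast_nonneg (α := ℝ) e.1
            linarith
        _ = _ := by
            have hγ := hF.pos e he
            rw [mul_assoc (C : ℝ≥0∞), ← ENNReal.ofReal_mul (by positivity), mul_left_comm,
              ← ENNReal.ofReal_mul (by positivity)]
            congr 2
            ring
    calc _ ≤ ∑ e ∈ F, ∫⁻ x in {x | x - c ∈ Ω₀}ᶜ,
          ‖(sqrtWt d e.1 : ℂ) * conv (Kker a η (e.1 + u)) (b e) x‖ₑ := by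
          rw [← lintegral_finsetSum' _ fun e he => ?_]
          · exact lintegral_mono fun x => enorm_sum_le _ _
          · exact ((ha.integrable_conv hη _ (hF.integrable he)).const_mul _).1.enorm.restrict
      _ ≤ ∑ e ∈ F, C * ENNReal.ofReal (√2 ^ (d - 1) * ((l ^ d)⁻¹ * (sqrtWt d e.1 ^ 2 * γ e))) :=
          Finset.sum_le_sum hterm
      _ = C * ENNReal.ofReal (√2 ^ (d - 1) * ((l ^ d)⁻¹ * ∑ e ∈ F, sqrtWt d e.1 ^ 2 * γ e)) := by
          rw [← Finset.mul_sum, ← ENNReal.ofReal_sum_of_nonneg fun e he => by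
            have := hF.pos e he
            positivity, ← Finset.mul_sum, ← Finset.mul_sum]
      _ ≤ C * ENNReal.ofReal ((√2 ^ (d - 1) * 2 ^ d) * X) := by
          rw [mul_assoc (√2 ^ (d - 1))]
          exact mul_le_mul_right (ENNReal.ofReal_le_ofReal (mul_le_mul_of_nonneg_left
            (sum_sqrtWt_sq_mul_le hd hβ hFβ hF.pos hq hdense) (by positivity))) _
      _ = C * (√2 ^ (d - 1) * 2 ^ d).toNNReal * ENNReal.ofReal X := by
          rw [ENNReal.ofReal_mul (by positivity), ENNReal.ofReal, mul_assoc]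
      _ ≤ _ := by
          push_cast
          gcongr
          simp

end Atoms

section GoodPart

variable {d : ℕ} {a : Rd d → ℝ} {η : ℝ → ℝ}

theorem conv_const_mul (K b : Rd d → ℂ) (c : ℂ) (x : Rd d) :
    conv K (fun y => c * b y) x = c * conv K b x := by
  simp only [conv, mul_left_comm _ c]
  exact integral_const_mul c _

theorem superpos_const_mul (u : ℝ) (E : Finset (ℕ × (Fin d → ℤ)))
    (b : ℕ × (Fin d → ℤ) → Rd d → ℂ) (c : ℂ) (x : Rd d) :
    superpos a η u E (fun e y => c * b e y) x = c * superpos a η u E b x := by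
  simp only [superpos, conv_const_mul, Finset.mul_sum, mul_left_comm _ c]

theorem aestronglyMeasurable_superpos (ha : IsDistFn a) (hη : IsBump η) (u : ℝ)
    {E : Finset (ℕ × (Fin d → ℤ))} {b : ℕ × (Fin d → ℤ) → Rd d → ℂ}
    (hb : ∀ e ∈ E, Integrable (b e)) : AEStronglyMeasurable (superpos a η u E b) volume :=
  Finset.aestronglyMeasurable_fun_sum _ fun e he =>
    ((ha.integrable_conv hη _ (hb e he)).const_mul _).1

theorem enorm_sum_range_sq_le {t : ℝ} (ht : 0 < t) (ht' : t < 1) (M : ℕ) (z : ℕ → ℂ) :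
    ‖∑ m ∈ Finset.range M, z m‖ₑ ^ 2 ≤
      ∑ m ∈ Finset.range M, ENNReal.ofReal ((1 - t)⁻¹ * (t ^ m)⁻¹) * ‖z m‖ₑ ^ 2 := by
  have h1t : 0 < 1 - t := by linarith
  have key : ‖∑ m ∈ Finset.range M, z m‖ ^ 2 ≤
      ∑ m ∈ Finset.range M, (1 - t)⁻¹ * (t ^ m)⁻¹ * ‖z m‖ ^ 2 := by
    calc _ ≤ (∑ m ∈ Finset.range M, ‖z m‖) ^ 2 := by gcongr; exact norm_sum_le _ _
      _ ≤ (∑ m ∈ Finset.range M, t ^ m) * ∑ m ∈ Finset.range M, (t ^ m)⁻¹ * ‖z m‖ ^ 2 :=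
          Finset.sum_sq_le_sum_mul_sum_of_sq_le_mul _ (fun m _ => by positivity)
            (fun m _ => by positivity) fun m _ => by
              rw [mul_inv_cancel_left₀ (by positivity)]
      _ ≤ (1 - t)⁻¹ * ∑ m ∈ Finset.range M, (t ^ m)⁻¹ * ‖z m‖ ^ 2 := by
          gcongr
          have := geom_sum_Ico_le_of_lt_one (m := 0) (n := M) ht.le ht'
          rwa [pow_zero, one_div, ← Finset.range_eq_Ico] at this
      _ = _ := by simp only [Finset.mul_sum, mul_assoc]
  have h : ∀ w : ℂ, ‖w‖ₑ ^ 2 = ENNReal.ofReal (‖w‖ ^ 2) := fun w => by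
    rw [ENNReal.ofReal_pow (norm_nonneg _), ofReal_norm]
  simp only [h, ← ENNReal.ofReal_mul (show 0 ≤ (1 - t)⁻¹ * (t ^ _)⁻¹ by positivity)]
  rw [← ENNReal.ofReal_sum_of_nonneg fun m _ => by positivity]
  exact ENNReal.ofReal_le_ofReal key

theorem boxIdx_zero (e : ℕ × (Fin d → ℤ)) : boxIdx 0 e = e := by
  simp [boxIdx]

/-- The interpolation exponent `κ = q (d + 1) / (d - 1)` satisfies `κ < 2` in the admissible
range. -/
theorem exponent_lt_two (hd : 4 ≤ d) {q : ℝ} (hq2 : q < 2 * ((d : ℝ) - 1) / ((d : ℝ) + 1)) :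
    q + 2 * q / ((d : ℝ) - 1) < 2 := by
  have hd' : (4 : ℝ) ≤ d := by exact_mod_cast hd
  rw [lt_div_iff₀ (by linarith)] at hq2
  have h : q + 2 * q / ((d : ℝ) - 1) = q * (d + 1) / (d - 1) := by
    field_simp [show (d : ℝ) - 1 ≠ 0 by linarith]
    ring
  rw [h, div_lt_iff₀ (by linarith)]
  exact hq2

theorem IsDistFn.exists_lintegral_superpos_level_le (ha : IsDistFn a) (hc : CurvNondeg a)
    (hη : IsBump η) (hd : 4 ≤ d) {q : ℝ} (hq : 1 ≤ q)
    (hq2 : q < 2 * ((d : ℝ) - 1) / ((d : ℝ) + 1)) :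
    ∃ C : ℝ≥0, ∀ (u : ℝ) (m : ℕ) (E : Finset (ℕ × (Fin d → ℤ)))
      (b : ℕ × (Fin d → ℤ) → Rd d → ℂ) (γ : ℕ × (Fin d → ℤ) → ℝ), IsAtomFamily E b γ →
      (∀ (k : ℕ) (β : ℕ × (Fin d → ℤ)), 1 ≤ β.1 →
        ∑ e ∈ E with boxIdx k e = β, γ e ^ q ≤ 2 ^ k) →
      (∀ e ∈ E, (1 / 2 : ℝ) ^ (m + 1) < γ e ∧ γ e ≤ (1 / 2) ^ m) →
      ∫⁻ x, ‖superpos a η u E b x‖ₑ ^ 2 ≤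
        C * ENNReal.ofReal (((2 : ℝ) ^ (q + 2 * q / ((d : ℝ) - 1) - 2)) ^ m *
          ∑ e ∈ E, sqrtWt d e.1 ^ 2 * γ e ^ q) := by
  obtain ⟨C, hC⟩ := ha.exists_lintegral_sum_conv_sq_le hc hη hd
  refine ⟨C * 8, fun u m E b γ hE hgood hlev => ?_⟩
  have hd' : (4 : ℝ) ≤ d := by exact_mod_cast hd
  have hκ := exponent_lt_two hd hq2
  set κ := q + 2 * q / ((d : ℝ) - 1) with hκdef
  set ρ : ℝ := 2 ^ ((m + 1 : ℝ) * (2 * q / ((d : ℝ) - 1))) with hρ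
  have hρ1 : 1 ≤ ρ := Real.one_le_rpow (by norm_num)
    (mul_nonneg (by positivity) (div_nonneg (by linarith) (by linarith)))
  set R := ⌈ρ⌉₊ with hR
  have hR1 : 1 ≤ R := Nat.one_le_ceil_iff.2 (by linarith)
  have hRρ : (R : ℝ) ≤ 2 * ρ := by
    have := Nat.ceil_lt_add_one (show 0 ≤ ρ by linarith)
    linarith
  have hγq : ∀ e ∈ E, (2 : ℝ) ^ (-((m + 1 : ℝ) * q)) ≤ γ e ^ q := fun e he => by
    calc (2 : ℝ) ^ (-((m + 1 : ℝ) * q)) = ((1 / 2 : ℝ) ^ (m + 1)) ^ q := by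
          rw [one_div, inv_pow, ← Real.rpow_natCast, ← Real.rpow_neg (by norm_num),
            ← Real.rpow_mul (by norm_num)]
          push_cast
          ring_nf
      _ ≤ _ := Real.rpow_le_rpow (by positivity) (hlev e he).1.le (by linarith)
  have hsqrt : (2 : ℝ) ^ ((m + 1 : ℝ) * q) ≤ √R ^ (d - 1) := by
    calc (2 : ℝ) ^ ((m + 1 : ℝ) * q) = √ρ ^ (d - 1) := by
          rw [Real.sqrt_eq_rpow, ← Real.rpow_natCast, Nat.cast_sub (by omega), hρ,
            ← Real.rpow_mul (by positivity), ← Real.rpow_mul (by norm_num)]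
          congr 1
          push_cast
          field_simp [show (d : ℝ) - 1 ≠ 0 by linarith]
      _ ≤ _ := by
          gcongr
          exact Nat.le_ceil ρ
  have hmain := hC u E R (fun e y => (2 : ℂ) ^ m * b e y) hR1 (fun k β hβ => by
      have h1 := hgood k β hβ
      have h2 : ((E.filter fun e => boxIdx k e = β).card : ℝ) * 2 ^ (-((m + 1 : ℝ) * q)) ≤ 2 ^ k := by
        rw [← nsmul_eq_mul]
        exact (Finset.card_nsmul_le_sum _ _ _ fun e he =>
          hγq e (Finset.mem_filter.1 he).1).trans h1
      rw [Real.rpow_neg (by norm_num), ← div_eq_mul_inv, div_le_iff₀ (by positivity)] at h2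
      calc _ ≤ _ := h2
        _ ≤ _ := by rw [mul_comm]; gcongr)
    (fun e he => (hE.measurable e he).const_mul _)
    (fun e he y hy => by simp [hE.support e he y hy])
    (fun e he => by
      simp_rw [enorm_mul]
      rw [lintegral_const_mul' _ _ (by finiteness)]
      calc _ ≤ ‖(2 : ℂ) ^ m‖ₑ * ENNReal.ofReal ((1 / 2) ^ m) := by
            gcongr
            exact (hE.lintegral_le e he).trans (ENNReal.ofReal_le_ofReal (hlev e he).2)
        _ = 1 := by
            rw [← ofReal_norm, ← ENNReal.ofReal_mul (norm_nonneg _)]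
            simp)
  have hS : ∀ x, ‖superpos a η u E b x‖ₑ ^ 2 = ENNReal.ofReal ((1 / 4) ^ m) *
      ‖superpos a η u E (fun e y => (2 : ℂ) ^ m * b e y) x‖ₑ ^ 2 := by
    intro x
    rw [superpos_const_mul, enorm_mul, mul_pow, ← mul_assoc, ← ofReal_norm ((2 : ℂ) ^ m),
      ← ENNReal.ofReal_pow (norm_nonneg _), ← ENNReal.ofReal_mul (by positivity)]
    have : (1 / 4 : ℝ) ^ m * ‖(2 : ℂ) ^ m‖ ^ 2 = 1 := by
      rw [norm_pow, Complex.norm_ofNat, ← pow_mul, mul_comm m, pow_mul, ← mul_pow]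
      norm_num
    rw [this, ENNReal.ofReal_one, one_mul]
  simp_rw [hS]
  rw [lintegral_const_mul' _ _ (by finiteness)]
  have hX : ∑ e ∈ E, sqrtWt d e.1 ^ 2 ≤
      2 ^ ((m + 1 : ℝ) * q) * ∑ e ∈ E, sqrtWt d e.1 ^ 2 * γ e ^ q := by
    rw [Finset.mul_sum]
    refine Finset.sum_le_sum fun e he => ?_
    have h1 := hγq e he
    rw [Real.rpow_neg (by norm_num), inv_le_iff_one_le_mul₀ (by positivity)] at h1
    calc _ = sqrtWt d e.1 ^ 2 * 1 := (mul_one _).symm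
      _ ≤ sqrtWt d e.1 ^ 2 * (γ e ^ q * 2 ^ ((m + 1 : ℝ) * q)) := by gcongr
      _ = _ := by ring
  set X := ∑ e ∈ E, sqrtWt d e.1 ^ 2 * γ e ^ q
  have hX0 : 0 ≤ X := Finset.sum_nonneg fun e he =>
    mul_nonneg (sq_nonneg _) (Real.rpow_nonneg (hE.pos e he).le q)
  have hexp : (1 / 4 : ℝ) ^ m * (2 * ρ * 2 ^ ((m + 1 : ℝ) * q)) ≤ 8 * (2 ^ (κ - 2)) ^ m := by
    have h1 : (1 / 4 : ℝ) ^ m = 2 ^ (-2 * m : ℝ) := by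
      rw [Real.rpow_mul (by norm_num), Real.rpow_natCast]
      congr 1
      rw [Real.rpow_neg (by norm_num)]
      norm_num
    have h2 : ((2 : ℝ) ^ (κ - 2)) ^ m = 2 ^ ((κ - 2) * m) := by
      rw [Real.rpow_mul (by norm_num), Real.rpow_natCast]
    rw [h1, h2, hρ, mul_assoc (2 : ℝ), ← Real.rpow_add (by norm_num), mul_left_comm,
      ← Real.rpow_add (by norm_num)]
    have h3 : (8 : ℝ) = 2 * 2 ^ (2 : ℝ) := by norm_num
    rw [h3, mul_assoc (2 : ℝ) (2 ^ (2 : ℝ)), ← Real.rpow_add (by norm_num)]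
    have h4 : -2 * (m : ℝ) + ((m + 1) * (2 * q / (d - 1)) + (m + 1) * q) = κ + (κ - 2) * m := by
      rw [hκdef]
      ring
    rw [h4]
    exact mul_le_mul_of_nonneg_left
      (Real.rpow_le_rpow_of_exponent_le (by norm_num) (by linarith)) (by norm_num)
  calc _ ≤ ENNReal.ofReal ((1 / 4) ^ m) *
        (C * R * ∑ e ∈ E, ENNReal.ofReal (sqrtWt d e.1 ^ 2)) := mul_le_mul_right hmain _
    _ ≤ ENNReal.ofReal ((1 / 4) ^ m) * (C * ENNReal.ofReal (2 * ρ) *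
          ENNReal.ofReal (2 ^ ((m + 1 : ℝ) * q) * X)) := by
        rw [← ENNReal.ofReal_sum_of_nonneg fun e _ => sq_nonneg _]
        gcongr
        rw [← ENNReal.ofReal_natCast]
        exact ENNReal.ofReal_le_ofReal hRρ
    _ = C * ENNReal.ofReal ((1 / 4) ^ m * (2 * ρ * 2 ^ ((m + 1 : ℝ) * q)) * X) := by
        rw [mul_assoc (C : ℝ≥0∞), ← ENNReal.ofReal_mul (by positivity), mul_left_comm,
          ← ENNReal.ofReal_mul (by positivity)]
        congr 2
        ring
    _ ≤ C * ENNReal.ofReal (8 * (2 ^ (κ - 2)) ^ m * X) := by gcongr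
    _ = _ := by
        rw [mul_assoc (8 : ℝ), ENNReal.ofReal_mul (by norm_num), ← mul_assoc]
        simp

theorem IsDistFn.exists_lintegral_superpos_sq_le (ha : IsDistFn a) (hc : CurvNondeg a)
    (hη : IsBump η) (hd : 4 ≤ d) {q : ℝ} (hq : 1 ≤ q)
    (hq2 : q < 2 * ((d : ℝ) - 1) / ((d : ℝ) + 1)) :
    ∃ C : ℝ≥0, ∀ (u : ℝ) (E : Finset (ℕ × (Fin d → ℤ)))
      (b : ℕ × (Fin d → ℤ) → Rd d → ℂ) (γ : ℕ × (Fin d → ℤ) → ℝ), IsAtomFamily E b γ →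
      (∀ (k : ℕ) (β : ℕ × (Fin d → ℤ)), 1 ≤ β.1 →
        ∑ e ∈ E with boxIdx k e = β, γ e ^ q ≤ 2 ^ k) →
      ∫⁻ x, ‖superpos a η u E b x‖ₑ ^ 2 ≤
        C * ENNReal.ofReal (∑ e ∈ E, sqrtWt d e.1 ^ 2 * γ e ^ q) := by
  obtain ⟨C, hC⟩ := ha.exists_lintegral_superpos_level_le hc hη hd hq hq2
  have hκ := exponent_lt_two hd hq2
  set θ : ℝ := 2 ^ (q + 2 * q / ((d : ℝ) - 1) - 2) with hθ
  have hθ0 : 0 < θ := by positivity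
  have hθ1 : θ < 1 := Real.rpow_lt_one_of_one_lt_of_neg (by norm_num) (by linarith)
  refine ⟨((1 - θ)⁻¹).toNNReal * C, fun u E b γ hE hgood => ?_⟩
  have hγ1 : ∀ e ∈ E, γ e ≤ 1 := by
    intro e he
    have h1 := hgood 0 e (hE.one_le e he)
    have h2 : γ e ^ q ≤ ∑ e' ∈ E with boxIdx 0 e' = e, γ e' ^ q :=
      Finset.single_le_sum (f := fun e' => γ e' ^ q)
        (fun e' he' => Real.rpow_nonneg (hE.pos e' (Finset.mem_filter.1 he').1).le q)
        (Finset.mem_filter.2 ⟨he, boxIdx_zero e⟩)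
    by_contra! hlt
    have := Real.one_lt_rpow hlt (show 0 < q by linarith)
    rw [pow_zero] at h1
    linarith
  have hex : ∀ e, ∃ m : ℕ, e ∈ E → (1 / 2 : ℝ) ^ (m + 1) < γ e ∧ γ e ≤ (1 / 2) ^ m := by
    intro e
    by_cases he : e ∈ E
    · obtain ⟨m, hm⟩ := exists_nat_pow_near_of_lt_one (hE.pos e he) (hγ1 e he)
        (show (0 : ℝ) < 1 / 2 by norm_num) (by norm_num)
      exact ⟨m, fun _ => hm⟩
    · exact ⟨0, fun h => absurd h he⟩
  choose lev hlev using hex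
  obtain ⟨M, hM⟩ : ∃ M, ∀ e ∈ E, lev e ∈ Finset.range M :=
    ⟨E.sup lev + 1, fun e he => Finset.mem_range.2 (Nat.lt_succ_of_le (Finset.le_sup he))⟩
  set F : ℕ → Finset (ℕ × (Fin d → ℤ)) := fun m => E.filter fun e => lev e = m with hF
  have hFE : ∀ m, F m ⊆ E := fun m => Finset.filter_subset _ _
  have hsplit : ∀ x, superpos a η u E b x = ∑ m ∈ Finset.range M, superpos a η u (F m) b x :=
    fun x => (Finset.sum_fiberwise_of_maps_to hM _).symm
  set X : ℕ → ℝ := fun m => ∑ e ∈ F m, sqrtWt d e.1 ^ 2 * γ e ^ q with hX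
  have hX0 : ∀ m, 0 ≤ X m := fun m => Finset.sum_nonneg fun e he =>
    mul_nonneg (sq_nonneg _) (Real.rpow_nonneg (hE.pos e (hFE m he)).le q)
  have hlevel : ∀ m, ∫⁻ x, ‖superpos a η u (F m) b x‖ₑ ^ 2 ≤ C * ENNReal.ofReal (θ ^ m * X m) := by
    intro m
    refine hC u m (F m) b γ (hE.mono (hFE m)) (fun k β hβ => ?_) fun e he => ?_
    · refine (Finset.sum_le_sum_of_subset_of_nonneg
        (Finset.filter_subset_filter _ (hFE m)) fun e he _ => ?_).trans (hgood k β hβ)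
      exact Real.rpow_nonneg (hE.pos e (Finset.mem_filter.1 he).1).le q
    · obtain ⟨h1, h2⟩ := Finset.mem_filter.1 he
      rw [← h2]
      exact hlev e h1
  calc ∫⁻ x, ‖superpos a η u E b x‖ₑ ^ 2
      ≤ ∫⁻ x, ∑ m ∈ Finset.range M, ENNReal.ofReal ((1 - θ)⁻¹ * (θ ^ m)⁻¹) *
          ‖superpos a η u (F m) b x‖ₑ ^ 2 := by
        refine lintegral_mono fun x => ?_
        rw [hsplit]
        exact enorm_sum_range_sq_le hθ0 hθ1 M _
    _ = ∑ m ∈ Finset.range M, ENNReal.ofReal ((1 - θ)⁻¹ * (θ ^ m)⁻¹) *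
          ∫⁻ x, ‖superpos a η u (F m) b x‖ₑ ^ 2 := by
        rw [lintegral_finsetSum' _ fun m _ => ?_]
        · refine Finset.sum_congr rfl fun m _ => ?_
          rw [lintegral_const_mul' _ _ (by finiteness)]
        · exact ((aestronglyMeasurable_superpos ha hη u fun e he =>
            hE.integrable (hFE m he)).enorm.pow_const 2).const_mul _
    _ ≤ ∑ m ∈ Finset.range M, ENNReal.ofReal ((1 - θ)⁻¹ * (θ ^ m)⁻¹) *
          (C * ENNReal.ofReal (θ ^ m * X m)) := by
        gcongr with m
        exact hlevel m
    _ = ∑ m ∈ Finset.range M, C * ENNReal.ofReal ((1 - θ)⁻¹ * X m) := by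
        refine Finset.sum_congr rfl fun m _ => ?_
        have h1 : 0 < 1 - θ := by linarith
        rw [mul_left_comm, ← ENNReal.ofReal_mul (by positivity)]
        congr 2
        field_simp
    _ = C * ENNReal.ofReal ((1 - θ)⁻¹ * ∑ m ∈ Finset.range M, X m) := by
        have h1 : 0 < 1 - θ := by linarith
        rw [← Finset.mul_sum, ← ENNReal.ofReal_sum_of_nonneg fun m _ =>
          mul_nonneg (by positivity) (hX0 m), ← Finset.mul_sum]
    _ = _ := by
        have h1 : 0 < 1 - θ := by linarith
        rw [ENNReal.ofReal_mul (by positivity), hX, Finset.sum_fiberwise_of_maps_to hM,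
          ← mul_assoc, mul_comm (C : ℝ≥0∞)]
        simp [ENNReal.ofReal]

end GoodPart

section WeakType

variable {d : ℕ} {a : Rd d → ℝ} {η : ℝ → ℝ}

theorem boxIdx_add (k j : ℕ) (e : ℕ × (Fin d → ℤ)) : boxIdx (k + j) e = boxIdx j (boxIdx k e) := by
  simp only [boxIdx, Nat.div_div_eq_div_mul, pow_add]
  congr 1
  funext i
  rw [Int.ediv_ediv_of_nonneg (by positivity), Nat.cast_mul]

theorem boxIdx_eq_of_le {k k' : ℕ} (h : k ≤ k') {e e' : ℕ × (Fin d → ℤ)}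
    (he : boxIdx k e = boxIdx k e') : boxIdx k' e = boxIdx k' e' := by
  obtain ⟨j, rfl⟩ := Nat.exists_eq_add_of_le h
  rw [boxIdx_add, boxIdx_add, he]

theorem le_of_one_le_boxIdx {k : ℕ} {e : ℕ × (Fin d → ℤ)} (h : 1 ≤ (boxIdx k e).1) : k ≤ e.1 := by
  have h1 : 2 ^ k ≤ e.1 := (Nat.one_le_div_iff (by positivity)).1 h
  exact (Nat.lt_two_pow_self.le).trans h1

/-- A finite set of space-time lattice points splits into a part carrying at most mass `2 ^ k` in
every dyadic box of side `2 ^ k`, and a disjoint union of full boxes with mass larger than this. -/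
theorem exists_box_decomposition (E : Finset (ℕ × (Fin d → ℤ))) {w : ℕ × (Fin d → ℤ) → ℝ} :
    ∃ (G : Finset (ℕ × (Fin d → ℤ))) (I : Finset (ℕ × (ℕ × (Fin d → ℤ))))
      (F : ℕ × (ℕ × (Fin d → ℤ)) → Finset (ℕ × (Fin d → ℤ))),
      G ⊆ E ∧ (∀ (k : ℕ) (β : ℕ × (Fin d → ℤ)), 1 ≤ β.1 →
        ∀ e ∈ G, boxIdx k e = β → ∑ e ∈ E with boxIdx k e = β, w e ≤ 2 ^ k) ∧
      (∀ i ∈ I, F i ⊆ E ∧ 1 ≤ i.2.1 ∧ (∀ e ∈ F i, boxIdx i.1 e = i.2) ∧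
        2 ^ i.1 ≤ ∑ e ∈ F i, w e) ∧
      (∀ {M : Type} [AddCommMonoid M] (h : ℕ × (Fin d → ℤ) → M),
        ∑ e ∈ E, h e = ∑ e ∈ G, h e + ∑ i ∈ I, ∑ e ∈ F i, h e) := by
  set P : ℕ → ℕ × (Fin d → ℤ) → Prop := fun k β =>
    1 ≤ β.1 ∧ 2 ^ k < ∑ e ∈ E with boxIdx k e = β, w e with hP
  set bad : ℕ × (Fin d → ℤ) → Prop := fun e => ∃ k, P k (boxIdx k e) with hbad
  set kk : ℕ × (Fin d → ℤ) → ℕ := fun e => Nat.findGreatest (fun k => P k (boxIdx k e)) e.1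
  have hkk : ∀ e, bad e → P (kk e) (boxIdx (kk e) e) := fun e ⟨k, hk⟩ =>
    Nat.findGreatest_spec (P := fun k => P k (boxIdx k e)) (le_of_one_le_boxIdx hk.1) hk
  have hle : ∀ e k, P k (boxIdx k e) → k ≤ kk e := fun e k hk =>
    Nat.le_findGreatest (le_of_one_le_boxIdx hk.1) hk
  set ι : ℕ × (Fin d → ℤ) → ℕ × (ℕ × (Fin d → ℤ)) := fun e => (kk e, boxIdx (kk e) e) with hι
  refine ⟨E.filter fun e => ¬ bad e, (E.filter bad).image ι,
    fun i => (E.filter bad).filter fun e => ι e = i, Finset.filter_subset _ _, ?_, ?_, ?_⟩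
  · intro k β hβ e he heβ
    by_contra! hlt
    exact (Finset.mem_filter.1 he).2 ⟨k, by rw [heβ]; exact ⟨hβ, hlt⟩⟩
  · intro i hi
    obtain ⟨e, he, rfl⟩ := Finset.mem_image.1 hi
    obtain ⟨heE, heb⟩ := Finset.mem_filter.1 he
    have hPe := hkk e heb
    have hmem : ∀ e', boxIdx (kk e) e' = boxIdx (kk e) e → bad e' ∧ ι e' = ι e := by
      intro e' he'
      have hP' : P (kk e) (boxIdx (kk e) e') := by rw [he']; exact hPe
      have hb' : bad e' := ⟨_, hP'⟩
      have h1 := hle e' _ hP'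
      have h2 : kk e' ≤ kk e := hle e _ (by
        rw [← boxIdx_eq_of_le h1 he']
        exact hkk e' hb')
      have h3 : kk e' = kk e := le_antisymm h2 h1
      exact ⟨hb', by simp only [hι, h3, he']⟩
    refine ⟨(Finset.filter_subset _ _).trans (Finset.filter_subset _ _), hPe.1, ?_, ?_⟩
    · intro e' he'
      have h := (Finset.mem_filter.1 he').2
      simp only [hι, Prod.mk.injEq] at h
      change boxIdx (kk e) e' = boxIdx (kk e) e
      rw [← h.2, h.1]
    · refine hPe.2.le.trans (le_of_eq (Finset.sum_congr ?_ fun _ _ => rfl))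
      ext e'
      simp only [Finset.mem_filter]
      constructor
      · rintro ⟨h1, h2⟩
        exact ⟨⟨h1, (hmem e' h2).1⟩, (hmem e' h2).2⟩
      · rintro ⟨⟨h1, -⟩, h2⟩
        simp only [hι, Prod.mk.injEq] at h2
        exact ⟨h1, by rw [← h2.2, h2.1]⟩
  · intro M _ h
    rw [Finset.sum_fiberwise_of_maps_to fun e he => Finset.mem_image_of_mem _ he, add_comm,
      Finset.sum_filter_add_sum_filter_not]

theorem IsDistFn.exists_lintegral_superpos_le (ha : IsDistFn a) (hη : IsBump η) (hd : 1 ≤ d) :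
    ∃ C : ℝ≥0, ∀ (u : ℝ) (E : Finset (ℕ × (Fin d → ℤ)))
      (b : ℕ × (Fin d → ℤ) → Rd d → ℂ) (γ : ℕ × (Fin d → ℤ) → ℝ), 0 ≤ u → u < 1 →
      IsAtomFamily E b γ →
      ∫⁻ x, ‖superpos a η u E b x‖ₑ ≤ C * ENNReal.ofReal (∑ e ∈ E, sqrtWt d e.1 ^ 2 * γ e) := by
  obtain ⟨r, hr1, hr⟩ := ha.exists_shell_support
  have hg : ContDiff ℝ (⊤ : ℕ∞) fun ξ => (η (a ξ) : ℂ) :=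
    Complex.ofRealCLM.contDiff.comp (ha.contDiff_bump_comp hη.smooth hη.supp)
  have hgs : ∀ ζ ∉ shell d r, (η (a ζ) : ℂ) = 0 := fun ζ hζ => by
    simp [hη.eq_zero_of_notMem hr hζ]
  obtain ⟨C, hC⟩ := ha.exists_lintegral_oscKer_le hd hg hr1 hgs
  refine ⟨C * (√2 ^ (d - 1)).toNNReal, fun u E b γ hu0 hu1 hE => ?_⟩
  have hterm : ∀ e ∈ E, ∫⁻ x, ‖(sqrtWt d e.1 : ℂ) * conv (Kker a η (e.1 + u)) (b e) x‖ₑ ≤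
      C * ENNReal.ofReal (√2 ^ (d - 1) * (sqrtWt d e.1 ^ 2 * γ e)) := by
    intro e he
    have habs : |(e.1 + u : ℝ)| = e.1 + u := abs_of_nonneg (by positivity)
    have hK : Kker a η (e.1 + u) = oscKer (fun ξ => (η (a ξ) : ℂ)) a (e.1 + u) :=
      Kker_eq_oscKer a η _
    have h3 := lintegral_compl_conv_le (ha.continuous_Kker hη (e.1 + u)).measurable
      (hE.measurable e he) (hE.support e he) MeasurableSet.univ
      (X := C * ENNReal.ofReal (√(1 + |(e.1 + u : ℝ)|) ^ (d - 1))) (by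
        intro y _
        simp only [mem_univ, ofPred_true, Measure.restrict_univ, hK]
        exact hC _)
    rw [Measure.restrict_univ] at h3
    simp_rw [enorm_mul, enorm_sqrtWt]
    rw [lintegral_const_mul' _ _ (by finiteness)]
    have hw := sqrtWt_pos d e.1
    calc _ ≤ ENNReal.ofReal (sqrtWt d e.1) * (C * ENNReal.ofReal
          (√(1 + |(e.1 + u : ℝ)|) ^ (d - 1)) * ENNReal.ofReal (γ e)) := by
          gcongr
          exact h3.trans (mul_le_mul_right (hE.lintegral_le e he) _)
      _ ≤ ENNReal.ofReal (sqrtWt d e.1) * (C * ENNReal.ofReal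
          (√2 ^ (d - 1) * sqrtWt d e.1) * ENNReal.ofReal (γ e)) := by
          gcongr
          rw [sqrtWt, ← mul_pow, ← Real.sqrt_mul (by norm_num), habs]
          gcongr
          have := Nat.cast_nonneg (α := ℝ) e.1
          linarith
      _ = _ := by
          have hγ := hE.pos e he
          rw [mul_assoc (C : ℝ≥0∞), ← ENNReal.ofReal_mul (by positivity), mul_left_comm,
            ← ENNReal.ofReal_mul (by positivity)]
          congr 2
          ring
  calc _ ≤ ∑ e ∈ E, ∫⁻ x, ‖(sqrtWt d e.1 : ℂ) * conv (Kker a η (e.1 + u)) (b e) x‖ₑ := by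
        rw [← lintegral_finsetSum' _ fun e he => ?_]
        · exact lintegral_mono fun x => enorm_sum_le _ _
        · exact ((ha.integrable_conv hη _ (hE.integrable he)).const_mul _).1.enorm
    _ ≤ ∑ e ∈ E, C * ENNReal.ofReal (√2 ^ (d - 1) * (sqrtWt d e.1 ^ 2 * γ e)) :=
        Finset.sum_le_sum hterm
    _ = C * ENNReal.ofReal (√2 ^ (d - 1) * ∑ e ∈ E, sqrtWt d e.1 ^ 2 * γ e) := by
        rw [← Finset.mul_sum, ← ENNReal.ofReal_sum_of_nonneg fun e he => by
          have := hE.pos e he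
          positivity, ← Finset.mul_sum]
    _ = _ := by
        rw [ENNReal.ofReal_mul (by positivity), ENNReal.ofReal, ENNReal.coe_mul, mul_assoc]

theorem one_le_two_mul_or {s g h : ℝ≥0∞} (hs : 1 < s) (hgh : s ≤ g + h) :
    1 ≤ (2 * g) ^ 2 ∨ 1 ≤ 2 * h := by
  by_contra! hcon
  have h1 : 2 * g < 1 := by
    by_contra! h1
    exact hcon.1.not_ge (one_le_pow₀ h1)
  have h2 := ENNReal.add_lt_add h1 hcon.2
  rw [← mul_add, one_add_one_eq_two] at h2
  refine h2.not_ge ?_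
  calc (2 : ℝ≥0∞) = 2 * 1 := (mul_one _).symm
    _ ≤ _ := by gcongr; exact hs.le.trans hgh

theorem IsDistFn.exists_volume_superpos_le (ha : IsDistFn a) (hc : CurvNondeg a)
    (hη : IsBump η) (hd : 4 ≤ d) {q : ℝ} (hq : 1 ≤ q)
    (hq2 : q < 2 * ((d : ℝ) - 1) / ((d : ℝ) + 1)) :
    ∃ C : ℝ≥0, ∀ (u : ℝ) (E : Finset (ℕ × (Fin d → ℤ)))
      (b : ℕ × (Fin d → ℤ) → Rd d → ℂ) (γ : ℕ × (Fin d → ℤ) → ℝ), 0 ≤ u → u < 1 →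
      IsAtomFamily E b γ →
      volume {x | 1 < ‖superpos a η u E b x‖ₑ} ≤
        C * ENNReal.ofReal (∑ e ∈ E, sqrtWt d e.1 ^ 2 * γ e ^ q) := by
  obtain ⟨C₁, hC₁⟩ := ha.exists_lintegral_superpos_sq_le hc hη hd hq hq2
  obtain ⟨C₂, hC₂⟩ := ha.exists_exceptional_set hη (by omega) hq
  refine ⟨4 * C₁ + 3 * C₂, fun u E b γ hu0 hu1 hE => ?_⟩
  obtain ⟨G, I, F, hGE, hG, hI, hsum⟩ := exists_box_decomposition E (w := fun e => γ e ^ q)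
  have hterm0 : ∀ e ∈ E, 0 ≤ sqrtWt d e.1 ^ 2 * γ e ^ q := fun e he =>
    mul_nonneg (sq_nonneg _) (Real.rpow_nonneg (hE.pos e he).le q)
  have hex : ∀ i, ∃ Ω : Set (Rd d), i ∈ I → MeasurableSet Ω ∧
      volume Ω ≤ C₂ * ENNReal.ofReal (∑ e ∈ F i, sqrtWt d e.1 ^ 2 * γ e ^ q) ∧
      ∫⁻ x in Ωᶜ, ‖superpos a η u (F i) b x‖ₑ ≤
        C₂ * ENNReal.ofReal (∑ e ∈ F i, sqrtWt d e.1 ^ 2 * γ e ^ q) := by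
    intro i
    by_cases hi : i ∈ I
    · obtain ⟨h1, h2, h3, h4⟩ := hI i hi
      obtain ⟨Ω, hΩ⟩ := hC₂ u i.1 i.2 (F i) b γ hu0 hu1 (hE.mono h1) h2 h3 h4
      exact ⟨Ω, fun _ => hΩ⟩
    · exact ⟨∅, fun h => absurd h hi⟩
  choose Ω hΩ using hex
  set U := ⋃ i ∈ I, Ω i with hU
  have hUm : MeasurableSet U := Finset.measurableSet_biUnion _ fun i hi => (hΩ i hi).1
  set X := ∑ e ∈ E, sqrtWt d e.1 ^ 2 * γ e ^ q with hX
  have hXsplit := hsum fun e => sqrtWt d e.1 ^ 2 * γ e ^ q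
  have hXF : ∑ i ∈ I, C₂ * ENNReal.ofReal (∑ e ∈ F i, sqrtWt d e.1 ^ 2 * γ e ^ q) ≤
      C₂ * ENNReal.ofReal X := by
    rw [← Finset.mul_sum, ← ENNReal.ofReal_sum_of_nonneg fun i hi =>
      Finset.sum_nonneg fun e he => hterm0 e ((hI i hi).1 he)]
    gcongr
    rw [hX, hXsplit]
    exact le_add_of_nonneg_left (Finset.sum_nonneg fun e he => hterm0 e (hGE he))
  have hXG : ∑ e ∈ G, sqrtWt d e.1 ^ 2 * γ e ^ q ≤ X :=
    Finset.sum_le_sum_of_subset_of_nonneg hGE fun e he _ => hterm0 e he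
  have hgood := hC₁ u G b γ (hE.mono hGE) fun k β hβ => by
    rcases (G.filter fun e => boxIdx k e = β).eq_empty_or_nonempty with h | ⟨e, he⟩
    · rw [h, Finset.sum_empty]
      positivity
    · obtain ⟨h1, h2⟩ := Finset.mem_filter.1 he
      refine (Finset.sum_le_sum_of_subset_of_nonneg
        (Finset.filter_subset_filter _ hGE) fun e he _ => ?_).trans (hG k β hβ e h1 h2)
      exact Real.rpow_nonneg (hE.pos e (Finset.mem_filter.1 he).1).le q
  have hFm : ∀ i ∈ I, AEStronglyMeasurable (superpos a η u (F i) b) volume := fun i hi =>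
    aestronglyMeasurable_superpos ha hη u fun e he => hE.integrable ((hI i hi).1 he)
  have hGm : AEStronglyMeasurable (superpos a η u G b) volume :=
    aestronglyMeasurable_superpos ha hη u fun e he => hE.integrable (hGE he)
  have hbad : ∫⁻ x in Uᶜ, ∑ i ∈ I, ‖superpos a η u (F i) b x‖ₑ ≤ C₂ * ENNReal.ofReal X := by
    rw [lintegral_finsetSum' _ fun i hi => (hFm i hi).enorm.restrict]
    refine (Finset.sum_le_sum fun i hi => ?_).trans hXF
    refine le_trans (lintegral_mono_set (compl_subset_compl.2 ?_)) (hΩ i hi).2.2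
    exact subset_biUnion_of_mem (u := Ω) hi
  have hsub : {x | 1 < ‖superpos a η u E b x‖ₑ} ⊆ U ∪
      ({x | 1 ≤ (2 * ‖superpos a η u G b x‖ₑ) ^ 2} ∪
        ({x | 1 ≤ 2 * ∑ i ∈ I, ‖superpos a η u (F i) b x‖ₑ} ∩ Uᶜ)) := by
    intro x hx
    by_cases hxU : x ∈ U
    · exact Or.inl hxU
    · rcases one_le_two_mul_or hx (h := ∑ i ∈ I, ‖superpos a η u (F i) b x‖ₑ)
        (g := ‖superpos a η u G b x‖ₑ) (by
          rw [show superpos a η u E b x = superpos a η u G b x +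
            ∑ i ∈ I, superpos a η u (F i) b x from hsum _]
          exact (enorm_add_le _ _).trans (add_le_add le_rfl (enorm_sum_le _ _))) with h | h
      · exact Or.inr (Or.inl h)
      · exact Or.inr (Or.inr ⟨h, hxU⟩)
  have h1 : volume U ≤ C₂ * ENNReal.ofReal X :=
    (measure_biUnion_finset_le _ _).trans ((Finset.sum_le_sum fun i hi => (hΩ i hi).2.1).trans hXF)
  have h2 : volume {x | 1 ≤ (2 * ‖superpos a η u G b x‖ₑ) ^ 2} ≤ 4 * (C₁ * ENNReal.ofReal X) := by
    have h := mul_meas_ge_le_lintegral₀ (μ := volume) ((hGm.enorm.const_mul 2).pow_const 2) 1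
    rw [one_mul] at h
    refine h.trans ?_
    simp_rw [mul_pow]
    rw [lintegral_const_mul' _ _ (by finiteness)]
    refine (mul_le_mul_right (hgood.trans (mul_le_mul_right (ENNReal.ofReal_le_ofReal hXG) _))
      _).trans (le_of_eq ?_)
    norm_num
  have h3 : volume ({x | 1 ≤ 2 * ∑ i ∈ I, ‖superpos a η u (F i) b x‖ₑ} ∩ Uᶜ) ≤
      2 * (C₂ * ENNReal.ofReal X) := by
    have h := mul_meas_ge_le_lintegral₀ (μ := volume.restrict Uᶜ)
      (f := fun x => 2 * ∑ i ∈ I, ‖superpos a η u (F i) b x‖ₑ)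
      ((Finset.aemeasurable_fun_sum _ fun i hi => (hFm i hi).enorm.restrict).const_mul 2) 1
    rw [one_mul, Measure.restrict_apply' hUm.compl] at h
    refine h.trans ?_
    rw [lintegral_const_mul' _ _ (by finiteness)]
    gcongr
  calc _ ≤ C₂ * ENNReal.ofReal X + (4 * (C₁ * ENNReal.ofReal X) + 2 * (C₂ * ENNReal.ofReal X)) :=
        (measure_mono hsub).trans ((measure_union_le _ _).trans
          (add_le_add h1 ((measure_union_le _ _).trans (add_le_add h2 h3))))
    _ = _ := by
        push_cast
        ring

end WeakType

section Interpolation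

variable {d : ℕ} {a : Rd d → ℝ} {η : ℝ → ℝ}

theorem lintegral_min_mul_rpow_le {p q γ : ℝ} (hp : 1 < p) (hpq : p < q) (hγ : 0 < γ) :
    ∫⁻ t in Ioi (0 : ℝ), ENNReal.ofReal ((if t ≤ γ then γ / t else (γ / t) ^ q) * t ^ (p - 1)) ≤
      ENNReal.ofReal (((p - 1)⁻¹ + (q - p)⁻¹) * γ ^ p) := by
  have h1 : ∫⁻ t in Ioc (0 : ℝ) γ,
      ENNReal.ofReal ((if t ≤ γ then γ / t else (γ / t) ^ q) * t ^ (p - 1)) =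
      ENNReal.ofReal ((p - 1)⁻¹ * γ ^ p) := by
    have hint : IntegrableOn (fun t : ℝ => γ * t ^ (p - 2)) (Ioc 0 γ) :=
      ((intervalIntegrable_iff_integrableOn_Ioc_of_le hγ.le).1
        (intervalIntegral.intervalIntegrable_rpow' (by linarith))).const_mul γ
    have hval : ∫ t in Ioc (0 : ℝ) γ, γ * t ^ (p - 2) = (p - 1)⁻¹ * γ ^ p := by
      rw [integral_const_mul, ← intervalIntegral.integral_of_le hγ.le,
        integral_rpow (Or.inl (by linarith)), Real.zero_rpow (by linarith),
        show p - 2 + 1 = p - 1 by ring, Real.rpow_sub_one hγ.ne']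
      field_simp
      ring
    rw [← hval, ofReal_integral_eq_lintegral_ofReal hint]
    · refine setLIntegral_congr_fun measurableSet_Ioc fun t ht => ?_
      rw [if_pos ht.2, show p - 1 = p - 2 + 1 by ring, Real.rpow_add_one ht.1.ne']
      congr 1
      field_simp [ht.1.ne']
    · refine (ae_restrict_mem measurableSet_Ioc).mono fun t ht => ?_
      exact mul_nonneg hγ.le (Real.rpow_nonneg ht.1.le _)
  have h2 : ∫⁻ t in Ioi γ,
      ENNReal.ofReal ((if t ≤ γ then γ / t else (γ / t) ^ q) * t ^ (p - 1)) =
      ENNReal.ofReal ((q - p)⁻¹ * γ ^ p) := by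
    have hint : IntegrableOn (fun t : ℝ => γ ^ q * t ^ (p - 1 - q)) (Ioi γ) :=
      (integrableOn_Ioi_rpow_of_lt (by linarith) hγ).const_mul _
    have hval : ∫ t in Ioi γ, γ ^ q * t ^ (p - 1 - q) = (q - p)⁻¹ * γ ^ p := by
      rw [integral_const_mul, integral_Ioi_rpow_of_lt (by linarith) hγ,
        show p - 1 - q + 1 = p - q by ring, mul_div_assoc', mul_neg, ← Real.rpow_add hγ,
        show q + (p - q) = p by ring, neg_div, ← div_neg, neg_sub, div_eq_inv_mul]
    rw [← hval, ofReal_integral_eq_lintegral_ofReal hint]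
    · refine setLIntegral_congr_fun measurableSet_Ioi fun t ht => ?_
      have ht0 : 0 < t := hγ.trans ht
      rw [if_neg (not_le.2 ht), Real.div_rpow hγ.le ht0.le, Real.rpow_sub ht0 (p - 1) q]
      congr 1
      ring
    · refine (ae_restrict_mem measurableSet_Ioi).mono fun t ht => ?_
      have ht0 : 0 < t := hγ.trans ht
      exact mul_nonneg (by positivity) (by positivity)
  have hp' : 0 < p - 1 := by linarith
  have hq' : 0 < q - p := by linarith
  rw [← Ioc_union_Ioi_eq_Ioi hγ.le, add_mul, ENNReal.ofReal_add (by positivity) (by positivity)]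
  exact (lintegral_union_le _ _ _).trans (add_le_add h1.le h2.le)

theorem IsAtomFamily.const_mul {E : Finset (ℕ × (Fin d → ℤ))} {b : ℕ × (Fin d → ℤ) → Rd d → ℂ}
    {γ : ℕ × (Fin d → ℤ) → ℝ} (h : IsAtomFamily E b γ) {t : ℝ} (ht : 0 < t) :
    IsAtomFamily E (fun e y => (t : ℂ) * b e y) (fun e => t * γ e) where
  measurable e he := (h.measurable e he).const_mul _
  support e he y hy := by simp [h.support e he y hy]
  lintegral_le e he := by
    simp_rw [enorm_mul]
    rw [lintegral_const_mul' _ _ (by finiteness), ← ofReal_norm, Complex.norm_real,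
      Real.norm_of_nonneg ht.le, ENNReal.ofReal_mul ht.le]
    exact mul_le_mul_right (h.lintegral_le e he) _
  pos e he := mul_pos ht (h.pos e he)
  one_le := h.one_le

theorem IsDistFn.exists_volume_two_lt_superpos_le (ha : IsDistFn a) (hc : CurvNondeg a)
    (hη : IsBump η) (hd : 4 ≤ d) {q : ℝ} (hq : 1 ≤ q)
    (hq2 : q < 2 * ((d : ℝ) - 1) / ((d : ℝ) + 1)) :
    ∃ C : ℝ≥0, ∀ (u : ℝ) (E : Finset (ℕ × (Fin d → ℤ)))
      (b : ℕ × (Fin d → ℤ) → Rd d → ℂ) (γ : ℕ × (Fin d → ℤ) → ℝ), 0 ≤ u → u < 1 →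
      IsAtomFamily E b γ →
      volume {x | 2 < ‖superpos a η u E b x‖ₑ} ≤ C * ENNReal.ofReal
        (∑ e ∈ E, sqrtWt d e.1 ^ 2 * if 1 ≤ γ e then γ e else γ e ^ q) := by
  obtain ⟨C₁, hC₁⟩ := ha.exists_lintegral_superpos_le hη (by omega)
  obtain ⟨C₂, hC₂⟩ := ha.exists_volume_superpos_le hc hη hd hq hq2
  refine ⟨C₁ + C₂, fun u E b γ hu0 hu1 hE => ?_⟩
  set F := E.filter fun e => 1 ≤ γ e
  set G := E.filter fun e => ¬ 1 ≤ γ e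
  have hF : F ⊆ E := Finset.filter_subset _ _
  have hG : G ⊆ E := Finset.filter_subset _ _
  have hterm : ∀ e ∈ E, 0 ≤ sqrtWt d e.1 ^ 2 * if 1 ≤ γ e then γ e else γ e ^ q := by
    intro e he
    have := hE.pos e he
    split_ifs <;> positivity
  have hFs : ∑ e ∈ F, sqrtWt d e.1 ^ 2 * γ e ≤
      ∑ e ∈ E, sqrtWt d e.1 ^ 2 * if 1 ≤ γ e then γ e else γ e ^ q := by
    refine le_trans (le_of_eq (Finset.sum_congr rfl fun e he => ?_))
      (Finset.sum_le_sum_of_subset_of_nonneg hF fun e he _ => hterm e he)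
    rw [if_pos (Finset.mem_filter.1 he).2]
  have hGs : ∑ e ∈ G, sqrtWt d e.1 ^ 2 * γ e ^ q ≤
      ∑ e ∈ E, sqrtWt d e.1 ^ 2 * if 1 ≤ γ e then γ e else γ e ^ q := by
    refine le_trans (le_of_eq (Finset.sum_congr rfl fun e he => ?_))
      (Finset.sum_le_sum_of_subset_of_nonneg hG fun e he _ => hterm e he)
    rw [if_neg (Finset.mem_filter.1 he).2]
  have hsub : {x | 2 < ‖superpos a η u E b x‖ₑ} ⊆
      {x | 1 ≤ ‖superpos a η u F b x‖ₑ} ∪ {x | 1 < ‖superpos a η u G b x‖ₑ} := by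
    intro x hx
    by_contra hcon
    simp only [mem_union, mem_ofPred_eq, not_or, not_le, not_lt] at hcon
    refine (not_le.2 (show 2 < ‖superpos a η u E b x‖ₑ from hx)) ?_
    rw [show superpos a η u E b x = superpos a η u F b x + superpos a η u G b x from
      (Finset.sum_filter_add_sum_filter_not _ _ _).symm, ← one_add_one_eq_two]
    exact (enorm_add_le _ _).trans (add_le_add hcon.1.le hcon.2)
  have h1 : volume {x | 1 ≤ ‖superpos a η u F b x‖ₑ} ≤ ∫⁻ x, ‖superpos a η u F b x‖ₑ := by
    have h := mul_meas_ge_le_lintegral₀ (μ := volume)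
      (aestronglyMeasurable_superpos ha hη u fun e he => hE.integrable (hF he)).enorm 1
    rwa [one_mul] at h
  push_cast
  rw [add_mul]
  refine (measure_mono hsub).trans ((measure_union_le _ _).trans (add_le_add ?_ ?_))
  · exact h1.trans ((hC₁ u F b γ hu0 hu1 (hE.mono hF)).trans
      (mul_le_mul_right (ENNReal.ofReal_le_ofReal hFs) _))
  · exact (hC₂ u G b γ hu0 hu1 (hE.mono hG)).trans
      (mul_le_mul_right (ENNReal.ofReal_le_ofReal hGs) _)

theorem IsDistFn.exists_lintegral_superpos_rpow_le (ha : IsDistFn a) (hc : CurvNondeg a)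
    (hη : IsBump η) (hd : 4 ≤ d) {p : ℝ} (hp : 1 ≤ p)
    (hp2 : p < 2 * ((d : ℝ) - 1) / ((d : ℝ) + 1)) :
    ∃ C : ℝ≥0, ∀ (u : ℝ) (E : Finset (ℕ × (Fin d → ℤ)))
      (b : ℕ × (Fin d → ℤ) → Rd d → ℂ) (γ : ℕ × (Fin d → ℤ) → ℝ), 0 ≤ u → u < 1 →
      IsAtomFamily E b γ →
      ∫⁻ x, ENNReal.ofReal (‖superpos a η u E b x‖ ^ p) ≤
        C * ENNReal.ofReal (∑ e ∈ E, sqrtWt d e.1 ^ 2 * γ e ^ p) := by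
  rcases hp.eq_or_lt with rfl | hp1
  · obtain ⟨C, hC⟩ := ha.exists_lintegral_superpos_le hη (by omega)
    refine ⟨C, fun u E b γ hu0 hu1 hE => ?_⟩
    simpa only [Real.rpow_one, ofReal_norm] using hC u E b γ hu0 hu1 hE
  obtain ⟨q, hpq, hq2⟩ := exists_between hp2
  obtain ⟨C, hC⟩ := ha.exists_volume_two_lt_superpos_le hc hη hd (by linarith) hq2
  set A : ℝ := 2 ^ p * p * ((p - 1)⁻¹ + (q - p)⁻¹) with hA
  refine ⟨C * A.toNNReal, fun u E b γ hu0 hu1 hE => ?_⟩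
  have hp' : 0 < p - 1 := by linarith
  have hq' : 0 < q - p := by linarith
  set S := superpos a η u E b with hS
  have hSm : AEStronglyMeasurable S volume :=
    aestronglyMeasurable_superpos ha hη u fun e he => hE.integrable he
  have hlevel : ∀ t ∈ Ioi (0 : ℝ), volume {x | t < ‖S x‖ / 2} * ENNReal.ofReal (t ^ (p - 1)) ≤
      C * ∑ e ∈ E, ENNReal.ofReal (sqrtWt d e.1 ^ 2) *
        ENNReal.ofReal ((if t ≤ γ e then γ e / t else (γ e / t) ^ q) * t ^ (p - 1)) := by
    intro t ht
    have ht0 : 0 < t := ht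
    have h := hC u E _ _ hu0 hu1 (hE.const_mul (inv_pos.2 ht0))
    have hset : {x | t < ‖S x‖ / 2} =
        {x | 2 < ‖superpos a η u E (fun e y => ((t⁻¹ : ℝ) : ℂ) * b e y) x‖ₑ} := by
      ext x
      simp only [mem_ofPred_eq]
      rw [superpos_const_mul, ← ofReal_norm, norm_mul, Complex.norm_real,
        Real.norm_of_nonneg (inv_pos.2 ht0).le, ← ENNReal.ofReal_ofNat 2,
        ENNReal.ofReal_lt_ofReal_iff_of_nonneg (by norm_num), inv_mul_eq_div,
        lt_div_iff₀ ht0, lt_div_iff₀ (by norm_num), mul_comm]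
    rw [hset]
    calc _ ≤ _ := mul_le_mul_left h _
      _ = C * ENNReal.ofReal (∑ e ∈ E, sqrtWt d e.1 ^ 2 *
          ((if t ≤ γ e then γ e / t else (γ e / t) ^ q) * t ^ (p - 1))) := by
          rw [mul_assoc, ← ENNReal.ofReal_mul' (by positivity), Finset.sum_mul]
          congr 3
          funext e
          simp only [mul_assoc, inv_mul_eq_div, one_le_div ht0]
      _ = _ := by
          rw [ENNReal.ofReal_sum_of_nonneg fun e he => ?_]
          · simp only [ENNReal.ofReal_mul (sq_nonneg (sqrtWt d _))]
          · have := hE.pos e he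
            split_ifs <;> positivity
  have hscale : ∀ x, ENNReal.ofReal (‖S x‖ ^ p) =
      ENNReal.ofReal (2 ^ p) * ENNReal.ofReal ((‖S x‖ / 2) ^ p) := fun x => by
    rw [← ENNReal.ofReal_mul (by positivity), ← Real.mul_rpow (by norm_num) (by positivity),
      mul_div_cancel₀ _ (two_ne_zero)]
  simp_rw [hscale]
  rw [lintegral_const_mul' _ _ (by finiteness),
    lintegral_rpow_eq_lintegral_meas_lt_mul volume (Filter.Eventually.of_forall fun x => by
      positivity) (hSm.norm.aemeasurable.div_const 2) (by linarith)]
  have hmeas : ∀ e ∈ E, Measurable fun t : ℝ => ENNReal.ofReal (sqrtWt d e.1 ^ 2) *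
      ENNReal.ofReal ((if t ≤ γ e then γ e / t else (γ e / t) ^ q) * t ^ (p - 1)) := by
    intro e _
    refine ((Measurable.mul ?_ (by fun_prop)).ennreal_ofReal).const_mul _
    exact Measurable.ite measurableSet_Iic (by fun_prop) (by fun_prop)
  calc _ ≤ ENNReal.ofReal (2 ^ p) * (ENNReal.ofReal p * (C * ∑ e ∈ E,
        ENNReal.ofReal (sqrtWt d e.1 ^ 2) *
          ENNReal.ofReal (((p - 1)⁻¹ + (q - p)⁻¹) * γ e ^ p))) := by
        gcongr
        refine (setLIntegral_mono' measurableSet_Ioi hlevel).trans ?_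
        rw [lintegral_const_mul' _ _ (by finiteness), lintegral_finsetSum _ hmeas]
        refine mul_le_mul_right (Finset.sum_le_sum fun e he => ?_) _
        rw [lintegral_const_mul' _ _ (by finiteness)]
        exact mul_le_mul_right (lintegral_min_mul_rpow_le hp1 hpq (hE.pos e he)) _
    _ = C * ENNReal.ofReal (A * ∑ e ∈ E, sqrtWt d e.1 ^ 2 * γ e ^ p) := by
        have h1 : ∀ e ∈ E, ENNReal.ofReal (sqrtWt d e.1 ^ 2) *
            ENNReal.ofReal (((p - 1)⁻¹ + (q - p)⁻¹) * γ e ^ p) =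
            ENNReal.ofReal (((p - 1)⁻¹ + (q - p)⁻¹) * (sqrtWt d e.1 ^ 2 * γ e ^ p)) :=
          fun e he => by
            rw [← ENNReal.ofReal_mul (sq_nonneg _)]
            congr 1
            ring
        rw [Finset.sum_congr rfl h1, ← ENNReal.ofReal_sum_of_nonneg fun e he => by
          have := hE.pos e he
          positivity, ← Finset.mul_sum, mul_left_comm _ (C : ℝ≥0∞), mul_left_comm _ (C : ℝ≥0∞),
          ← ENNReal.ofReal_mul (by linarith), ← ENNReal.ofReal_mul (by positivity), hA]
        congr 2
        ring
    _ = _ := by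
        rw [ENNReal.ofReal_mul (by positivity), ENNReal.coe_mul, mul_assoc, ENNReal.ofReal]

end Interpolation

section Reduction

variable {d : ℕ} {a : Rd d → ℝ} {η : ℝ → ℝ}

theorem eLpNorm_rpow_eq {α : Type*} [MeasurableSpace α] {p : ℝ} (hp : 1 ≤ p) (g : α → ℂ)
    (μ : Measure α) :
    eLpNorm g (ENNReal.ofReal p) μ ^ p = ∫⁻ x, ENNReal.ofReal (‖g x‖ ^ p) ∂μ := by
  have hp0 : 0 < p := by linarith
  rw [eLpNorm_eq_lintegral_rpow_enorm_toReal (by simpa using hp0) ENNReal.ofReal_ne_top,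
    ENNReal.toReal_ofReal hp0.le, ← ENNReal.rpow_mul, one_div, inv_mul_cancel₀ hp0.ne',
    ENNReal.rpow_one]
  refine lintegral_congr fun x => ?_
  rw [← ofReal_norm, ENNReal.ofReal_rpow_of_nonneg (norm_nonneg _) hp0.le]

theorem lintegral_qcube_rpow_le {p : ℝ} (hp : 1 ≤ p) {f : Rd d → ℂ} (hf : Measurable f)
    (z : Fin d → ℤ) :
    (∫⁻ y in qcube d z, ‖f y‖ₑ) ^ p ≤ ∫⁻ y in qcube d z, ENNReal.ofReal (‖f y‖ ^ p) := by
  have : IsProbabilityMeasure ((volume : Measure (Rd d)).restrict (qcube d z)) :=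
    ⟨by rw [Measure.restrict_apply_univ, volume_qcube]⟩
  rw [← eLpNorm_rpow_eq hp, ← eLpNorm_one_eq_lintegral_enorm]
  exact ENNReal.rpow_le_rpow (eLpNorm_le_eLpNorm_of_exponent_le
    (by rw [← ENNReal.ofReal_one]; exact ENNReal.ofReal_le_ofReal hp) hf.aestronglyMeasurable)
    (by linarith)

/-- The union of the unit cubes with lower corner in `Z`. -/
def cubeUnion (Z : Finset (Fin d → ℤ)) : Set (Rd d) := ⋃ z ∈ Z, qcube d z

theorem mem_qcube_iff {z : Fin d → ℤ} {y : Rd d} : y ∈ qcube d z ↔ (fun i => ⌊y i⌋) = z := by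
  simp only [qcube, mem_ofPred_eq, funext_iff, Int.floor_eq_iff]

theorem pairwiseDisjoint_qcube (s : Set (Fin d → ℤ)) : s.PairwiseDisjoint (qcube d) :=
  fun _ _ _ _ hne => Set.disjoint_left.2 fun _ h h' =>
    hne ((mem_qcube_iff.1 h).symm.trans (mem_qcube_iff.1 h'))

theorem measurableSet_cubeUnion (Z : Finset (Fin d → ℤ)) : MeasurableSet (cubeUnion Z) :=
  Finset.measurableSet_biUnion _ fun z _ => measurableSet_qcube z

theorem sum_indicator_qcube (Z : Finset (Fin d → ℤ)) (f : Rd d → ℂ) (y : Rd d) :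
    ∑ z ∈ Z, (qcube d z).indicator f y = (cubeUnion Z).indicator f y := by
  rw [cubeUnion, Finset.indicator_biUnion _ _ (pairwiseDisjoint_qcube _)]

theorem sum_lintegral_qcube_le (Z : Finset (Fin d → ℤ)) (G : Rd d → ℝ≥0∞) :
    ∑ z ∈ Z, ∫⁻ y in qcube d z, G y ≤ ∫⁻ y, G y := by
  rw [← lintegral_biUnion_finset (pairwiseDisjoint_qcube _) fun z _ => measurableSet_qcube z]
  exact setLIntegral_le_lintegral _ _

theorem lintegral_rpow_le_of_tendsto {α : Type*} [MeasurableSpace α] {μ : Measure α} {p : ℝ}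
    (hp : 1 ≤ p) {F : ℕ → α → ℂ} {G : α → ℂ} {B : ℝ≥0∞}
    (hF : ∀ k, AEStronglyMeasurable (F k) μ)
    (hG : ∀ x, Filter.Tendsto (fun k => F k x) Filter.atTop (nhds (G x)) ∨ G x = 0)
    (hB : ∀ k, ∫⁻ x, ENNReal.ofReal (‖F k x‖ ^ p) ∂μ ≤ B) :
    ∫⁻ x, ENNReal.ofReal (‖G x‖ ^ p) ∂μ ≤ B := by
  have hp0 : 0 < p := by linarith
  calc ∫⁻ x, ENNReal.ofReal (‖G x‖ ^ p) ∂μ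
      ≤ ∫⁻ x, Filter.liminf (fun k => ENNReal.ofReal (‖F k x‖ ^ p)) Filter.atTop ∂μ := by
        refine lintegral_mono fun x => ?_
        rcases hG x with h | h
        · exact ((ENNReal.tendsto_ofReal (h.norm.rpow_const (.inr hp0.le))).liminf_eq).ge
        · simp [h, Real.zero_rpow hp0.ne']
    _ ≤ Filter.liminf (fun k => ∫⁻ x, ENNReal.ofReal (‖F k x‖ ^ p) ∂μ) Filter.atTop :=
        lintegral_liminf_le' fun k => ((hF k).norm.aemeasurable.pow_const p).ennreal_ofReal
    _ ≤ B := by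
        refine (Filter.liminf_le_liminf (Filter.Eventually.of_forall hB)).trans ?_
        simp

theorem integrable_indicator_qcube {p : ℝ} (hp : 1 ≤ p) {f : Rd d → ℂ} (hf : Measurable f)
    (hfi : ∫⁻ y, ENNReal.ofReal (‖f y‖ ^ p) ≠ ⊤) (z : Fin d → ℤ) :
    Integrable ((qcube d z).indicator f) := by
  rw [integrable_indicator_iff (measurableSet_qcube z)]
  refine ⟨hf.aestronglyMeasurable, lt_top_iff_ne_top.2 fun h => hfi ?_⟩
  have h1 := lintegral_qcube_rpow_le hp hf z
  rw [h, ENNReal.top_rpow_of_pos (by linarith), top_le_iff] at h1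
  exact top_le_iff.1 (h1 ▸ setLIntegral_le_lintegral _ _)

theorem integrable_indicator_cubeUnion {p : ℝ} (hp : 1 ≤ p) {f : Rd d → ℂ} (hf : Measurable f)
    (hfi : ∫⁻ y, ENNReal.ofReal (‖f y‖ ^ p) ≠ ⊤) (Z : Finset (Fin d → ℤ)) :
    Integrable ((cubeUnion Z).indicator f) := by
  rw [← funext (sum_indicator_qcube Z f)]
  exact integrable_finsetSum _ fun z _ => integrable_indicator_qcube hp hf hfi z

theorem IsDistFn.integrable_conv_integrand (ha : IsDistFn a) (hη : IsBump η) (s : ℝ)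
    {b : Rd d → ℂ} (hb : Integrable b) (x : Rd d) :
    Integrable fun y => Kker a η s (x - y) * b y := by
  obtain ⟨C, hC⟩ := ha.exists_norm_Kker_le hη s
  exact hb.bdd_mul
    ((ha.continuous_Kker hη s).comp (continuous_const.sub continuous_id)).aestronglyMeasurable
    (Filter.Eventually.of_forall fun y => hC _)

theorem IsDistFn.conv_indicator_cubeUnion (ha : IsDistFn a) (hη : IsBump η) (s : ℝ) {p : ℝ}
    (hp : 1 ≤ p) {f : Rd d → ℂ} (hf : Measurable f)
    (hfi : ∫⁻ y, ENNReal.ofReal (‖f y‖ ^ p) ≠ ⊤) (Z : Finset (Fin d → ℤ)) (x : Rd d) :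
    conv (Kker a η s) ((cubeUnion Z).indicator f) x =
      ∑ z ∈ Z, conv (Kker a η s) ((qcube d z).indicator f) x := by
  simp only [conv, ← sum_indicator_qcube, Finset.mul_sum]
  exact integral_finsetSum _ fun z _ =>
    ha.integrable_conv_integrand hη s (integrable_indicator_qcube hp hf hfi z) x

theorem IsDistFn.tendsto_conv_cubeUnion (ha : IsDistFn a) (hη : IsBump η) (s : ℝ) {p : ℝ}
    (hp : 1 ≤ p) {f : Rd d → ℂ} (hf : Measurable f)
    (hfi : ∫⁻ y, ENNReal.ofReal (‖f y‖ ^ p) ≠ ⊤) (x : Rd d) :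
    Filter.Tendsto (fun k : ℕ => conv (Kker a η s) ((cubeUnion
      (Fintype.piFinset fun _ => Finset.Icc (-k : ℤ) k)).indicator f) x) Filter.atTop
      (nhds (conv (Kker a η s) f x)) := by
  have hp0 : 0 < p := by linarith
  obtain ⟨C, hC⟩ := ha.exists_norm_Kker_le hη s
  have hC0 : 0 ≤ C := (norm_nonneg _).trans (hC 0)
  have hKc : Continuous fun y => Kker a η s (x - y) :=
    (ha.continuous_Kker hη s).comp (continuous_const.sub continuous_id)
  have hfp : Integrable fun y => ‖f y‖ ^ p := by
    refine ⟨(hf.norm.pow_const p).aestronglyMeasurable, ?_⟩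
    rw [hasFiniteIntegral_iff_ofReal (Filter.Eventually.of_forall fun y => by positivity)]
    exact lt_top_iff_ne_top.2 hfi
  refine tendsto_integral_of_dominated_convergence
    (fun y => ‖Kker a η s (x - y)‖ + C * ‖f y‖ ^ p) (fun k => ?_) ?_ (fun k => ?_) ?_
  · exact (hKc.measurable.mul (hf.indicator (measurableSet_cubeUnion _))).aestronglyMeasurable
  · exact ((ha.integrable_Kker hη s).comp_sub_left x).norm.add (hfp.const_mul C)
  · refine Filter.Eventually.of_forall fun y => ?_
    have h1 : ‖f y‖ ≤ 1 + ‖f y‖ ^ p := by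
      rcases le_total ‖f y‖ 1 with h | h
      · have : 0 ≤ ‖f y‖ ^ p := by positivity
        linarith
      · have := Real.self_le_rpow_of_one_le h hp
        linarith
    calc ‖Kker a η s (x - y) * (cubeUnion _).indicator f y‖
        ≤ ‖Kker a η s (x - y)‖ * ‖f y‖ := by
          rw [norm_mul]
          gcongr
          exact norm_indicator_le_norm_self _ _
      _ ≤ ‖Kker a η s (x - y)‖ * (1 + ‖f y‖ ^ p) := by gcongr
      _ ≤ ‖Kker a η s (x - y)‖ + C * ‖f y‖ ^ p := by
          rw [mul_add, mul_one]
          gcongr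
          exact hC _
  · refine Filter.Eventually.of_forall fun y => tendsto_const_nhds.congr' ?_
    obtain ⟨N, hN⟩ : ∃ N : ℕ, ∀ i, |⌊y i⌋| ≤ (N : ℤ) :=
      ⟨∑ i, (⌊y i⌋).natAbs, fun i => by
        rw [Int.abs_eq_natAbs]
        exact_mod_cast Finset.single_le_sum (f := fun i => (⌊y i⌋).natAbs)
          (fun _ _ => Nat.zero_le _) (Finset.mem_univ i)⟩
    filter_upwards [Filter.eventually_ge_atTop N] with k hk
    rw [indicator_of_mem]
    refine mem_biUnion (x := fun i => ⌊y i⌋) ?_ (mem_qcube_iff.2 rfl)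
    simp only [Finset.mem_coe, Fintype.mem_piFinset, Finset.mem_Icc, ← abs_le]
    exact fun i => (hN i).trans (by exact_mod_cast hk)

end Reduction

section Superposition

variable {d : ℕ} {a : Rd d → ℝ} {η : ℝ → ℝ}

theorem sqrtWt_sq_mul_rpow (hd : 1 ≤ d) (n : ℕ) {p J : ℝ} (hp : 1 ≤ p) (hJ : 0 ≤ J) :
    sqrtWt d n ^ 2 * ((sqrtWt d n)⁻¹ * J) ^ p =
      (1 + (n : ℝ)) ^ (p * ((d : ℝ) - 1) * (1 / p - 1 / 2)) * J ^ p := by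
  have hn : (0 : ℝ) < 1 + n := by positivity
  have hs : sqrtWt d n = (1 + (n : ℝ)) ^ (((d : ℝ) - 1) / 2) := by
    rw [sqrtWt, Real.sqrt_eq_rpow, ← Real.rpow_natCast, ← Real.rpow_mul hn.le, Nat.cast_sub hd]
    congr 1
    push_cast
    ring
  rw [Real.mul_rpow (inv_nonneg.2 (sqrtWt_pos d n).le) hJ, ← mul_assoc, hs, ← Real.rpow_neg hn.le,
    ← Real.rpow_mul hn.le, ← Real.rpow_natCast, ← Real.rpow_mul hn.le, ← Real.rpow_add hn]
  congr 2
  field_simp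
  push_cast
  ring

theorem conv_eq_zero_of_ae {K b : Rd d → ℂ} (hb : b =ᵐ[volume] 0) (x : Rd d) :
    conv K b x = 0 := by
  refine integral_eq_zero_of_ae ?_
  filter_upwards [hb] with y hy
  simp [hy]

/-- The model inequality for finitely many `n` and functions truncated to finitely many unit cubes. -/
theorem IsDistFn.exists_lintegral_sum_conv_cubeUnion_le (ha : IsDistFn a) (hc : CurvNondeg a)
    (hη : IsBump η) (hd : 4 ≤ d) {p : ℝ} (hp : 1 ≤ p)
    (hp2 : p < 2 * ((d : ℝ) - 1) / ((d : ℝ) + 1)) :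
    ∃ C : ℝ≥0, ∀ (u : ℝ) (f : ℕ → Rd d → ℂ) (N : ℕ) (Z : Finset (Fin d → ℤ)), 0 ≤ u → u < 1 →
      (∀ n, Measurable (f n)) → (∀ n, 2 ≤ n → ∫⁻ y, ENNReal.ofReal (‖f n y‖ ^ p) ≠ ⊤) →
      ∫⁻ x, ENNReal.ofReal (‖∑ n ∈ Finset.Ico 2 N,
        conv (Kker a η (n + u)) ((cubeUnion Z).indicator (f n)) x‖ ^ p) ≤
      C * ∑ n ∈ Finset.Ico 2 N,
        ENNReal.ofReal ((1 + (n : ℝ)) ^ (p * ((d : ℝ) - 1) * (1 / p - 1 / 2))) *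
          ∫⁻ y, ENNReal.ofReal (‖f n y‖ ^ p) := by
  have hp0 : 0 < p := by linarith
  obtain ⟨C, hC⟩ := ha.exists_lintegral_superpos_rpow_le hc hη hd hp hp2
  refine ⟨C, fun u f N Z hu hu' hf hfi => ?_⟩
  set I : ℕ × (Fin d → ℤ) → ℝ≥0∞ := fun e => ∫⁻ y in qcube d e.2, ‖f e.1 y‖ₑ with hI
  set γ : ℕ × (Fin d → ℤ) → ℝ := fun e => (sqrtWt d e.1)⁻¹ * (I e).toReal with hγ
  set b : ℕ × (Fin d → ℤ) → Rd d → ℂ := fun e y =>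
    ((sqrtWt d e.1 : ℂ))⁻¹ * (qcube d e.2).indicator (f e.1) y with hb
  set E₀ := Finset.Ico 2 N ×ˢ Z with hE₀
  set E := E₀.filter fun e => 0 < γ e with hE
  have hmem : ∀ e ∈ E₀, 2 ≤ e.1 := fun e he =>
    (Finset.mem_Ico.1 (Finset.mem_product.1 he).1).1
  have hIfin : ∀ e ∈ E₀, I e ≠ ⊤ := fun e he h => by
    have h1 := lintegral_qcube_rpow_le hp (hf e.1) e.2
    rw [show ∫⁻ y in qcube d e.2, ‖f e.1 y‖ₑ = ⊤ from h, ENNReal.top_rpow_of_pos hp0,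
      top_le_iff] at h1
    exact hfi e.1 (hmem e he) (top_le_iff.1 (h1 ▸ setLIntegral_le_lintegral _ _))
  have hIeq : ∀ e, ∫⁻ y, ‖(qcube d e.2).indicator (f e.1) y‖ₑ = I e := fun e => by
    simp only [enorm_indicator_eq_indicator_enorm]
    rw [lintegral_indicator (measurableSet_qcube _)]
  have hatom : IsAtomFamily E b γ := by
    refine ⟨fun e _ => ((hf e.1).indicator (measurableSet_qcube _)).const_mul _,
      fun e _ y hy => by simp [hb, hy], fun e he => ?_, fun e he => (Finset.mem_filter.1 he).2,
      fun e he => one_le_two.trans (hmem e (Finset.mem_filter.1 he).1)⟩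
    have hs := sqrtWt_pos d e.1
    simp only [hb, hγ, enorm_mul]
    rw [lintegral_const_mul _ ((hf e.1).indicator (measurableSet_qcube _)).enorm, hIeq,
      ENNReal.ofReal_mul (inv_nonneg.2 hs.le),
      ENNReal.ofReal_toReal (hIfin e (Finset.mem_filter.1 he).1), enorm_inv
      (by exact_mod_cast hs.ne'), enorm_sqrtWt, ENNReal.ofReal_inv_of_pos hs]
  have hsum : ∀ x, ∑ n ∈ Finset.Ico 2 N,
      conv (Kker a η (n + u)) ((cubeUnion Z).indicator (f n)) x = superpos a η u E b x := by
    intro x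
    calc ∑ n ∈ Finset.Ico 2 N, conv (Kker a η (n + u)) ((cubeUnion Z).indicator (f n)) x
        = ∑ n ∈ Finset.Ico 2 N, ∑ z ∈ Z,
            conv (Kker a η (n + u)) ((qcube d z).indicator (f n)) x :=
          Finset.sum_congr rfl fun n hn => ha.conv_indicator_cubeUnion hη _ hp (hf n)
            (hfi n (Finset.mem_Ico.1 hn).1) Z x
      _ = ∑ e ∈ E₀, conv (Kker a η (e.1 + u)) ((qcube d e.2).indicator (f e.1)) x :=
          by rw [hE₀, Finset.sum_product]
      _ = ∑ e ∈ E, conv (Kker a η (e.1 + u)) ((qcube d e.2).indicator (f e.1)) x := by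
          refine (Finset.sum_subset (Finset.filter_subset _ _) fun e he he' => ?_).symm
          have h0 : (I e).toReal = 0 := by
            by_contra h
            exact he' (Finset.mem_filter.2 ⟨he, mul_pos (inv_pos.2 (sqrtWt_pos d e.1))
              (lt_of_le_of_ne ENNReal.toReal_nonneg (Ne.symm h))⟩)
          have h1 : I e = 0 := by
            simpa [hIfin e he] using (ENNReal.toReal_eq_zero_iff _).1 h0
          rw [← hIeq, lintegral_eq_zero_iff
            ((hf e.1).indicator (measurableSet_qcube _)).enorm] at h1
          refine conv_eq_zero_of_ae ?_ x
          filter_upwards [h1] with y hy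
          simpa using hy
      _ = superpos a η u E b x := by
          refine Finset.sum_congr rfl fun e _ => ?_
          have hs : (sqrtWt d e.1 : ℂ) ≠ 0 := by exact_mod_cast (sqrtWt_pos d e.1).ne'
          simp only [hb]
          rw [conv_const_mul, mul_inv_cancel_left₀ hs]
  simp only [hsum]
  refine (hC u E b γ hu hu' hatom).trans (mul_le_mul_right ?_ _)
  have hterm : ∀ e, 0 ≤ sqrtWt d e.1 ^ 2 * γ e ^ p := fun e => by
    have := sqrtWt_pos d e.1
    positivity
  calc ENNReal.ofReal (∑ e ∈ E, sqrtWt d e.1 ^ 2 * γ e ^ p)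
      ≤ ENNReal.ofReal (∑ e ∈ E₀, sqrtWt d e.1 ^ 2 * γ e ^ p) :=
        ENNReal.ofReal_le_ofReal (Finset.sum_le_sum_of_subset_of_nonneg
          (Finset.filter_subset _ _) fun e _ _ => hterm e)
    _ = ∑ e ∈ E₀, ENNReal.ofReal ((1 + (e.1 : ℝ)) ^ (p * ((d : ℝ) - 1) * (1 / p - 1 / 2))) *
          I e ^ p := by
        rw [ENNReal.ofReal_sum_of_nonneg fun e _ => hterm e]
        refine Finset.sum_congr rfl fun e he => ?_
        rw [hγ, sqrtWt_sq_mul_rpow (by omega) _ hp ENNReal.toReal_nonneg,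
          ENNReal.ofReal_mul (by positivity),
          ← ENNReal.ofReal_rpow_of_nonneg ENNReal.toReal_nonneg hp0.le,
          ENNReal.ofReal_toReal (hIfin e he)]
    _ = ∑ n ∈ Finset.Ico 2 N,
          ENNReal.ofReal ((1 + (n : ℝ)) ^ (p * ((d : ℝ) - 1) * (1 / p - 1 / 2))) *
            ∑ z ∈ Z, I (n, z) ^ p := by
        rw [hE₀, Finset.sum_product]
        simp only [Finset.mul_sum]
    _ ≤ _ := by
        refine Finset.sum_le_sum fun n _ => mul_le_mul_right ?_ _
        exact (Finset.sum_le_sum fun z _ => lintegral_qcube_rpow_le hp (hf n) z).trans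
          (sum_lintegral_qcube_le Z _)

/-- Bounds for truncated sums pass to the full series. -/
theorem IsDistFn.lintegral_tsum_conv_le (ha : IsDistFn a) (hη : IsBump η) {p : ℝ} (hp : 1 ≤ p)
    {u : ℝ} {f : ℕ → Rd d → ℂ} (hf : ∀ n, Measurable (f n))
    (hfi : ∀ n, 2 ≤ n → ∫⁻ y, ENNReal.ofReal (‖f n y‖ ^ p) ≠ ⊤) {B : ℝ≥0∞}
    (hB : ∀ (N : ℕ) (Z : Finset (Fin d → ℤ)), ∫⁻ x, ENNReal.ofReal (‖∑ n ∈ Finset.Ico 2 N,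
      conv (Kker a η (n + u)) ((cubeUnion Z).indicator (f n)) x‖ ^ p) ≤ B) :
    ∫⁻ x, ENNReal.ofReal (‖∑' n : ℕ, if 2 ≤ n then
      conv (Kker a η (n + u)) (f n) x else 0‖ ^ p) ≤ B := by
  set Zk : ℕ → Finset (Fin d → ℤ) := fun k => Fintype.piFinset fun _ => Finset.Icc (-k : ℤ) k
  have hlim : ∀ (N : ℕ) (x : Rd d), Filter.Tendsto (fun k => ∑ n ∈ Finset.Ico 2 N,
      conv (Kker a η (n + u)) ((cubeUnion (Zk k)).indicator (f n)) x) Filter.atTop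
      (nhds (∑ n ∈ Finset.Ico 2 N, conv (Kker a η (n + u)) (f n) x)) := fun N x =>
    tendsto_finsetSum _ fun n hn =>
      ha.tendsto_conv_cubeUnion hη _ hp (hf n) (hfi n (Finset.mem_Ico.1 hn).1) x
  have hmeas : ∀ (N k : ℕ), AEStronglyMeasurable (fun x => ∑ n ∈ Finset.Ico 2 N,
      conv (Kker a η (n + u)) ((cubeUnion (Zk k)).indicator (f n)) x) volume := fun N k =>
    Finset.aestronglyMeasurable_fun_sum _ fun n hn => (ha.integrable_conv hη _
      (integrable_indicator_cubeUnion hp (hf n) (hfi n (Finset.mem_Ico.1 hn).1) _)).1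
  refine lintegral_rpow_le_of_tendsto hp
    (F := fun N x => ∑ n ∈ Finset.Ico 2 N, conv (Kker a η (n + u)) (f n) x)
    (fun N => aestronglyMeasurable_of_tendsto_ae Filter.atTop (hmeas N)
      (Filter.Eventually.of_forall (hlim N))) (fun x => ?_)
    fun N => lintegral_rpow_le_of_tendsto hp (hmeas N) (fun x => .inl (hlim N x))
      fun k => hB N (Zk k)
  by_cases hs : Summable fun n : ℕ => if 2 ≤ n then conv (Kker a η (n + u)) (f n) x else 0
  · left
    convert hs.hasSum.tendsto_sum_nat using 2 with N
    rw [← Finset.sum_filter]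
    refine Finset.sum_congr ?_ fun _ _ => rfl
    ext n
    simp [and_comm]
  · exact .inr (tsum_eq_zero_of_not_summable hs)

end Superposition

/-- the discretized model inequality, uniformly in `0 ≤ u < 1`:
`‖∑_{n≥2} K_{n+u} ∗ f(n,·)‖_p^p ≲ ∑_{n≥2} (1+n)^{p(d-1)(1/p-1/2)} ∫ |f(n,y)|^p dy`. -/
theorem statement3 (d : ℕ) (hd : 4 ≤ d) (a : Rd d → ℝ) (ha : IsDistFn a)
    (hcurv : CurvNondeg a) (η : ℝ → ℝ) (hη : IsBump η)
    (p : ℝ) (hp1 : 1 ≤ p) (hp2 : p < 2 * ((d : ℝ) - 1) / ((d : ℝ) + 1)) :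
    ∃ C : ℝ, 0 < C ∧ ∀ u : ℝ, 0 ≤ u → u < 1 → ∀ f : ℕ × Rd d → ℂ,
      (∀ n : ℕ, Measurable fun y => f (n, y)) →
      eLpNorm (fun x : Rd d => ∑' n : ℕ,
            if 2 ≤ n then conv (Kker a η ((n : ℝ) + u)) (fun y => f (n, y)) x else 0)
          (ENNReal.ofReal p) volume ^ p ≤
        ENNReal.ofReal C * ∑' n : ℕ,
          (if 2 ≤ n then
            ENNReal.ofReal ((1 + (n : ℝ)) ^ (p * ((d : ℝ) - 1) * (1 / p - 1 / 2))) *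
              ∫⁻ y : Rd d, ENNReal.ofReal (‖f (n, y)‖ ^ p) ∂volume
          else 0) := by
  obtain ⟨C, hC⟩ := ha.exists_lintegral_sum_conv_cubeUnion_le hcurv hη hd hp1 hp2
  refine ⟨C + 1, by positivity, fun u hu hu' f hf => ?_⟩
  rw [eLpNorm_rpow_eq hp1]
  by_cases hfi : ∀ n, 2 ≤ n → ∫⁻ y, ENNReal.ofReal (‖f (n, y)‖ ^ p) ≠ ⊤
  · refine ha.lintegral_tsum_conv_le hη hp1 hf hfi fun N Z =>
      (hC u (fun n y => f (n, y)) N Z hu hu' hf hfi).trans ?_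
    gcongr
    · rw [← ENNReal.ofReal_coe_nnreal]
      exact ENNReal.ofReal_le_ofReal (by linarith)
    · refine le_trans (le_of_eq ?_) (ENNReal.sum_le_tsum (Finset.Ico 2 N))
      exact Finset.sum_congr rfl fun n hn => by rw [if_pos (Finset.mem_Ico.1 hn).1]
  · push Not at hfi
    obtain ⟨n, hn, hn'⟩ := hfi
    refine le_top.trans (le_of_eq ?_)
    symm
    refine ENNReal.mul_eq_top.2 (.inl ⟨(ENNReal.ofReal_pos.2 (by positivity)).ne',
      top_le_iff.1 (le_trans (le_of_eq ?_) (ENNReal.le_tsum n))⟩)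
    rw [if_pos hn, hn', ENNReal.mul_top (ENNReal.ofReal_pos.2 (by positivity)).ne']
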